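/- For a general surface S'_26 ⊂ P^5 (the projection from a general point outside the secant variety of a septic surface in P^6 with one node, which is itself the projection of a smooth del Pezzo surface of degree 7 in P^7 from a general point of its secant variety), the space H^0(I²_{S'_26}(5)) of quintic forms vanishing to order at least 2 along S'_26 has dimension 8, so |H^0(I²_{S'_26}(5))| = P^7. -/

import Mathlib

/-!
Common framework: a set-theoretic model of complex projective algebraic
geometry in `ℙⁿ = Projectivization ℂ (Fin (n+1) → ℂ)`, sufficient to state
the results of Russo–Stagliano, "Explicit rationality of some cubic fourfolds".
-/

noncomputable section
open MvPolynomial Filter Set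
open scoped Classical

namespace CF

/-- Polynomials in `n` variables over `ℂ` (forms on `ℙ^(n-1)` when homogeneous). -/
abbrev Pl (n : ℕ) := MvPolynomial (Fin n) ℂ

/-- Complex projective `n`-space. -/
abbrev Pr (n : ℕ) := Projectivization ℂ (Fin (n + 1) → ℂ)

/-- The affine cone (set of nonzero representative vectors) over a subset of `ℙⁿ`. -/
def cone {n : ℕ} (Z : Set (Pr n)) : Set (Fin (n + 1) → ℂ) :=
  {v | ∃ h : v ≠ 0, Projectivization.mk ℂ v h ∈ Z}

/-- The common zero locus in `ℙⁿ` of a set of polynomials. -/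
def zeroSet {n : ℕ} (T : Set (Pl (n + 1))) : Set (Pr n) :=
  {x | ∀ f ∈ T, ∀ v ∈ cone ({x} : Set (Pr n)), eval v f = 0}

/-- Zariski-closed (algebraic) subsets of `ℙⁿ`. -/
def IsAlg {n : ℕ} (Z : Set (Pr n)) : Prop :=
  ∃ T : Set (Pl (n + 1)), (∀ f ∈ T, ∃ d, f.IsHomogeneous d) ∧ Z = zeroSet T

/-- Zariski closure. -/
def algClosure {n : ℕ} (A : Set (Pr n)) : Set (Pr n) := ⋂₀ {Z | IsAlg Z ∧ A ⊆ Z}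

/-- `A` is a (Zariski-)dense subset of `X`. -/
def DenseIn {n : ℕ} (A X : Set (Pr n)) : Prop := A ⊆ X ∧ X ⊆ algClosure A

/-- Irreducibility with respect to the Zariski topology. -/
def IsIrr {n : ℕ} (X : Set (Pr n)) : Prop :=
  X.Nonempty ∧ ∀ Z₁ Z₂ : Set (Pr n), IsAlg Z₁ → IsAlg Z₂ → X ⊆ Z₁ ∪ Z₂ → (X ⊆ Z₁ ∨ X ⊆ Z₂)

/-- Dimension of `X`: Krull dimension of the poset of irreducible algebraic
subsets of `X`. -/
def dim {n : ℕ} (X : Set (Pr n)) : WithBot ℕ∞ :=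
  Order.krullDim {W : Set (Pr n) // IsAlg W ∧ IsIrr W ∧ W ⊆ X}

/-- The (saturated) homogeneous vanishing ideal of `Z ⊆ ℙⁿ`. -/
def vIdeal {n : ℕ} (Z : Set (Pr n)) : Ideal (Pl (n + 1)) :=
  ⨅ v ∈ cone Z, RingHom.ker (MvPolynomial.eval v)

/-- Hilbert function of a homogeneous ideal: dimension of the degree `d` graded
piece of the quotient ring. -/
def hilb {n : ℕ} (I : Ideal (Pl n)) (d : ℕ) : ℕ :=
  Module.finrank ℂ
    ((homogeneousSubmodule (Fin n) ℂ d).map (Ideal.Quotient.mkₐ ℂ I).toLinearMap)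

/-- A finite scheme cut out by a homogeneous ideal `I` has length `L`
(the eventual value of the Hilbert function). -/
def HasLen {n : ℕ} (I : Ideal (Pl n)) (L : ℕ) : Prop := ∀ᶠ d in atTop, hilb I d = L

/-- The scheme-theoretic intersection `C ∩ S` has length `L`. -/
def interLength {n : ℕ} (C S : Set (Pr n)) (L : ℕ) : Prop := HasLen (vIdeal C ⊔ vIdeal S) L

/-- `Z` has Hilbert polynomial `p`. -/
def HasHilbPoly {n : ℕ} (Z : Set (Pr n)) (p : Polynomial ℚ) : Prop :=
  ∀ᶠ d in atTop, (hilb (vIdeal Z) d : ℚ) = p.eval (d : ℚ)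

/-- `Z` is `k`-dimensional of degree `e` (leading term `e·dᵏ/k!` of the
Hilbert polynomial). -/
def HasDegree {n : ℕ} (Z : Set (Pr n)) (k e : ℕ) : Prop :=
  ∃ p : Polynomial ℚ, HasHilbPoly Z p ∧ p.natDegree ≤ k ∧
    p.coeff k = (e : ℚ) / (Nat.factorial k)

/-- A curve `C` has degree `e` (Hilbert polynomial `e·d + c`). -/
def CurveDeg {n : ℕ} (C : Set (Pr n)) (e : ℕ) : Prop :=
  ∃ c : ℤ, ∀ᶠ d in atTop, (hilb (vIdeal C) d : ℤ) = e * d + c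

/-- A curve `C` has degree `e` and arithmetic genus `g`
(Hilbert polynomial `e·d + 1 - g`). -/
def CurveDegGenus {n : ℕ} (C : Set (Pr n)) (e : ℕ) (g : ℤ) : Prop :=
  ∀ᶠ d in atTop, (hilb (vIdeal C) d : ℤ) = e * d + 1 - g

/-- Iterated partial derivative operator. -/
def diffOp {n : ℕ} (l : List (Fin n)) : Pl n →ₗ[ℂ] Pl n :=
  l.foldr (fun i L => L ∘ₗ (pderiv i).toLinearMap) LinearMap.id

/-- The vector space of degree-`d` forms in `n` variables vanishing to order
`≥ e` at every point of a set `A` of vectors. -/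
def linSysV (n d e : ℕ) (A : Set (Fin n → ℂ)) : Submodule ℂ (Pl n) :=
  homogeneousSubmodule (Fin n) ℂ d ⊓
    ⨅ (l : List (Fin n)) (_ : l.length < e) (v : Fin n → ℂ) (_ : v ∈ A),
      LinearMap.ker ((aeval (R := ℂ) v).toLinearMap ∘ₗ diffOp l)

/-- `H⁰(𝐼_Z^e(d))`: degree-`d` forms with points of multiplicity `≥ e` along
`Z ⊆ ℙⁿ`. -/
def linSys {n : ℕ} (d e : ℕ) (Z : Set (Pr n)) : Submodule ℂ (Pl (n + 1)) :=
  linSysV (n + 1) d e (cone Z)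

/-- `h⁰(𝐼_Z^e(d))`. -/
def h0 {n : ℕ} (d e : ℕ) (Z : Set (Pr n)) : ℕ := Module.finrank ℂ ↥(linSys d e Z)

/-- A base point of projective space. -/
def Pr.pt (m : ℕ) : Pr m :=
  Projectivization.mk ℂ (fun _ => (1 : ℂ)) (fun h => one_ne_zero (congrFun h 0))

/-- A rational map `ℙⁿ ⇢ ℙᵐ` given by `m+1` forms of the same degree. -/
structure RatMap (n m : ℕ) where
  F : Fin (m + 1) → Pl (n + 1)
  deg : ℕ
  homog : ∀ i, (F i).IsHomogeneous deg
  nontriv : ∃ x : Pr n, (fun i => eval x.rep (F i)) ≠ 0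

/-- Locus where a rational map is defined. -/
def RatMap.dom {n m : ℕ} (φ : RatMap n m) : Set (Pr n) :=
  {x | (fun i => eval x.rep (φ.F i)) ≠ 0}

/-- The underlying (partial) function of a rational map. -/
def RatMap.app {n m : ℕ} (φ : RatMap n m) (x : Pr n) : Pr m :=
  if h : (fun i => eval x.rep (φ.F i)) ≠ 0 then Projectivization.mk ℂ _ h else Pr.pt m

/-- `b` is a basis of the subspace `W`. -/
def IsBasisOf {M : Type*} [AddCommGroup M] [Module ℂ M] {k : ℕ}
    (b : Fin k → M) (W : Submodule ℂ M) : Prop :=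
  (∀ i, b i ∈ W) ∧ LinearIndependent ℂ b ∧ Submodule.span ℂ (Set.range b) = W

/-- The rational map `φ` is defined by (a basis of) the linear system `W`. -/
def RatMap.definedBy {n m : ℕ} (φ : RatMap n m) (W : Submodule ℂ (Pl (n + 1))) : Prop :=
  IsBasisOf φ.F W

/-- `f` restricts to a birational map from `X` onto `Y`:
it is a bijection between dense subsets. -/
def BirationalOn {n m : ℕ} (f : Pr n → Pr m) (X : Set (Pr n)) (Y : Set (Pr m)) : Prop :=
  ∃ U V, DenseIn U X ∧ DenseIn V Y ∧ Set.BijOn f U V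

/-- Closure of the image of `X` under the rational map `φ`. -/
def RatMap.im {n m : ℕ} (φ : RatMap n m) (X : Set (Pr n)) : Set (Pr m) :=
  algClosure (φ.app '' (X ∩ φ.dom))

/-- `X ⊆ ℙⁿ` is rational of dimension `k`: birational to `ℙᵏ`. -/
def Rational {n : ℕ} (X : Set (Pr n)) (k : ℕ) : Prop :=
  ∃ φ : RatMap n k, BirationalOn φ.app X Set.univ

/-- `Q` holds generically (off a proper algebraic subset) on `X`. -/
def Generically {n : ℕ} (X : Set (Pr n)) (Q : Pr n → Prop) : Prop :=
  ∃ Z, IsAlg Z ∧ ¬ X ⊆ Z ∧ ∀ x ∈ X \ Z, Q x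

/-- `Q` holds for a generic choice of affine parameters indexed by `ι`. -/
def GenericAff {ι : Type} (Q : ((ι → ℂ)) → Prop) : Prop :=
  ∃ P : MvPolynomial ι ℂ, P ≠ 0 ∧ ∀ v, eval v P ≠ 0 → Q v

/-- Polynomial functions on a complex vector space. -/
def polyFun (V : Type*) [AddCommGroup V] [Module ℂ V] : Subalgebra ℂ (V → ℂ) :=
  Algebra.adjoin ℂ (Set.range fun φ : Module.Dual ℂ V => (φ : V → ℂ))

/-- `Q` holds generically on the subset `A` of a complex vector space
(on a nonempty "open" subset cut by nonvanishing of a polynomial function). -/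
def GenericallyLin {V : Type*} [AddCommGroup V] [Module ℂ V]
    (A : Set V) (Q : V → Prop) : Prop :=
  ∃ P : V → ℂ, P ∈ polyFun V ∧ (∃ v ∈ A, P v ≠ 0) ∧ ∀ v ∈ A, P v ≠ 0 → Q v

/-- Zariski-closed subsets of a complex vector space. -/
def AffClosed {V : Type*} [AddCommGroup V] [Module ℂ V] (Z : Set V) : Prop :=
  ∃ T : Set (V → ℂ), (∀ f ∈ T, f ∈ polyFun V) ∧ Z = {v | ∀ f ∈ T, f v = 0}

/-- Zariski closure in a complex vector space. -/
def affClosure {V : Type*} [AddCommGroup V] [Module ℂ V] (A : Set V) : Set V :=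
  ⋂₀ {Z | AffClosed Z ∧ A ⊆ Z}

/-- The projective hypersurface `F = 0` is smooth. -/
def SmoothHypersurface {n : ℕ} (F : Pl (n + 1)) : Prop :=
  ∀ v : Fin (n + 1) → ℂ, v ≠ 0 → ¬ (∀ i, eval v (pderiv i F) = 0)

/-- Embedded (projective) tangent space of `X` at `x`. -/
def tangentSpaceAt {n : ℕ} (X : Set (Pr n)) (x : Pr n) : Set (Pr n) :=
  {y | ∀ f ∈ vIdeal X, (∑ i, y.rep i * eval x.rep (pderiv i f)) = 0}

/-- `X` is a smooth subvariety (tangent space has the right dimension at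
every point). -/
def SmoothVariety {n : ℕ} (X : Set (Pr n)) : Prop :=
  IsAlg X ∧ ∀ x ∈ X, dim (tangentSpaceAt X x) = dim X

/-- Lines in `ℙⁿ`. -/
def IsLine {n : ℕ} (L : Set (Pr n)) : Prop :=
  ∃ A : (Fin 2 → ℂ) →ₗ[ℂ] (Fin (n + 1) → ℂ), Function.Injective A ∧
    L = {x | ∃ (v : Fin 2 → ℂ) (h : A v ≠ 0), x = Projectivization.mk ℂ (A v) h}

/-- Conics in `ℙ⁵`: irreducible plane quadrics. -/
def IsConic (C : Set (Pr 5)) : Prop :=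
  ∃ A : (Fin 3 → ℂ) →ₗ[ℂ] (Fin 6 → ℂ), Function.Injective A ∧
    ∃ q : Pl 3, q.IsHomogeneous 2 ∧ q ≠ 0 ∧
      C = {x | ∃ (v : Fin 3 → ℂ) (h : A v ≠ 0),
        eval v q = 0 ∧ x = Projectivization.mk ℂ (A v) h}

/-- Standard rational normal cubic parametrization of `ℙ¹` in `ℙ³`. -/
def twistedParam (s : Fin 2 → ℂ) : Fin 4 → ℂ :=
  ![s 0 ^ 3, s 0 ^ 2 * s 1, s 0 * s 1 ^ 2, s 1 ^ 3]

/-- Twisted cubics in `ℙ⁵` (rational normal curves of degree 3). -/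
def IsTwistedCubic (C : Set (Pr 5)) : Prop :=
  ∃ A : (Fin 4 → ℂ) →ₗ[ℂ] (Fin 6 → ℂ), Function.Injective A ∧
    C = {x | ∃ (s : Fin 2 → ℂ) (h : A (twistedParam s) ≠ 0),
      x = Projectivization.mk ℂ (A (twistedParam s)) h}

/-- Secant variety of `Z ⊆ ℙⁿ`. -/
def secantVariety {n : ℕ} (Z : Set (Pr n)) : Set (Pr n) :=
  algClosure {y | ∃ u v : Fin (n + 1) → ℂ, u ∈ cone Z ∧ v ∈ cone Z ∧
    y.rep ∈ Submodule.span ℂ ({u, v} : Set (Fin (n + 1) → ℂ))}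

/-- Closure of the image of the rational map `ℙ^(m-1) ⇢ ℙⁿ` given by the
polynomials `b i`. -/
def imClos {m n : ℕ} (b : Fin (n + 1) → Pl m) : Set (Pr n) :=
  algClosure {x | ∃ (v : Fin m → ℂ) (h : (fun i => eval v (b i)) ≠ 0),
    x = Projectivization.mk ℂ _ h}

/-- The (partial) map on projective spaces induced by a linear map. -/
def projPt {N n : ℕ} (L : (Fin (N + 1) → ℂ) →ₗ[ℂ] (Fin (n + 1) → ℂ)) (x : Pr N) : Pr n :=
  if h : L x.rep ≠ 0 then Projectivization.mk ℂ (L x.rep) h else Pr.pt n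

/-- Closure of the image of `Z` under the linear projection induced by `L`. -/
def projIm {N n : ℕ} (L : (Fin (N + 1) → ℂ) →ₗ[ℂ] (Fin (n + 1) → ℂ))
    (Z : Set (Pr N)) : Set (Pr n) :=
  algClosure {y | ∃ v ∈ cone Z, ∃ h : L v ≠ 0, y = Projectivization.mk ℂ (L v) h}

/-- Double points (images of at least two points of `Z`) of the projection. -/
def doublePoints {N n : ℕ} (L : (Fin (N + 1) → ℂ) →ₗ[ℂ] (Fin (n + 1) → ℂ))
    (Z : Set (Pr N)) : Set (Pr n) :=
  {y | ∃ x₁ x₂, x₁ ∈ Z ∧ x₂ ∈ Z ∧ x₁ ≠ x₂ ∧ projPt L x₁ = y ∧ projPt L x₂ = y}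

/-- Linear map from a matrix of parameters. -/
def matLin {p q : ℕ} (M : Fin p × Fin q → ℂ) : (Fin q → ℂ) →ₗ[ℂ] (Fin p → ℂ) :=
  Matrix.mulVecLin (Matrix.of fun i j => M (i, j))

/-- Linear form with coefficient vector `c`. -/
def linForm {m : ℕ} (c : Fin m → ℂ) : Pl m := ∑ i, C (c i) * X i

/-- Parametrization of the rational normal scroll `S(a,b)`. -/
def scrollVec (a b : ℕ) {n : ℕ} (v : Fin 4 → ℂ) : Fin (n + 1) → ℂ := fun i =>
  if i.val ≤ a then v 2 * v 0 ^ (a - i.val) * v 1 ^ i.val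
  else v 3 * v 0 ^ (a + b + 1 - i.val) * v 1 ^ (i.val - (a + 1))

/-- The standard rational normal scroll `S(a,b) ⊆ ℙⁿ` (`n = a + b + 1`). -/
def stdScroll (a b n : ℕ) : Set (Pr n) :=
  {x | ∃ (v : Fin 4 → ℂ) (h : scrollVec a b (n := n) v ≠ 0),
    x = Projectivization.mk ℂ _ h}

/-- Smooth rational normal scroll surfaces of degree `d` in `ℙⁿ = ℙ^(d+1)`. -/
def IsRNScroll (d : ℕ) {n : ℕ} (S : Set (Pr n)) : Prop :=
  ∃ a b : ℕ, 1 ≤ a ∧ 1 ≤ b ∧ a + b = d ∧ a + b + 1 = n ∧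
    ∃ g : (Fin (n + 1) → ℂ) ≃ₗ[ℂ] (Fin (n + 1) → ℂ),
      S = Projectivization.map (g : (Fin (n+1) → ℂ) →ₗ[ℂ] (Fin (n+1) → ℂ)) g.injective ''
        stdScroll a b n
/-- The 10 ordered pairs `i < j` in `Fin 5`. -/
def pairs4 : Fin 10 → Fin 5 × Fin 5 :=
  ![(0,1),(0,2),(0,3),(0,4),(1,2),(1,3),(1,4),(2,3),(2,4),(3,4)]

/-- Plücker coordinates of the line spanned by `u, v` in `ℙ⁴`. -/
def pluck4 (u v : Fin 5 → ℂ) : Fin 10 → ℂ := fun p =>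
  u (pairs4 p).1 * v (pairs4 p).2 - u (pairs4 p).2 * v (pairs4 p).1

/-- The Grassmannian `𝔾(1,4) ⊆ ℙ⁹` of lines in `ℙ⁴`, Plücker embedded. -/
def G14 : Set (Pr 9) :=
  {x | ∃ (u v : Fin 5 → ℂ) (h : pluck4 u v ≠ 0), x = Projectivization.mk ℂ (pluck4 u v) h}

/-- The 15 ordered pairs `i < j` in `Fin 6`. -/
def pairs5 : Fin 15 → Fin 6 × Fin 6 :=
  ![(0,1),(0,2),(0,3),(0,4),(0,5),(1,2),(1,3),(1,4),(1,5),(2,3),(2,4),(2,5),(3,4),(3,5),(4,5)]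

/-- Plücker coordinates of the line spanned by `u, v` in `ℙ⁵`. -/
def pluck5 (u v : Fin 6 → ℂ) : Fin 15 → ℂ := fun p =>
  u (pairs5 p).1 * v (pairs5 p).2 - u (pairs5 p).2 * v (pairs5 p).1

/-- The Grassmannian `𝔾(1,5) ⊆ ℙ¹⁴` of lines in `ℙ⁵`, Plücker embedded. -/
def G15 : Set (Pr 14) :=
  {x | ∃ (u v : Fin 6 → ℂ) (h : pluck5 u v ≠ 0), x = Projectivization.mk ℂ (pluck5 u v) h}

/-- `Y ⊆ ℙⁿ` is (projectively equivalent to) a linear section of `G ⊆ ℙᴺ`. -/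
def IsLinearSectionOf {n N : ℕ} (Y : Set (Pr n)) (G : Set (Pr N)) : Prop :=
  ∃ (J : (Fin (n + 1) → ℂ) →ₗ[ℂ] (Fin (N + 1) → ℂ)) (hJ : Function.Injective J),
    Projectivization.map (J : (Fin (n+1) → ℂ) →ₗ[ℂ] (Fin (N+1) → ℂ)) hJ '' Y =
      G ∩ Set.range (Projectivization.map (J : (Fin (n+1) → ℂ) →ₗ[ℂ] (Fin (N+1) → ℂ)) hJ)

/-! ### The surfaces `S_d ⊆ ℙ⁵` -/

/-- The surface `S₁₄ ⊆ ℙ⁵`: isomorphic projection to `ℙ⁵` of the smooth octic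
surface of sectional genus 3 in `ℙ⁶`, image of `ℙ²` by the quartics through
the 8 points `pts`.  `b` is a basis of that system of quartics and the center
of the projection `L` avoids the secant variety. -/
def IsS14 (pts : Fin 8 → (Fin 3 → ℂ)) (S : Set (Pr 5)) : Prop :=
  ∃ b : Fin 7 → Pl 3, IsBasisOf b (linSysV 3 4 1 (Set.range pts)) ∧
    ∃ L : (Fin 7 → ℂ) →ₗ[ℂ] (Fin 6 → ℂ), Function.Surjective L ∧
      (∀ v ∈ cone (secantVariety (imClos (n := 6) b)), L v ≠ 0) ∧
      S = projIm L (imClos (n := 6) b)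

/-- The surface `S₃₈ ⊆ ℙ⁵`: image of `ℙ²` by the linear system of curves of
degree 10 with 10 triple points at `pts`. -/
def IsS38 (pts : Fin 10 → (Fin 3 → ℂ)) (S : Set (Pr 5)) : Prop :=
  ∃ b : Fin 6 → Pl 3, IsBasisOf b (linSysV 3 10 3 (Set.range pts)) ∧ S = imClos (n := 5) b

/-- Farkas–Verra surfaces: rational septic scrolls in `ℙ⁵` with 3 nodes,
projections of a rational normal septic scroll in `ℙ⁸`. -/
def IsFVScroll (S : Set (Pr 5)) : Prop :=
  ∃ Sc : Set (Pr 8), IsRNScroll 7 Sc ∧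
    ∃ L : (Fin 9 → ℂ) →ₗ[ℂ] (Fin 6 → ℂ), Function.Surjective L ∧
      (∀ v ∈ cone Sc, L v ≠ 0) ∧ S = projIm L Sc ∧
      (doublePoints L Sc).ncard = 3 ∧
      (∀ y ∈ doublePoints L Sc, ({x | x ∈ Sc ∧ projPt L x = y}).ncard = 2)

/-- Smooth del Pezzo surfaces of degree 7 in `ℙ⁷`: images of `ℙ²` by the cubics
through two distinct points. -/
def IsDelPezzo7 (S : Set (Pr 7)) : Prop :=
  ∃ p : Fin 2 → (Fin 3 → ℂ), (∀ i, p i ≠ 0) ∧ (∀ c : ℂ, p 0 ≠ c • p 1) ∧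
    ∃ b : Fin 8 → Pl 3, IsBasisOf b (linSysV 3 3 1 (Set.range p)) ∧ S = imClos (n := 7) b

/-- Octic rational scrolls `S'₃₈ ⊆ ℙ⁵` with exactly 6 nodes (`Nodes`), obtained
by projecting a smooth octic rational normal scroll in `ℙ⁹` from a `ℙ³`
meeting its secant variety in 6 points. -/
def IsS38'Nodes (S Nodes : Set (Pr 5)) : Prop :=
  ∃ Sc : Set (Pr 9), IsRNScroll 8 Sc ∧
    ∃ L : (Fin 10 → ℂ) →ₗ[ℂ] (Fin 6 → ℂ), Function.Surjective L ∧
      (∀ v ∈ cone Sc, L v ≠ 0) ∧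
      ({x | x ∈ secantVariety Sc ∧ L x.rep = 0}).ncard = 6 ∧
      S = projIm L Sc ∧ Nodes = doublePoints L Sc ∧ Nodes.ncard = 6 ∧
      (∀ y ∈ Nodes, ({x | x ∈ Sc ∧ projPt L x = y}).ncard = 2)

/-- Octic rational scrolls in `ℙ⁵` with 6 nodes. -/
def IsS38' (S : Set (Pr 5)) : Prop := ∃ Nodes, IsS38'Nodes S Nodes

/-- Smooth quintic del Pezzo surfaces `D ⊆ ℙ⁵`: images of `ℙ²` by the cubics
through 4 points in general position. -/
def IsQuinticDelPezzo (D : Set (Pr 5)) : Prop :=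
  ∃ p : Fin 4 → (Fin 3 → ℂ),
    (∀ i j k : Fin 4, i ≠ j → j ≠ k → i ≠ k → LinearIndependent ℂ ![p i, p j, p k]) ∧
    ∃ b : Fin 6 → Pl 3, IsBasisOf b (linSysV 3 3 1 (Set.range p)) ∧ D = imClos (n := 5) b

/-! ### Hassett divisors (via their geometric descriptions) -/

/-- Cubic forms whose zero locus contains a surface of the prescribed kind. -/
def cubicsContaining (P : Set (Pr 5) → Prop) : Set (Pl 6) :=
  {F | F.IsHomogeneous 3 ∧ ∃ S, P S ∧ S ⊆ zeroSet {F}}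

/-- The "divisor" of cubic forms: Zariski closure (within the cubics) of the
locus of cubics containing a surface of the prescribed kind. -/
def HassettDiv (P : Set (Pr 5) → Prop) : Set (Pl 6) :=
  affClosure (cubicsContaining P) ∩ {F | F.IsHomogeneous 3}

/-- The Hassett divisor `𝒞₁₄` (cubics containing a quintic del Pezzo surface). -/
def HassettC14 : Set (Pl 6) := HassettDiv IsQuinticDelPezzo

/-- The Hassett divisor `𝒞₂₆` (cubics containing a Farkas–Verra
3-nodal septic scroll). -/
def HassettC26 : Set (Pl 6) := HassettDiv IsFVScroll

/-- The Hassett divisor `𝒞₃₈` (cubics containing a surface `S₃₈`). -/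
def HassettC38 : Set (Pl 6) :=
  HassettDiv fun S => ∃ pts : Fin 10 → (Fin 3 → ℂ), (∀ i, pts i ≠ 0) ∧ IsS38 pts S

/-! ### Congruences of `(re-1)`-secant curves of degree `e` -/

/-- A congruence of `(r·e-1)`-secant curves of degree `e` to a surface
`S ⊆ ℙ⁵`: an irreducible proper 4-dimensional family `H` of degree-`e` curves,
whose general member is irreducible and meets `S` in a scheme of length
`r·e - 1`, and such that through a general point of `ℙ⁵` there passes exactly
one member (i.e. the tautological morphism `ψ : 𝒟 → ℙ⁵` is birational). -/
structure Congruence (S : Set (Pr 5)) (e r : ℕ) where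
  N : ℕ
  H : Set (Pr N)
  H_alg : IsAlg H
  H_irr : IsIrr H
  H_dim : dim H = 4
  curve : Pr N → Set (Pr 5)
  curve_alg : ∀ h ∈ H, IsAlg (curve h)
  curve_dim : ∀ h ∈ H, dim (curve h) = 1
  curve_deg : ∀ h ∈ H, CurveDeg (curve h) e
  curve_irr : Generically H fun h => IsIrr (curve h)
  secant : Generically H fun h => interLength (curve h) S (r * e - 1)
  unique_through : Generically Set.univ fun x : Pr 5 => ∃! h, h ∈ H ∧ x ∈ curve h

/-- The hypersurface `X` is transversal to the congruence: the unique member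
through a general point of `X` is not contained in `X`. -/
def TransversalTo {S : Set (Pr 5)} {e r : ℕ} (X : Set (Pr 5)) (𝒞 : Congruence S e r) : Prop :=
  Generically X fun x =>
    (∃ h, h ∈ 𝒞.H ∧ x ∈ 𝒞.curve h) ∧
    ∀ h, h ∈ 𝒞.H → x ∈ 𝒞.curve h → ¬ (𝒞.curve h ⊆ X)

/-! ### Sections of (co)normal sheaves, via graded homomorphisms -/

/-- Global sections of the normal sheaf `N_{S/ℙⁿ}`, modelled as degree-0 graded
homomorphisms `I → R/I` of graded modules over the coordinate ring. -/
def gradedHomDeg0 {n : ℕ} (I : Ideal (Pl n)) :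
    Submodule ℂ (↥I →ₗ[Pl n] (Pl n ⧸ I)) where
  carrier := {φ | ∀ (d : ℕ) (f : Pl n) (hf : f ∈ I), f.IsHomogeneous d →
      ∃ g : Pl n, g.IsHomogeneous d ∧ φ ⟨f, hf⟩ = Ideal.Quotient.mk I g}
  add_mem' := by
    rintro φ ψ hφ hψ d f hf hdf
    obtain ⟨g1, hg1, e1⟩ := hφ d f hf hdf
    obtain ⟨g2, hg2, e2⟩ := hψ d f hf hdf
    exact ⟨g1 + g2, hg1.add hg2, by simp [e1, e2]⟩
  zero_mem' := by
    intro d f hf hdf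
    exact ⟨0, isHomogeneous_zero _ _ _, by simp⟩
  smul_mem' := by
    rintro c φ hφ d f hf hdf
    obtain ⟨g, hg, e⟩ := hφ d f hf hdf
    refine ⟨c • g, ?_, ?_⟩
    · rw [smul_eq_C_mul]
      simpa using (isHomogeneous_C (Fin n) c).mul hg
    · have : Ideal.Quotient.mk I (c • g) = c • Ideal.Quotient.mk I g :=
        map_smul (Ideal.Quotient.mkₐ ℂ I) c g
      simp [e, this]

/-- Evaluation of a graded homomorphism at an element of the ideal. -/
def evalAt {n : ℕ} (I : Ideal (Pl n)) (f : ↥I) :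
    (↥I →ₗ[Pl n] (Pl n ⧸ I)) →ₗ[ℂ] (Pl n ⧸ I) where
  toFun φ := φ f
  map_add' := by intros; rfl
  map_smul' := by intros; rfl

/-- `h⁰(N_{S/ℙⁿ})` for `S ⊆ ℙⁿ` with homogeneous ideal `I`. -/
def h0Normal {n : ℕ} (I : Ideal (Pl n)) : ℕ := Module.finrank ℂ ↥(gradedHomDeg0 I)

/-- `h⁰(N_{S/X})` for `S ⊆ X = {F = 0} ⊆ ℙⁿ`: those sections of `N_{S/ℙⁿ}`
killing the equation of `X`. -/
def h0NormalIn {n : ℕ} (I : Ideal (Pl n)) (F : Pl n) (hF : F ∈ I) : ℕ :=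
  Module.finrank ℂ ↥(gradedHomDeg0 I ⊓ LinearMap.ker (evalAt I ⟨F, hF⟩))

/-- `h⁰(N^*_{S/ℙ⁵}(k))`, modelled as the dimension of the image of
`H⁰(𝐼_S(k)) → H⁰(N^*_{S/ℙ⁵}(k))`, i.e. of `H⁰(𝐼_S(k))/H⁰(𝐼_S²(k))`. -/
def h0conormal (S : Set (Pr 5)) (k : ℕ) : ℕ :=
  Module.finrank ℂ ↥((linSys k 1 S).map (linSys (n := 5) k 2 S).mkQ)

/-! ### Rational singularities (proxy) and projective degrees -/

/-- `X ⊆ ℙ⁵` has at worst rational singularities: it admits a resolution of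
singularities `f : X' → X` (a smooth projective variety mapping regularly and
birationally onto `X`) inducing an equality of the Euler characteristics
`χ(𝒪_{X'}) = χ(𝒪_X)` (constant terms of the Hilbert polynomials). -/
def HasAtWorstRationalSingularities (X : Set (Pr 5)) : Prop :=
  ∃ (N : ℕ) (X' : Set (Pr N)) (f : Pr N → Pr 5),
    IsAlg X' ∧ IsIrr X' ∧ SmoothVariety X' ∧
    (∀ x ∈ X', ∃ φ : RatMap N 5, x ∈ φ.dom ∧ ∀ y ∈ X' ∩ φ.dom, f y = φ.app y) ∧
    f '' X' = X ∧ BirationalOn f X' X ∧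
    ∃ p q : Polynomial ℚ, HasHilbPoly X' p ∧ HasHilbPoly X q ∧
      p.eval 0 = q.eval 0

/-- The `i`-th projective degree of (the restriction to `X`, of dimension
`dimX`, of) the map `f` with domain of definition `dom`: the degree of the
closure of the preimage of a general linear subspace of codimension `i` of the
target `ℙᵐ`. -/
def HasProjDeg {m : ℕ} (f : Pr 5 → Pr m) (dom X : Set (Pr 5)) (dimX i di : ℕ) : Prop :=
  GenericAff (ι := Fin i × Fin (m + 1)) fun P =>
    HasDegree
      (algClosure (X ∩ dom ∩ f ⁻¹'
        (zeroSet {g | ∃ j : Fin i, g = linForm fun t => P (j, t)})))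
      (dimX - i) di

/-- `f n`, arranged so that the kernel evaluates `n` to a literal before unfolding `f`. -/
def strictly {α : Type} (n : ℕ) (f : ℕ → α) : α :=
  Nat.rec (f 0) (fun k _ => f (k + 1)) n

theorem strictly_eq {α : Type} (n : ℕ) (f : ℕ → α) : strictly n f = f n := by
  cases n <;> rfl

/-- The list `l` of digits in base `B`, least significant digit first, as a number. -/
def packDigits (B : ℕ) (l : List ℕ) : ℕ := l.foldr (fun a N => a + B * N) 0

@[simp] theorem packDigits_nil (B : ℕ) : packDigits B [] = 0 := rfl

@[simp] theorem packDigits_cons (B a : ℕ) (l : List ℕ) :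
    packDigits B (a :: l) = a + B * packDigits B l := rfl

/-- Multiply each of the lowest `m` digits of a number by `t` modulo `p`. -/
def scaleDigits (B p t : ℕ) (m : ℕ) : ℕ → ℕ :=
  Nat.rec (fun _ => 0) (fun _ ih N => N % B * t % p + B * strictly (N / B) ih) m

/-- Map a function over a list, evaluating all values before continuing with `k`. -/
def strictMap {α : Type} (f : ℕ → ℕ) (l : List ℕ) : (List ℕ → α) → α :=
  List.rec (fun k => k []) (fun a _ ih k => strictly (f a) fun b => ih fun t => k (b :: t)) l

theorem strictMap_eq {α : Type} (f : ℕ → ℕ) (l : List ℕ) (k : List ℕ → α) :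
    strictMap f l k = k (l.map f) := by
  induction l generalizing k with
  | nil => rfl
  | cons a l ih =>
    change strictly (f a) (fun b => strictMap f l fun t => k (b :: t)) = _
    rw [strictly_eq, ih]
    rfl

/-- Gaussian elimination modulo `p` on `m` packed rows of length `m`, without
exchanging rows or columns; returns `true` if every pivot is invertible. -/
def elimCheck (B p : ℕ) (m : ℕ) : List ℕ → Bool :=
  Nat.rec (fun _ => true) (fun m ih rows =>
    List.rec false (fun r rs _ =>
      strictly (r % B) fun a =>
      strictly (a ^ (p - 2) % p) fun t =>
      (a * t % p).beq 1 &&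
        strictly (scaleDigits B p t m (r / B)) fun q =>
          strictMap (fun N => N / B + (p - N % B % p) * q) rs ih) rows) m

theorem elimCheck_nil (B p m : ℕ) : elimCheck B p (m + 1) [] = false := rfl

theorem elimCheck_cons (B p m r : ℕ) (rs : List ℕ) :
    elimCheck B p (m + 1) (r :: rs) =
      (((r % B) * ((r % B) ^ (p - 2) % p) % p).beq 1 &&
        elimCheck B p m (rs.map fun N => N / B + (p - N % B % p) *
          scaleDigits B p ((r % B) ^ (p - 2) % p) m (r / B))) := by
  change strictly (r % B) (fun a => strictly (a ^ (p - 2) % p) fun t =>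
      (a * t % p).beq 1 &&
        strictly (scaleDigits B p t m (r / B)) fun q =>
          strictMap (fun N => N / B + (p - N % B % p) * q) rs (elimCheck B p m)) = _
  simp only [strictly_eq, strictMap_eq]

/-- The combination of `c 0, c 1, …` with coefficients the digits of a list, modulo `p`. -/
def dotDigits {p : ℕ} : List ℕ → (ℕ → ZMod p) → ZMod p
  | [], _ => 0
  | a :: l, c => a * c 0 + dotDigits l fun k => c (k + 1)

/-- `N` packs `m` digits, all less than `b`, and orthogonal to `c` modulo `p`. -/
def PacksOrthogonal {p : ℕ} (B b m N : ℕ) (c : ℕ → ZMod p) : Prop :=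
  ∃ l : List ℕ, l.length = m ∧ (∀ a ∈ l, a < b) ∧ N = packDigits B l ∧ dotDigits l c = 0

theorem dotDigits_zipWith {p : ℕ} (x : ℕ) : ∀ (l l' : List ℕ) (c : ℕ → ZMod p),
    l.length = l'.length →
    dotDigits (List.zipWith (fun a b => a + x * b) l l') c =
      dotDigits l c + x * dotDigits l' c
  | [], [], c, _ => by simp [dotDigits]
  | a :: l, b :: l', c, h => by
    simp only [List.zipWith_cons_cons, dotDigits]
    rw [dotDigits_zipWith x l l' _ (by simpa using h)]
    push_cast
    ring

theorem packDigits_zipWith (B x : ℕ) : ∀ l l' : List ℕ, l.length = l'.length →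
    packDigits B (List.zipWith (fun a b => a + x * b) l l') =
      packDigits B l + x * packDigits B l'
  | [], [], _ => by simp
  | a :: l, b :: l', h => by
    simp only [List.zipWith_cons_cons, packDigits_cons]
    rw [packDigits_zipWith B x l l' (by simpa using h)]
    ring

theorem zipWith_lt {b b' x : ℕ} : ∀ l l' : List ℕ, (∀ a ∈ l, a < b) → (∀ a ∈ l', a < b') →
    ∀ a ∈ List.zipWith (fun a b => a + x * b) l l', a < b + x * b'
  | [], _, _, _ => by simp
  | _ :: _, [], _, _ => by simp
  | a :: l, a' :: l', h, h' => by
    simp only [List.zipWith_cons_cons, List.mem_cons, forall_eq_or_imp] at h h' ⊢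
    exact ⟨add_lt_add_of_lt_of_le h.1 (Nat.mul_le_mul_left _ h'.1.le),
      zipWith_lt l l' h.2 h'.2⟩

theorem scaleDigits_packDigits {B p t b : ℕ} (hb : b ≤ B) : ∀ l : List ℕ, (∀ a ∈ l, a < b) →
    scaleDigits B p t l.length (packDigits B l) = packDigits B (l.map fun a => a * t % p)
  | [], _ => rfl
  | a :: l, h => by
    simp only [List.mem_cons, forall_eq_or_imp] at h
    have ha : a < B := h.1.trans_le hb
    change (a + B * packDigits B l) % B * t % p +
      B * strictly ((a + B * packDigits B l) / B) (scaleDigits B p t l.length) = _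
    rw [strictly_eq, Nat.add_mul_mod_self_left, Nat.mod_eq_of_lt ha,
      Nat.add_mul_div_left _ _ (by omega), Nat.div_eq_of_lt ha, zero_add,
      scaleDigits_packDigits hb l h.2]
    rfl

theorem dotDigits_map {p : ℕ} (t : ℕ) : ∀ (l : List ℕ) (c : ℕ → ZMod p),
    dotDigits (l.map fun a => a * t % p) c = t * dotDigits l c
  | [], _ => by simp [dotDigits]
  | a :: l, c => by
    simp only [List.map_cons, dotDigits, dotDigits_map t l]
    rw [ZMod.natCast_mod]
    push_cast
    ring

/-- If elimination succeeds, only the zero vector is orthogonal to all rows. -/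
theorem eq_zero_of_elimCheck {B p : ℕ} (hp : 0 < p) (m : ℕ) : ∀ (b : ℕ) (rows : List ℕ)
    (c : ℕ → ZMod p), b + m * (p * p) ≤ B → (∀ N ∈ rows, PacksOrthogonal B b m N c) →
    elimCheck B p m rows = true → ∀ j < m, c j = 0 := by
  induction m with
  | zero => intro _ _ _ _ _ _ j hj; omega
  | succ m ih =>
    intro b rows c hb hrows hc
    match rows, hrows, hc with
    | [], _, hc => simp [elimCheck_nil] at hc
    | r :: rs, hrows, hc =>
      rw [elimCheck_cons, Bool.and_eq_true] at hc
      obtain ⟨hinv, hc⟩ := hc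
      set t := (r % B) ^ (p - 2) % p with ht
      have hbB : b ≤ B := by omega
      have split : ∀ N, PacksOrthogonal B b (m + 1) N c → ∃ a l, l.length = m ∧
          (∀ a ∈ l, a < b) ∧ N % B = a ∧ N / B = packDigits B l ∧
          (a : ZMod p) * c 0 + dotDigits l (fun k => c (k + 1)) = 0 := by
        rintro N ⟨l, hl, hlt, rfl, hdot⟩
        match l, hl, hlt, hdot with
        | a :: l, hl, hlt, hdot =>
          simp only [List.mem_cons, forall_eq_or_imp] at hlt
          have ha : a < B := hlt.1.trans_le hbB
          refine ⟨a, l, by simpa using hl, hlt.2, ?_, ?_, hdot⟩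
          · rw [packDigits_cons, Nat.add_mul_mod_self_left, Nat.mod_eq_of_lt ha]
          · rw [packDigits_cons, Nat.add_mul_div_left _ _ (by omega), Nat.div_eq_of_lt ha,
              zero_add]
      obtain ⟨a, l, hl, hlt, hra, hrl, hdot⟩ := split r (hrows r (by simp))
      have hat : (a : ZMod p) * t = 1 := by
        have h1 := Nat.eq_of_beq_eq_true hinv
        rw [hra] at h1
        have h2 := congrArg (Nat.cast : ℕ → ZMod p) h1
        rw [ZMod.natCast_mod] at h2
        simpa using h2
      rw [hrl, ← hl, scaleDigits_packDigits hbB l hlt, hl] at hc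
      have hpiv : c 0 + dotDigits (l.map fun a => a * t % p) (fun k => c (k + 1)) = 0 := by
        rw [dotDigits_map]
        linear_combination (t : ZMod p) * hdot - c 0 * hat
      have hnext := ih (b + p * p) _ (fun k => c (k + 1)) (by
        rw [Nat.succ_mul] at hb
        omega) (by
          intro N hN
          obtain ⟨N', hN', rfl⟩ := List.mem_map.1 hN
          obtain ⟨a', l', hl', hlt', hra', hrl', hdot'⟩ := split N' (hrows N' (by simp [hN']))
          rw [hra', hrl']
          have hlen : l'.length = (l.map fun a => a * t % p).length := by simp [hl, hl']
          refine ⟨List.zipWith (fun x y => x + (p - a' % p) * y) l'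
            (l.map fun a => a * t % p), by simp [hl, hl'], ?_, ?_, ?_⟩
          · intro x hx
            refine (zipWith_lt l' _ hlt' (b' := p) ?_ x hx).trans_le ?_
            · intro y hy
              obtain ⟨z, -, rfl⟩ := List.mem_map.1 hy
              exact Nat.mod_lt _ hp
            · exact Nat.add_le_add_left (Nat.mul_le_mul_right _ (Nat.sub_le _ _)) _
          · rw [packDigits_zipWith _ _ _ _ hlen]
          · rw [dotDigits_zipWith _ _ _ _ hlen, Nat.cast_sub (Nat.mod_lt _ hp).le,
              ZMod.natCast_mod, ZMod.natCast_self]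
            linear_combination hdot' - (a' : ZMod p) * hpiv) hc
      intro j hj
      cases j with
      | succ j => exact hnext j (by omega)
      | zero =>
        have hz : ∀ (l : List ℕ) (d : ℕ → ZMod p), (∀ j < l.length, d j = 0) →
            dotDigits l d = 0 := by
          intro l
          induction l with
          | nil => intro _ _; rfl
          | cons a l ihl =>
            intro d hd
            simp only [dotDigits]
            rw [hd 0 (by simp), ihl _ fun j hj => hd (j + 1) (by simpa using hj)]
            simp
        rw [hz _ _ fun j hj => hnext j (by simpa [hl] using hj), add_zero] at hpiv
        exact hpiv

/-- The exponents of a monomial in six variables. -/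
structure SixExp where
  (a b c d e f : ℕ)

/-- The exponents of a monomial in three variables, together with a coordinate index. -/
structure CoordExp where
  (i a b c : ℕ)

/-- Exponents of 244 quintic monomials in six variables. -/
def quinticExps : List SixExp :=
  [⟨1,0,0,0,0,4⟩, ⟨0,1,0,0,0,4⟩, ⟨0,0,1,0,0,4⟩, ⟨0,0,0,1,0,4⟩, ⟨0,0,0,0,1,4⟩, ⟨0,0,0,0,0,5⟩,
   ⟨1,0,0,0,1,3⟩, ⟨0,1,0,0,1,3⟩, ⟨0,0,1,0,1,3⟩, ⟨0,0,0,1,1,3⟩, ⟨0,0,0,0,2,3⟩, ⟨0,0,0,0,3,2⟩,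
   ⟨1,0,0,0,2,2⟩, ⟨0,1,0,0,2,2⟩, ⟨0,0,1,0,2,2⟩, ⟨0,0,0,1,2,2⟩, ⟨0,0,0,0,4,1⟩, ⟨0,0,0,0,5,0⟩,
   ⟨1,0,0,0,3,1⟩, ⟨0,1,0,0,3,1⟩, ⟨0,0,1,0,3,1⟩, ⟨0,0,0,1,3,1⟩, ⟨0,0,0,1,4,0⟩, ⟨0,0,0,2,0,3⟩,
   ⟨1,0,0,0,4,0⟩, ⟨0,1,0,0,4,0⟩, ⟨0,0,1,0,4,0⟩, ⟨0,0,0,2,1,2⟩, ⟨0,0,0,2,2,1⟩, ⟨0,0,0,2,3,0⟩,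
   ⟨1,0,0,1,0,3⟩, ⟨0,1,0,1,0,3⟩, ⟨0,0,1,1,0,3⟩, ⟨0,0,0,3,0,2⟩, ⟨0,0,0,3,1,1⟩, ⟨0,0,0,3,2,0⟩,
   ⟨1,0,0,1,1,2⟩, ⟨0,1,0,1,1,2⟩, ⟨0,0,1,1,1,2⟩, ⟨0,0,0,4,0,1⟩, ⟨0,0,0,4,1,0⟩, ⟨0,0,0,5,0,0⟩,
   ⟨1,0,0,1,2,1⟩, ⟨0,1,0,1,2,1⟩, ⟨0,0,1,1,2,1⟩, ⟨0,0,1,1,3,0⟩, ⟨0,0,1,2,0,2⟩, ⟨0,0,1,2,1,1⟩,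
   ⟨1,0,0,1,3,0⟩, ⟨0,1,0,1,3,0⟩, ⟨0,0,1,2,2,0⟩, ⟨0,0,1,3,0,1⟩, ⟨0,0,1,3,1,0⟩, ⟨0,0,1,4,0,0⟩,
   ⟨1,0,0,2,0,2⟩, ⟨0,1,0,2,0,2⟩, ⟨0,0,2,0,0,3⟩, ⟨0,0,2,0,1,2⟩, ⟨0,0,2,0,2,1⟩, ⟨0,0,2,0,3,0⟩,
   ⟨1,0,0,2,1,1⟩, ⟨0,1,0,2,1,1⟩, ⟨0,0,2,1,0,2⟩, ⟨0,0,2,1,1,1⟩, ⟨0,0,2,1,2,0⟩, ⟨0,0,2,2,0,1⟩,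
   ⟨1,0,0,2,2,0⟩, ⟨0,1,0,2,2,0⟩, ⟨0,0,2,2,1,0⟩, ⟨0,0,2,3,0,0⟩, ⟨0,0,3,0,0,2⟩, ⟨0,0,3,0,1,1⟩,
   ⟨1,0,0,3,0,1⟩, ⟨0,1,0,3,0,1⟩, ⟨0,0,3,0,2,0⟩, ⟨0,0,3,1,0,1⟩, ⟨0,0,3,1,1,0⟩, ⟨0,0,3,2,0,0⟩,
   ⟨1,0,0,3,1,0⟩, ⟨0,1,0,3,1,0⟩, ⟨0,0,4,0,0,1⟩, ⟨0,0,4,0,1,0⟩, ⟨0,0,4,1,0,0⟩, ⟨0,0,5,0,0,0⟩,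
   ⟨1,0,0,4,0,0⟩, ⟨0,1,0,4,0,0⟩, ⟨0,1,1,0,0,3⟩, ⟨0,1,1,0,1,2⟩, ⟨0,1,1,0,2,1⟩, ⟨0,1,1,0,3,0⟩,
   ⟨1,0,1,0,0,3⟩, ⟨0,1,1,1,0,2⟩, ⟨0,1,1,1,1,1⟩, ⟨0,1,1,1,2,0⟩, ⟨0,1,1,2,0,1⟩, ⟨0,1,1,2,1,0⟩,
   ⟨1,0,1,0,1,2⟩, ⟨0,1,1,3,0,0⟩, ⟨0,1,2,0,0,2⟩, ⟨0,1,2,0,1,1⟩, ⟨0,1,2,0,2,0⟩, ⟨0,1,2,1,0,1⟩,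
   ⟨1,0,1,0,2,1⟩, ⟨0,1,2,1,1,0⟩, ⟨0,1,2,2,0,0⟩, ⟨0,1,3,0,0,1⟩, ⟨0,1,3,0,1,0⟩, ⟨0,1,3,1,0,0⟩,
   ⟨1,0,1,0,3,0⟩, ⟨0,1,4,0,0,0⟩, ⟨0,2,0,0,0,3⟩, ⟨0,2,0,0,1,2⟩, ⟨0,2,0,0,2,1⟩, ⟨0,2,0,0,3,0⟩,
   ⟨1,0,1,1,0,2⟩, ⟨0,2,0,1,0,2⟩, ⟨0,2,0,1,1,1⟩, ⟨0,2,0,1,2,0⟩, ⟨0,2,0,2,0,1⟩, ⟨0,2,0,2,1,0⟩,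
   ⟨1,0,1,1,1,1⟩, ⟨0,2,0,3,0,0⟩, ⟨0,2,1,0,0,2⟩, ⟨0,2,1,0,1,1⟩, ⟨0,2,1,0,2,0⟩, ⟨0,2,1,1,0,1⟩,
   ⟨1,0,1,1,2,0⟩, ⟨0,2,1,1,1,0⟩, ⟨0,2,1,2,0,0⟩, ⟨0,2,2,0,0,1⟩, ⟨0,2,2,0,1,0⟩, ⟨0,2,2,1,0,0⟩,
   ⟨1,0,1,2,0,1⟩, ⟨0,2,3,0,0,0⟩, ⟨0,3,0,0,0,2⟩, ⟨0,3,0,0,1,1⟩, ⟨0,3,0,0,2,0⟩, ⟨0,3,0,1,0,1⟩,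
   ⟨1,0,1,2,1,0⟩, ⟨0,3,0,1,1,0⟩, ⟨0,3,0,2,0,0⟩, ⟨0,3,1,0,0,1⟩, ⟨0,3,1,0,1,0⟩, ⟨0,3,1,1,0,0⟩,
   ⟨1,0,1,3,0,0⟩, ⟨0,3,2,0,0,0⟩, ⟨0,4,0,0,0,1⟩, ⟨0,4,0,0,1,0⟩, ⟨0,4,0,1,0,0⟩, ⟨0,4,1,0,0,0⟩,
   ⟨1,0,2,0,1,1⟩, ⟨0,5,0,0,0,0⟩, ⟨1,0,2,0,0,2⟩, ⟨1,0,2,0,2,0⟩, ⟨1,0,2,1,0,1⟩, ⟨1,0,2,1,1,0⟩,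
   ⟨1,0,2,2,0,0⟩, ⟨1,0,3,0,0,1⟩, ⟨1,0,3,0,1,0⟩, ⟨1,0,3,1,0,0⟩, ⟨1,0,4,0,0,0⟩, ⟨1,1,0,0,0,3⟩,
   ⟨1,1,0,0,1,2⟩, ⟨1,1,0,0,2,1⟩, ⟨1,1,0,0,3,0⟩, ⟨1,1,0,1,0,2⟩, ⟨1,1,0,1,1,1⟩, ⟨1,1,0,1,2,0⟩,
   ⟨1,1,0,2,0,1⟩, ⟨1,1,0,2,1,0⟩, ⟨1,1,0,3,0,0⟩, ⟨1,1,1,0,0,2⟩, ⟨1,1,1,0,1,1⟩, ⟨1,1,1,0,2,0⟩,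
   ⟨1,1,1,1,0,1⟩, ⟨1,1,1,1,1,0⟩, ⟨1,1,1,2,0,0⟩, ⟨1,1,2,0,0,1⟩, ⟨1,1,2,0,1,0⟩, ⟨1,1,2,1,0,0⟩,
   ⟨1,1,3,0,0,0⟩, ⟨1,2,0,0,1,1⟩, ⟨1,2,0,0,2,0⟩, ⟨1,2,0,1,0,1⟩, ⟨1,2,0,1,1,0⟩, ⟨1,2,0,2,0,0⟩,
   ⟨1,2,1,0,0,1⟩, ⟨1,2,1,0,1,0⟩, ⟨1,2,1,1,0,0⟩, ⟨1,2,2,0,0,0⟩, ⟨1,3,0,0,0,1⟩, ⟨1,3,0,0,1,0⟩,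
   ⟨1,3,0,1,0,0⟩, ⟨1,3,1,0,0,0⟩, ⟨1,4,0,0,0,0⟩, ⟨2,0,0,0,0,3⟩, ⟨2,0,0,0,1,2⟩, ⟨2,0,0,0,2,1⟩,
   ⟨2,0,0,0,3,0⟩, ⟨2,0,0,1,1,1⟩, ⟨2,0,0,1,2,0⟩, ⟨2,0,0,2,1,0⟩, ⟨2,0,0,3,0,0⟩, ⟨2,0,1,0,0,2⟩,
   ⟨2,0,1,0,1,1⟩, ⟨2,0,1,0,2,0⟩, ⟨2,0,1,1,0,1⟩, ⟨2,0,1,1,1,0⟩, ⟨2,0,1,2,0,0⟩, ⟨2,0,2,0,0,1⟩,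
   ⟨2,0,2,0,1,0⟩, ⟨2,0,2,1,0,0⟩, ⟨2,0,3,0,0,0⟩, ⟨2,1,0,0,2,0⟩, ⟨2,1,0,1,1,0⟩, ⟨2,1,0,2,0,0⟩,
   ⟨2,1,1,0,0,1⟩, ⟨2,1,1,0,1,0⟩, ⟨2,1,1,1,0,0⟩, ⟨2,1,2,0,0,0⟩, ⟨2,2,0,0,0,1⟩, ⟨2,2,0,0,1,0⟩,
   ⟨2,2,0,1,0,0⟩, ⟨2,2,1,0,0,0⟩, ⟨2,3,0,0,0,0⟩, ⟨3,0,0,0,1,1⟩, ⟨3,0,0,0,2,0⟩, ⟨3,0,0,1,1,0⟩,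
   ⟨3,0,0,2,0,0⟩, ⟨3,0,1,0,0,1⟩, ⟨3,0,1,0,1,0⟩, ⟨3,0,1,1,0,0⟩, ⟨3,0,2,0,0,0⟩, ⟨3,1,0,0,0,1⟩,
   ⟨3,1,0,0,1,0⟩, ⟨3,1,0,1,0,0⟩, ⟨3,1,1,0,0,0⟩, ⟨3,2,0,0,0,0⟩, ⟨4,0,0,0,0,1⟩, ⟨4,0,0,0,1,0⟩,
   ⟨4,0,0,1,0,0⟩, ⟨4,0,1,0,0,0⟩, ⟨4,1,0,0,0,0⟩, ⟨5,0,0,0,0,0⟩]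

/-- Coordinate indices and exponents of 182 monomial vectors of length six. -/
def vectorExps : List CoordExp :=
  [⟨0,0,0,12⟩, ⟨0,0,1,11⟩, ⟨0,0,2,10⟩, ⟨0,0,3,9⟩, ⟨0,0,4,8⟩, ⟨0,0,5,7⟩, ⟨0,0,6,6⟩, ⟨0,0,7,5⟩,
   ⟨0,0,8,4⟩, ⟨0,1,0,11⟩, ⟨0,1,1,10⟩, ⟨0,1,2,9⟩, ⟨0,1,3,8⟩, ⟨0,1,4,7⟩, ⟨0,1,5,6⟩, ⟨0,1,6,5⟩,
   ⟨0,1,7,4⟩, ⟨0,1,8,3⟩, ⟨0,2,0,10⟩, ⟨0,2,1,9⟩, ⟨0,2,2,8⟩, ⟨0,2,3,7⟩, ⟨0,2,4,6⟩, ⟨0,2,5,5⟩,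
   ⟨0,2,6,4⟩, ⟨0,2,7,3⟩, ⟨0,2,8,2⟩, ⟨0,3,0,9⟩, ⟨0,3,1,8⟩, ⟨0,3,2,7⟩, ⟨0,3,3,6⟩, ⟨0,3,4,5⟩,
   ⟨0,3,5,4⟩, ⟨0,3,6,3⟩, ⟨0,3,7,2⟩, ⟨0,3,8,1⟩, ⟨0,4,0,8⟩, ⟨0,4,1,7⟩, ⟨0,4,2,6⟩, ⟨0,4,3,5⟩,
   ⟨0,4,4,4⟩, ⟨0,4,5,3⟩, ⟨0,4,6,2⟩, ⟨0,4,7,1⟩, ⟨0,4,8,0⟩, ⟨0,5,0,7⟩, ⟨0,5,1,6⟩, ⟨0,5,2,5⟩,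
   ⟨0,5,3,4⟩, ⟨0,5,4,3⟩, ⟨0,5,5,2⟩, ⟨0,5,6,1⟩, ⟨0,5,7,0⟩, ⟨0,6,0,6⟩, ⟨0,6,1,5⟩, ⟨0,6,2,4⟩,
   ⟨0,6,3,3⟩, ⟨0,6,4,2⟩, ⟨0,6,5,1⟩, ⟨0,6,6,0⟩, ⟨0,7,0,5⟩, ⟨0,7,1,4⟩, ⟨0,7,2,3⟩, ⟨0,7,3,2⟩,
   ⟨0,7,4,1⟩, ⟨0,7,5,0⟩, ⟨0,8,0,4⟩, ⟨0,8,1,3⟩, ⟨0,8,2,2⟩, ⟨0,8,3,1⟩, ⟨1,0,0,12⟩, ⟨1,0,1,11⟩,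
   ⟨1,0,2,10⟩, ⟨1,0,3,9⟩, ⟨1,0,4,8⟩, ⟨1,0,5,7⟩, ⟨1,0,6,6⟩, ⟨1,0,7,5⟩, ⟨1,0,8,4⟩, ⟨1,1,0,11⟩,
   ⟨1,1,1,10⟩, ⟨1,1,2,9⟩, ⟨1,1,3,8⟩, ⟨1,1,4,7⟩, ⟨1,1,5,6⟩, ⟨1,1,6,5⟩, ⟨1,1,7,4⟩, ⟨1,1,8,3⟩,
   ⟨1,2,0,10⟩, ⟨1,2,1,9⟩, ⟨1,2,2,8⟩, ⟨1,2,3,7⟩, ⟨1,2,4,6⟩, ⟨1,2,5,5⟩, ⟨1,2,6,4⟩, ⟨1,2,7,3⟩,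
   ⟨1,2,8,2⟩, ⟨1,3,0,9⟩, ⟨1,3,1,8⟩, ⟨1,3,2,7⟩, ⟨1,3,3,6⟩, ⟨1,3,4,5⟩, ⟨1,3,5,4⟩, ⟨1,3,6,3⟩,
   ⟨1,3,7,2⟩, ⟨1,3,8,1⟩, ⟨1,4,0,8⟩, ⟨1,4,1,7⟩, ⟨1,4,2,6⟩, ⟨1,4,3,5⟩, ⟨1,4,4,4⟩, ⟨1,4,5,3⟩,
   ⟨1,4,6,2⟩, ⟨1,4,7,1⟩, ⟨1,4,8,0⟩, ⟨1,5,0,7⟩, ⟨1,5,1,6⟩, ⟨1,5,2,5⟩, ⟨1,5,3,4⟩, ⟨1,5,4,3⟩,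
   ⟨1,5,5,2⟩, ⟨1,5,6,1⟩, ⟨1,5,7,0⟩, ⟨1,6,0,6⟩, ⟨1,6,1,5⟩, ⟨1,6,2,4⟩, ⟨1,6,3,3⟩, ⟨1,6,4,2⟩,
   ⟨1,6,5,1⟩, ⟨1,6,6,0⟩, ⟨1,7,0,5⟩, ⟨1,7,1,4⟩, ⟨1,7,2,3⟩, ⟨1,7,3,2⟩, ⟨1,7,4,1⟩, ⟨1,7,5,0⟩,
   ⟨2,0,0,12⟩, ⟨2,0,1,11⟩, ⟨2,0,2,10⟩, ⟨2,0,3,9⟩, ⟨2,0,4,8⟩, ⟨2,0,5,7⟩, ⟨2,0,6,6⟩, ⟨2,0,7,5⟩,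
   ⟨2,0,8,4⟩, ⟨2,1,0,11⟩, ⟨2,1,1,10⟩, ⟨2,1,2,9⟩, ⟨2,1,3,8⟩, ⟨2,1,4,7⟩, ⟨2,1,5,6⟩, ⟨2,1,6,5⟩,
   ⟨2,1,7,4⟩, ⟨2,1,8,3⟩, ⟨2,2,0,10⟩, ⟨2,2,7,3⟩, ⟨2,2,8,2⟩, ⟨2,3,7,2⟩, ⟨2,3,8,1⟩, ⟨3,0,0,12⟩,
   ⟨2,4,7,1⟩, ⟨3,0,1,11⟩, ⟨3,0,2,10⟩, ⟨3,0,3,9⟩, ⟨3,0,4,8⟩, ⟨3,0,5,7⟩, ⟨3,0,6,6⟩, ⟨3,0,7,5⟩,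
   ⟨3,0,8,4⟩, ⟨3,1,7,4⟩, ⟨4,0,0,12⟩, ⟨4,1,0,11⟩, ⟨2,2,1,9⟩, ⟨3,1,0,11⟩, ⟨2,2,2,8⟩, ⟨3,1,1,10⟩,
   ⟨4,0,1,11⟩, ⟨5,0,1,11⟩, ⟨2,2,3,7⟩, ⟨2,2,4,6⟩, ⟨3,1,2,9⟩, ⟨4,0,2,10⟩]

/-- The monomial with exponents `a, b, c` at `(x, y, z)`, differentiated once with respect to each
variable flagged by `i, j, k`. -/
def natJet (i j k x y z a b c : ℕ) : ℕ :=
  Nat.mul (Nat.mul (Nat.pow a i) (Nat.pow x (Nat.sub a i)))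
    (Nat.mul (Nat.mul (Nat.pow b j) (Nat.pow y (Nat.sub b j)))
      (Nat.mul (Nat.pow c k) (Nat.pow z (Nat.sub c k))))

/-- The six forms of the sample projection (differentiated as in `natJet`), passed to `K`. -/
def withSampleForms {α : Type} (i j k x y z : ℕ) (K : ℕ → ℕ → ℕ → ℕ → ℕ → ℕ → α) : α :=
  strictly (natJet i j k x y z 2 1 0) fun m₀ =>
  strictly (natJet i j k x y z 2 0 1) fun m₁ =>
  strictly (natJet i j k x y z 1 2 0) fun m₂ =>
  strictly (natJet i j k x y z 1 0 2) fun m₄ =>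
  strictly (natJet i j k x y z 0 2 1) fun m₅ =>
  strictly (natJet i j k x y z 0 1 2) fun m₆ =>
  strictly (Nat.mod (natJet i j k x y z 0 0 3) 4099) fun n₅ =>
  strictly (Nat.mod (Nat.add m₀ (Nat.mul 4098 m₁)) 4099) fun n₀ =>
  strictly (Nat.mod (Nat.add m₁ (Nat.mul 4098 m₂)) 4099) fun n₁ =>
  strictly (Nat.mod (Nat.add m₂ (Nat.mul 4098 m₄)) 4099) fun n₂ =>
  strictly (Nat.mod (Nat.add m₄ (Nat.mul 4098 m₅)) 4099) fun n₃ =>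
  strictly (Nat.mod (Nat.add m₅ (Nat.mul 4098 m₆)) 4099) fun n₄ =>
  K n₀ n₁ n₂ n₃ n₄ n₅

/-- `1` if `a = b` and `0` otherwise. -/
def natDelta (a b : ℕ) : ℕ := Bool.rec 0 1 (Nat.beq a b)

/-- Pack the values modulo `4099` of a function on a list as base `2 ^ 40` digits. -/
def packRow {α : Type} (f : α → ℕ) (l : List α) : ℕ :=
  List.rec 0 (fun a _ ih =>
    strictly (Nat.mod (f a) 4099) fun b => Nat.add b (Nat.mul 1099511627776 ih)) l

/-- The derivative with respect to the variable flagged by `i₀, …, i₅` of a monomial in six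
variables at `(x₀, …, x₅)`. -/
def natPartial (i₀ i₁ i₂ i₃ i₄ i₅ x₀ x₁ x₂ x₃ x₄ x₅ : ℕ) (t : SixExp) : ℕ :=
  SixExp.rec (fun a b c d e f =>
    Nat.mul (natJet i₀ i₁ i₂ x₀ x₁ x₂ a b c) (natJet i₃ i₄ i₅ x₃ x₄ x₅ d e f)) t

/-- Row `k` of the sample matrix of partial derivatives. -/
def partialRow (k : ℕ) : ℕ :=
  strictly (Nat.mod k 6) fun i =>
  strictly (natDelta i 0) fun i₀ =>
  strictly (natDelta i 1) fun i₁ =>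
  strictly (natDelta i 2) fun i₂ =>
  strictly (natDelta i 3) fun i₃ =>
  strictly (natDelta i 4) fun i₄ =>
  strictly (natDelta i 5) fun i₅ =>
  strictly (Nat.add k 2) fun x =>
  strictly (Nat.mod (Nat.pow x 101) 4099) fun y =>
  withSampleForms 0 0 0 x y 1 fun x₀ x₁ x₂ x₃ x₄ x₅ =>
  packRow (natPartial i₀ i₁ i₂ i₃ i₄ i₅ x₀ x₁ x₂ x₃ x₄ x₅) quinticExps

/-- The `i`-th of six numbers. -/
def natSelect (w₀ w₁ w₂ w₃ w₄ w₅ i : ℕ) : ℕ :=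
  Nat.rec w₀ (fun i _ => Nat.rec w₁ (fun i _ => Nat.rec w₂ (fun i _ => Nat.rec w₃
    (fun i _ => Nat.rec w₄ (fun _ _ => w₅) i) i) i) i) i

/-- Difference modulo `4099` of two weighted jets of a monomial vector. -/
def natTwoJet (w₀ w₁ w₂ w₃ w₄ w₅ i j k x y z w₀' w₁' w₂' w₃' w₄' w₅' i' j' k' x' y' z' : ℕ)
    (t : CoordExp) : ℕ :=
  CoordExp.rec (fun l a b c => Nat.add
    (Nat.mul (natSelect w₀ w₁ w₂ w₃ w₄ w₅ l) (natJet i j k x y z a b c))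
    (Nat.mul 4098 (Nat.mul (natSelect w₀' w₁' w₂' w₃' w₄' w₅' l)
      (natJet i' j' k' x' y' z' a b c)))) t

/-- A sample row coming from the differentiated Euler relation. -/
def eulerRow (k : ℕ) : ℕ :=
  strictly (natDelta (Nat.mod k 2) 0) fun i =>
  strictly (natDelta (Nat.mod k 2) 1) fun j =>
  strictly (Nat.add k 2) fun x =>
  strictly (Nat.mod (Nat.pow x 101) 4099) fun y =>
  withSampleForms 0 0 0 x y 1 fun x₀ x₁ x₂ x₃ x₄ x₅ =>
  withSampleForms i j 0 x y 1 fun y₀ y₁ y₂ y₃ y₄ y₅ =>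
  strictly (Nat.mul 4 y₀) fun y₀ =>
  strictly (Nat.mul 4 y₁) fun y₁ =>
  strictly (Nat.mul 4 y₂) fun y₂ =>
  strictly (Nat.mul 4 y₃) fun y₃ =>
  strictly (Nat.mul 4 y₄) fun y₄ =>
  strictly (Nat.mul 4 y₅) fun y₅ =>
  packRow (natTwoJet x₀ x₁ x₂ x₃ x₄ x₅ i j 0 x y 1 y₀ y₁ y₂ y₃ y₄ y₅ 0 0 0 x y 1) vectorExps

/-- A sample row expressing equality at the two preimages of the node. -/
def nodeRow (l : ℕ) : ℕ :=
  strictly (natDelta l 0) fun i₀ =>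
  strictly (natDelta l 1) fun i₁ =>
  strictly (natDelta l 2) fun i₂ =>
  strictly (natDelta l 3) fun i₃ =>
  strictly (natDelta l 4) fun i₄ =>
  strictly (natDelta l 5) fun i₅ =>
  packRow (natTwoJet i₀ i₁ i₂ i₃ i₄ i₅ 0 0 0 0 0 1 i₀ i₁ i₂ i₃ i₄ i₅ 0 0 0 1 1 1) vectorExps

/-- A sample row expressing the symmetry of the Hessian at the node. -/
def hessianRow (i j i' j' : ℕ) : ℕ :=
  withSampleForms i' j' 0 1 1 1 fun x₀ x₁ x₂ x₃ x₄ x₅ =>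
  withSampleForms i j 0 0 0 1 fun y₀ y₁ y₂ y₃ y₄ y₅ =>
  packRow (natTwoJet x₀ x₁ x₂ x₃ x₄ x₅ i j 0 0 0 1 y₀ y₁ y₂ y₃ y₄ y₅ i' j' 0 1 1 1) vectorExps


theorem elimCheck_partialRow : strictMap partialRow (List.range 244)
    (elimCheck 1099511627776 4099 244) = true := by
  decide +kernel


theorem elimCheck_twoJetRow : strictMap eulerRow (List.range 172)
    (fun l => strictMap nodeRow (List.range 6) fun l' =>
      elimCheck 1099511627776 4099 182 (l ++ (l' ++ [hessianRow 1 0 1 0,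
        hessianRow 1 0 0 1, hessianRow 0 1 1 0, hessianRow 0 1 0 1]))) = true := by
  decide +kernel

/-- The exponents of a `SixExp` as a function. -/
def SixExp.toFun (t : SixExp) : Fin 6 → ℕ := ![t.a, t.b, t.c, t.d, t.e, t.f]

/-- The exponents of a `CoordExp` as a function. -/
def CoordExp.toFun (t : CoordExp) : Fin 3 → ℕ := ![t.a, t.b, t.c]

/-- The indicator of `k`. -/
def unitExp (n k : ℕ) : Fin n → ℕ := fun l => if l.val = k then 1 else 0

section jets

variable {R S : Type*} [CommRing R] [CommRing S]

/-- The value at `s` of the monomial with exponents `μ`, differentiated with respect to the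
variables flagged by `d`. -/
def jet {n : ℕ} (d μ : Fin n → ℕ) (s : Fin n → R) : R :=
  ∏ l, (μ l : R) ^ d l * s l ^ (μ l - d l)

theorem map_jet {n : ℕ} (f : R →+* S) (d μ : Fin n → ℕ) (s : Fin n → R) :
    f (jet d μ s) = jet d μ (f ∘ s) := by
  simp [jet]

/-- The exponents of the cubic monomials in three variables without `x ^ 3` and `y ^ 3`. -/
def cubicExp : Fin 8 → Fin 3 → ℕ :=
  ![![2, 1, 0], ![2, 0, 1], ![1, 2, 0], ![1, 1, 1], ![1, 0, 2], ![0, 2, 1], ![0, 1, 2], ![0, 0, 3]]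

/-- The eight cubic monomials at `s`, differentiated as in `jet`. -/
def cubicJet (d : Fin 3 → ℕ) (s : Fin 3 → R) : Fin 8 → R := fun k => jet d (cubicExp k) s

theorem map_cubicJet (f : R →+* S) (d : Fin 3 → ℕ) (s : Fin 3 → R) :
    f ∘ cubicJet d s = cubicJet d (f ∘ s) :=
  funext fun _ => map_jet f _ _ _

/-- Second coordinates of a sequence of points in the plane. -/
def sampleCoord (k : ℕ) : ℕ := Nat.mod (Nat.pow (Nat.add k 2) 101) 4099

/-- A sequence of points in the plane. -/
def samplePoint (R : Type*) [CommRing R] (k : ℕ) : Fin 3 → R :=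
  ![(Nat.add k 2 : ℕ), sampleCoord k, (1 : ℕ)]

theorem map_samplePoint (f : R →+* S) (k : ℕ) : f ∘ samplePoint R k = samplePoint S k := by
  funext i
  fin_cases i <;> exact map_natCast f _

theorem map_mulVec (f : R →+* S) (L : Matrix (Fin 6) (Fin 8) R) (z : Fin 8 → R) :
    f ∘ L.mulVec z = (L.map f).mulVec (f ∘ z) :=
  funext fun i => RingHom.map_mulVec f L z i

/-- Partial derivatives of quintic monomials at points of the surface parametrized by the
cubics `L` in three variables. -/
def partialMatrix (L : Matrix (Fin 6) (Fin 8) R) :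
    Matrix (Fin quinticExps.length) (Fin quinticExps.length) R :=
  Matrix.of fun k c => jet (unitExp 6 (k % 6)) quinticExps[c].toFun
    (L.mulVec (cubicJet 0 (samplePoint R k)))

theorem map_partialMatrix (f : R →+* S) (L : Matrix (Fin 6) (Fin 8) R) :
    (partialMatrix L).map f = partialMatrix (L.map f) := by
  ext k c
  simp only [partialMatrix, Matrix.map_apply, Matrix.of_apply, map_jet, map_mulVec, map_cubicJet,
    map_samplePoint]

/-- A difference of two weighted jets of a monomial vector. -/
def twoJet (w : Fin 6 → R) (d : Fin 3 → ℕ) (s : Fin 3 → R) (w' : Fin 6 → R) (d' : Fin 3 → ℕ)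
    (s' : Fin 3 → R) (i : Fin 6) (μ : Fin 3 → ℕ) : R :=
  w i * jet d μ s - w' i * jet d' μ s'

theorem map_twoJet (f : R →+* S) (w : Fin 6 → R) (d : Fin 3 → ℕ) (s : Fin 3 → R)
    (w' : Fin 6 → R) (d' : Fin 3 → ℕ) (s' : Fin 3 → R) (i : Fin 6) (μ : Fin 3 → ℕ) :
    f (twoJet w d s w' d' s' i μ) = twoJet (f ∘ w) d (f ∘ s) (f ∘ w') d' (f ∘ s') i μ := by
  simp [twoJet, map_jet]

/-- The functional on monomial vectors given by the differentiated Euler relation. -/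
def eulerFunctional (L : Matrix (Fin 6) (Fin 8) R) (j : ℕ) (s : Fin 3 → R) :
    Fin 6 → (Fin 3 → ℕ) → R :=
  twoJet (L.mulVec (cubicJet 0 s)) (unitExp 3 j) s
    (4 • L.mulVec (cubicJet (unitExp 3 j) s)) 0 s

/-- The functional on monomial vectors comparing the `l`-th entries at two points. -/
def nodeFunctional (l : ℕ) (u v : Fin 3 → R) : Fin 6 → (Fin 3 → ℕ) → R :=
  twoJet (fun i => (unitExp 6 l i : R)) 0 u (fun i => (unitExp 6 l i : R)) 0 v

/-- The functional on monomial vectors given by the symmetry of the Hessian at a node. -/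
def hessianFunctional (L : Matrix (Fin 6) (Fin 8) R) (a b : ℕ) (u v : Fin 3 → R) :
    Fin 6 → (Fin 3 → ℕ) → R :=
  twoJet (L.mulVec (cubicJet (unitExp 3 b) v)) (unitExp 3 a) u
    (L.mulVec (cubicJet (unitExp 3 a) u)) (unitExp 3 b) v

/-- A list of functionals vanishing on gradients of quintics along the surface. -/
def relationFunctional (L : Matrix (Fin 6) (Fin 8) R) (u v : Fin 3 → R) (n : ℕ) :
    Fin 6 → (Fin 3 → ℕ) → R :=
  if n < 172 then eulerFunctional L (n % 2) (samplePoint R n)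
  else if n < 178 then nodeFunctional (n - 172) u v
  else hessianFunctional L ((n - 178) / 2) (n % 2) u v

theorem map_relationFunctional (f : R →+* S) (L : Matrix (Fin 6) (Fin 8) R) (u v : Fin 3 → R)
    (n : ℕ) (i : Fin 6) (μ : Fin 3 → ℕ) :
    f (relationFunctional L u v n i μ) =
      relationFunctional (L.map f) (f ∘ u) (f ∘ v) n i μ := by
  have h4 : ∀ w : Fin 6 → R, f ∘ (4 • w) = 4 • (f ∘ w) := fun w => by
    funext i
    simp [map_ofNat]
  have hn : ∀ w : Fin 6 → ℕ, (f ∘ fun i => (w i : R)) = fun i => (w i : S) := fun w => by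
    funext i
    simp
  unfold relationFunctional
  split_ifs
  · simp only [eulerFunctional, map_twoJet, h4, map_mulVec, map_cubicJet, map_samplePoint]
  · simp only [nodeFunctional, map_twoJet, hn]
  · simp only [hessianFunctional, map_twoJet, map_mulVec, map_cubicJet]

/-- The value of the `i`-th coordinate function of a `CoordExp`, as an element of `Fin 6`. -/
def CoordExp.idx (t : CoordExp) : Fin 6 := Fin.ofNat 6 t.i

/-- The relations of `relationFunctional` on a list of monomial vectors. -/
def relationMatrix (L : Matrix (Fin 6) (Fin 8) R) (u v : Fin 3 → R) :
    Matrix (Fin vectorExps.length) (Fin vectorExps.length) R :=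
  Matrix.of fun n c => relationFunctional L u v n vectorExps[c].idx vectorExps[c].toFun

theorem map_relationMatrix (f : R →+* S) (L : Matrix (Fin 6) (Fin 8) R) (u v : Fin 3 → R) :
    (relationMatrix L u v).map f = relationMatrix (L.map f) (f ∘ u) (f ∘ v) := by
  ext n c
  simp only [relationMatrix, Matrix.map_apply, Matrix.of_apply, map_relationFunctional]

end jets

/-- A sample projection. -/
def sampleProj : Matrix (Fin 6) (Fin 8) ℤ :=
  !![1, -1, 0, 0, 0, 0, 0, 0;
     0, 1, -1, 0, 0, 0, 0, 0;
     0, 0, 1, 0, -1, 0, 0, 0;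
     0, 0, 0, 0, 1, -1, 0, 0;
     0, 0, 0, 0, 0, 1, -1, 0;
     0, 0, 0, 0, 0, 0, 0, 1]

theorem packRow_eq {α : Type} (f : α → ℕ) (l : List α) :
    packRow f l = packDigits 1099511627776 (l.map fun a => f a % 4099) := by
  induction l with
  | nil => rfl
  | cons a l ih =>
    change strictly (Nat.mod (f a) 4099) (fun b => Nat.add b (Nat.mul 1099511627776 (packRow f l)))
      = _
    rw [strictly_eq, ih]
    rfl

theorem dotDigits_eq_sum {p : ℕ} : ∀ (l : List ℕ) (c : ℕ → ZMod p),
    dotDigits l c = ∑ j : Fin l.length, (l[j] : ZMod p) * c j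
  | [], _ => by simp [dotDigits]
  | a :: l, c => by
    change _ = ∑ j : Fin (l.length + 1), _
    rw [Fin.sum_univ_succ, dotDigits, dotDigits_eq_sum l]
    rfl

theorem prime_4099 : Nat.Prime 4099 := by norm_num

instance : Fact (Nat.Prime 4099) := ⟨prime_4099⟩

/-- If elimination succeeds on the packed rows, the determinant does not vanish. -/
theorem det_ne_zero_of_elimCheck {α : Type} (items : List α) (rows : List ℕ)
    (hlen : items.length ≤ 1000)
    (M : Matrix (Fin items.length) (Fin items.length) (ZMod 4099))
    (hM : ∀ N ∈ rows, ∃ k f, N = packRow f items ∧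
      ∀ j : Fin items.length, (f items[j] : ZMod 4099) = M k j)
    (h : elimCheck 1099511627776 4099 items.length rows = true) : M.det ≠ 0 := by
  intro hdet
  obtain ⟨c, hc, hMc⟩ := Matrix.exists_mulVec_eq_zero_iff.2 hdet
  refine hc (funext fun j => ?_)
  have := eq_zero_of_elimCheck (p := 4099) (by norm_num) items.length 4099 rows
    (fun j => if h : j < items.length then c ⟨j, h⟩ else 0) (by omega) ?_ h j j.2
  · simpa using this
  · intro N hN
    obtain ⟨k, f, rfl, hf⟩ := hM N hN
    refine ⟨items.map fun a => f a % 4099, by simp, ?_, packRow_eq f items, ?_⟩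
    · intro a ha
      obtain ⟨x, -, rfl⟩ := List.mem_map.1 ha
      exact Nat.mod_lt _ (by norm_num)
    · rw [dotDigits_eq_sum]
      have h0 := congrFun hMc k
      rw [Matrix.mulVec, dotProduct] at h0
      rw [← Equiv.sum_comp (finCongr (by simp : items.length =
        (items.map fun a => f a % 4099).length))]
      refine Eq.trans ?_ h0
      refine Finset.sum_congr rfl fun j _ => ?_
      rw [← hf]
      simp

theorem natDelta_eq (a b : ℕ) : natDelta a b = if b = a then 1 else 0 := by
  unfold natDelta
  split_ifs with h
  · subst h
    rw [show Nat.beq b b = true from Nat.beq_refl b]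
  · rw [show Nat.beq a b = false from Bool.eq_false_iff.2 fun h' =>
      h (Nat.eq_of_beq_eq_true h').symm]

section casts

variable {R : Type*} [CommRing R]

theorem natJet_cast (i j k x y z a b c : ℕ) : (natJet i j k x y z a b c : R) =
    jet ![i, j, k] ![a, b, c] ![(x : R), y, z] := by
  have : natJet i j k x y z a b c =
    a ^ i * x ^ (a - i) * (b ^ j * y ^ (b - j) * (c ^ k * z ^ (c - k))) := rfl
  rw [this]
  simp [jet, Fin.prod_univ_three]
  ring

theorem natPartial_cast (i₀ i₁ i₂ i₃ i₄ i₅ x₀ x₁ x₂ x₃ x₄ x₅ : ℕ) (t : SixExp) :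
    (natPartial i₀ i₁ i₂ i₃ i₄ i₅ x₀ x₁ x₂ x₃ x₄ x₅ t : R) =
      jet ![i₀, i₁, i₂, i₃, i₄, i₅] t.toFun ![(x₀ : R), x₁, x₂, x₃, x₄, x₅] := by
  have : natPartial i₀ i₁ i₂ i₃ i₄ i₅ x₀ x₁ x₂ x₃ x₄ x₅ t =
    natJet i₀ i₁ i₂ x₀ x₁ x₂ t.a t.b t.c * natJet i₃ i₄ i₅ x₃ x₄ x₅ t.d t.e t.f := rfl
  rw [this]
  push_cast
  rw [natJet_cast, natJet_cast]
  simp [jet, Fin.prod_univ_succ, SixExp.toFun]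
  ring

end casts

theorem unitExp_six (k : ℕ) : unitExp 6 k = ![natDelta k 0, natDelta k 1, natDelta k 2,
    natDelta k 3, natDelta k 4, natDelta k 5] := by
  funext i
  fin_cases i <;> simp [unitExp, natDelta_eq]

theorem exists_withSampleForms {α : Type} (i j k x y z : ℕ)
    (K : ℕ → ℕ → ℕ → ℕ → ℕ → ℕ → α) :
    ∃ n₀ n₁ n₂ n₃ n₄ n₅ : ℕ, withSampleForms i j k x y z K = K n₀ n₁ n₂ n₃ n₄ n₅ ∧
      (sampleProj.map (Int.cast : ℤ → ZMod 4099)).mulVec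
        (cubicJet ![i, j, k] ![(x : ZMod 4099), y, z]) =
        ![(n₀ : ZMod 4099), n₁, n₂, n₃, n₄, n₅] := by
  unfold withSampleForms
  simp only [strictly_eq]
  refine ⟨_, _, _, _, _, _, rfl, ?_⟩
  have h1 : ((4098 : ℕ) : ZMod 4099) = -1 := by decide
  have key : ∀ a b : ℕ, ((Nat.mod (Nat.add a (Nat.mul 4098 b)) 4099 : ℕ) : ZMod 4099) = a - b := by
    intro a b
    change (((a + 4098 * b) % 4099 : ℕ) : ZMod 4099) = _
    rw [ZMod.natCast_mod, Nat.cast_add, Nat.cast_mul, h1]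
    ring
  have key' : ∀ a : ℕ, ((Nat.mod a 4099 : ℕ) : ZMod 4099) = a := fun a => ZMod.natCast_mod a 4099
  simp only [key, key', natJet_cast]
  funext l
  fin_cases l <;>
    simp [sampleProj, Matrix.mulVec, dotProduct, Fin.sum_univ_succ, cubicJet, cubicExp,
      sub_eq_add_neg]

theorem exists_partialRow (k : ℕ) : ∃ f : SixExp → ℕ, partialRow k = packRow f quinticExps ∧
    ∀ t, (f t : ZMod 4099) = jet (unitExp 6 (k % 6)) t.toFun
      ((sampleProj.map (Int.cast : ℤ → ZMod 4099)).mulVec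
        (cubicJet 0 (samplePoint (ZMod 4099) k))) := by
  unfold partialRow
  simp only [strictly_eq]
  obtain ⟨n₀, n₁, n₂, n₃, n₄, n₅, hK, hL⟩ := exists_withSampleForms 0 0 0 (Nat.add k 2)
    (sampleCoord k) 1 (fun x₀ x₁ x₂ x₃ x₄ x₅ => packRow (natPartial (natDelta (Nat.mod k 6) 0)
      (natDelta (Nat.mod k 6) 1) (natDelta (Nat.mod k 6) 2) (natDelta (Nat.mod k 6) 3)
      (natDelta (Nat.mod k 6) 4) (natDelta (Nat.mod k 6) 5) x₀ x₁ x₂ x₃ x₄ x₅) quinticExps)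
  refine ⟨_, hK, fun t => ?_⟩
  have h0 : (0 : Fin 3 → ℕ) = ![0, 0, 0] := by
    funext i
    fin_cases i <;> rfl
  rw [natPartial_cast, unitExp_six, h0, samplePoint, hL]
  rfl

theorem det_partialMatrix_sampleProj :
    (partialMatrix (sampleProj.map (Int.cast : ℤ → ZMod 4099))).det ≠ 0 := by
  have hlen : quinticExps.length = 244 := rfl
  refine det_ne_zero_of_elimCheck _ ((List.range 244).map partialRow) (by omega) _ ?_ ?_
  · intro N hN
    obtain ⟨k, hk, rfl⟩ := List.mem_map.1 hN
    obtain ⟨f, hf, hf'⟩ := exists_partialRow k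
    exact ⟨⟨k, by simpa [hlen] using hk⟩, f, hf, fun j => hf' _⟩
  · have := elimCheck_partialRow
    rw [strictMap_eq] at this
    exact this

theorem natSelect_cast (w₀ w₁ w₂ w₃ w₄ w₅ : ℕ) (i : Fin 6) :
    (natSelect w₀ w₁ w₂ w₃ w₄ w₅ i : ZMod 4099) =
      ![(w₀ : ZMod 4099), w₁, w₂, w₃, w₄, w₅] i := by
  fin_cases i <;> rfl

theorem natTwoJet_cast (w₀ w₁ w₂ w₃ w₄ w₅ i j k x y z w₀' w₁' w₂' w₃' w₄' w₅' i' j' k' x' y' z' : ℕ)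
    (t : CoordExp) (ht : t.i < 6) :
    (natTwoJet w₀ w₁ w₂ w₃ w₄ w₅ i j k x y z w₀' w₁' w₂' w₃' w₄' w₅' i' j' k' x' y' z' t :
      ZMod 4099) =
    twoJet ![(w₀ : ZMod 4099), w₁, w₂, w₃, w₄, w₅] ![i, j, k] ![(x : ZMod 4099), y, z]
      ![(w₀' : ZMod 4099), w₁', w₂', w₃', w₄', w₅'] ![i', j', k'] ![(x' : ZMod 4099), y', z']
      t.idx t.toFun := by
  have h1 : ((4098 : ℕ) : ZMod 4099) = -1 := by decide
  have hi : (t.idx : ℕ) = t.i := Nat.mod_eq_of_lt ht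
  have : natTwoJet w₀ w₁ w₂ w₃ w₄ w₅ i j k x y z w₀' w₁' w₂' w₃' w₄' w₅' i' j' k' x' y' z' t =
    natSelect w₀ w₁ w₂ w₃ w₄ w₅ t.i * natJet i j k x y z t.a t.b t.c + 4098 *
    (natSelect w₀' w₁' w₂' w₃' w₄' w₅' t.i * natJet i' j' k' x' y' z' t.a t.b t.c) := rfl
  rw [this, ← hi]
  simp only [Nat.cast_add, Nat.cast_mul, h1, natSelect_cast, natJet_cast, twoJet, CoordExp.toFun]
  ring

theorem vectorExps_idx_lt : ∀ t ∈ vectorExps, t.i < 6 := by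
  have : vectorExps.all (fun t => Nat.blt t.i 6) = true := by decide +kernel
  intro t ht
  simpa [Nat.blt_eq] using List.all_eq_true.1 this t ht

theorem unitExp_three (k : ℕ) (hk : k < 2) : unitExp 3 k = ![natDelta k 0, natDelta k 1, 0] := by
  funext i
  fin_cases i
  · simp [unitExp, natDelta_eq]
  · simp [unitExp, natDelta_eq]
  · simp [unitExp]
    omega

theorem exists_eulerRow (k : ℕ) : ∃ f : CoordExp → ℕ, eulerRow k = packRow f vectorExps ∧
    ∀ t ∈ vectorExps, (f t : ZMod 4099) = eulerFunctional
      (sampleProj.map (Int.cast : ℤ → ZMod 4099)) (k % 2) (samplePoint (ZMod 4099) k)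
      t.idx t.toFun := by
  unfold eulerRow
  simp only [strictly_eq]
  obtain ⟨x₀, x₁, x₂, x₃, x₄, x₅, hK, hL⟩ := exists_withSampleForms 0 0 0 (Nat.add k 2)
    (sampleCoord k) 1 (fun x₀ x₁ x₂ x₃ x₄ x₅ =>
      withSampleForms (natDelta (Nat.mod k 2) 0) (natDelta (Nat.mod k 2) 1) 0 (Nat.add k 2)
        (sampleCoord k) 1 fun y₀ y₁ y₂ y₃ y₄ y₅ =>
      packRow (natTwoJet x₀ x₁ x₂ x₃ x₄ x₅ (natDelta (Nat.mod k 2) 0) (natDelta (Nat.mod k 2) 1) 0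
        (Nat.add k 2) (sampleCoord k) 1 (Nat.mul 4 y₀) (Nat.mul 4 y₁) (Nat.mul 4 y₂)
        (Nat.mul 4 y₃) (Nat.mul 4 y₄) (Nat.mul 4 y₅) 0 0 0 (Nat.add k 2) (sampleCoord k) 1)
        vectorExps)
  obtain ⟨y₀, y₁, y₂, y₃, y₄, y₅, hK', hL'⟩ := exists_withSampleForms (natDelta (Nat.mod k 2) 0)
    (natDelta (Nat.mod k 2) 1) 0 (Nat.add k 2)
    (sampleCoord k) 1 (fun y₀ y₁ y₂ y₃ y₄ y₅ =>
      packRow (natTwoJet x₀ x₁ x₂ x₃ x₄ x₅ (natDelta (Nat.mod k 2) 0) (natDelta (Nat.mod k 2) 1) 0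
        (Nat.add k 2) (sampleCoord k) 1 (Nat.mul 4 y₀) (Nat.mul 4 y₁) (Nat.mul 4 y₂)
        (Nat.mul 4 y₃) (Nat.mul 4 y₄) (Nat.mul 4 y₅) 0 0 0 (Nat.add k 2) (sampleCoord k) 1)
        vectorExps)
  refine ⟨_, hK.trans hK', fun t ht => ?_⟩
  have h4 : 4 • ![(y₀ : ZMod 4099), y₁, y₂, y₃, y₄, y₅] = ![((Nat.mul 4 y₀ : ℕ) : ZMod 4099),
      (Nat.mul 4 y₁ : ℕ), (Nat.mul 4 y₂ : ℕ), (Nat.mul 4 y₃ : ℕ), (Nat.mul 4 y₄ : ℕ),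
      (Nat.mul 4 y₅ : ℕ)] := by
    funext i
    fin_cases i <;> simp
  have h0 : (0 : Fin 3 → ℕ) = ![0, 0, 0] := by
    funext i
    fin_cases i <;> rfl
  rw [natTwoJet_cast _ _ _ _ _ _ _ _ _ _ _ _ _ _ _ _ _ _ _ _ _ _ _ _ _
    (vectorExps_idx_lt t ht), eulerFunctional, unitExp_three _ (Nat.mod_lt _ (by norm_num)),
    samplePoint, h0, hL]
  erw [hL']
  rw [h4]
  rfl

theorem exists_nodeRow (l : ℕ) : ∃ f : CoordExp → ℕ, nodeRow l = packRow f vectorExps ∧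
    ∀ t ∈ vectorExps, (f t : ZMod 4099) =
      nodeFunctional l ![0, 0, 1] ![1, 1, 1] t.idx t.toFun := by
  unfold nodeRow
  simp only [strictly_eq]
  refine ⟨_, rfl, fun t ht => ?_⟩
  have h0 : (0 : Fin 3 → ℕ) = ![0, 0, 0] := by
    funext i
    fin_cases i <;> rfl
  have h6 : (fun i => (unitExp 6 l i : ZMod 4099)) =
      ![(natDelta l 0 : ZMod 4099), natDelta l 1, natDelta l 2, natDelta l 3, natDelta l 4,
        natDelta l 5] := by
    rw [unitExp_six]
    funext i
    fin_cases i <;> rfl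
  rw [natTwoJet_cast _ _ _ _ _ _ _ _ _ _ _ _ _ _ _ _ _ _ _ _ _ _ _ _ _
    (vectorExps_idx_lt t ht), nodeFunctional, h6, h0]
  simp

theorem exists_hessianRow (a b : ℕ) (ha : a < 2) (hb : b < 2) : ∃ f : CoordExp → ℕ,
    hessianRow (natDelta a 0) (natDelta a 1) (natDelta b 0) (natDelta b 1) =
      packRow f vectorExps ∧
    ∀ t ∈ vectorExps, (f t : ZMod 4099) =
      hessianFunctional (sampleProj.map (Int.cast : ℤ → ZMod 4099)) a b ![0, 0, 1] ![1, 1, 1]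
        t.idx t.toFun := by
  unfold hessianRow
  obtain ⟨x₀, x₁, x₂, x₃, x₄, x₅, hK, hL⟩ := exists_withSampleForms (natDelta b 0) (natDelta b 1)
    0 1 1 1 (fun x₀ x₁ x₂ x₃ x₄ x₅ =>
      withSampleForms (natDelta a 0) (natDelta a 1) 0 0 0 1 fun y₀ y₁ y₂ y₃ y₄ y₅ =>
      packRow (natTwoJet x₀ x₁ x₂ x₃ x₄ x₅ (natDelta a 0) (natDelta a 1) 0 0 0 1
        y₀ y₁ y₂ y₃ y₄ y₅ (natDelta b 0) (natDelta b 1) 0 1 1 1) vectorExps)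
  obtain ⟨y₀, y₁, y₂, y₃, y₄, y₅, hK', hL'⟩ := exists_withSampleForms (natDelta a 0) (natDelta a 1)
    0 0 0 1 (fun y₀ y₁ y₂ y₃ y₄ y₅ =>
      packRow (natTwoJet x₀ x₁ x₂ x₃ x₄ x₅ (natDelta a 0) (natDelta a 1) 0 0 0 1
        y₀ y₁ y₂ y₃ y₄ y₅ (natDelta b 0) (natDelta b 1) 0 1 1 1) vectorExps)
  refine ⟨_, hK.trans hK', fun t ht => ?_⟩
  rw [natTwoJet_cast _ _ _ _ _ _ _ _ _ _ _ _ _ _ _ _ _ _ _ _ _ _ _ _ _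
    (vectorExps_idx_lt t ht), hessianFunctional, unitExp_three _ ha, unitExp_three _ hb]
  rw [← hL, ← hL']
  simp

theorem det_relationMatrix_sampleProj :
    (relationMatrix (sampleProj.map (Int.cast : ℤ → ZMod 4099)) ![0, 0, 1] ![1, 1, 1]).det ≠ 0 := by
  have hlen : vectorExps.length = 182 := rfl
  refine det_ne_zero_of_elimCheck _ ((List.range 172).map eulerRow ++
    ((List.range 6).map nodeRow ++ [hessianRow 1 0 1 0, hessianRow 1 0 0 1, hessianRow 0 1 1 0,
      hessianRow 0 1 0 1])) (by omega) _ ?_ ?_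
  · have key : ∀ (n : ℕ) (_ : n < 182) (N : ℕ), (∃ f : CoordExp → ℕ, N = packRow f vectorExps ∧
        ∀ t ∈ vectorExps, (f t : ZMod 4099) = relationFunctional
          (sampleProj.map (Int.cast : ℤ → ZMod 4099)) ![0, 0, 1] ![1, 1, 1] n t.idx t.toFun) →
        ∃ (k : Fin vectorExps.length) (f : CoordExp → ℕ), N = packRow f vectorExps ∧
          ∀ j : Fin vectorExps.length, (f vectorExps[j] : ZMod 4099) = relationMatrix
            (sampleProj.map (Int.cast : ℤ → ZMod 4099)) ![0, 0, 1] ![1, 1, 1] k j := by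
      rintro n hn N ⟨f, hf, hf'⟩
      exact ⟨⟨n, by omega⟩, f, hf, fun j => hf' _ (List.getElem_mem _)⟩
    intro N hN
    rcases List.mem_append.1 hN with hN | hN
    · obtain ⟨k, hk, rfl⟩ := List.mem_map.1 hN
      have hk := List.mem_range.1 hk
      refine key k (by omega) _ ?_
      have := exists_eulerRow k
      simpa only [relationFunctional, if_pos hk] using this
    · rcases List.mem_append.1 hN with hN | hN
      · obtain ⟨k, hk, rfl⟩ := List.mem_map.1 hN
        have hk := List.mem_range.1 hk
        refine key (172 + k) (by omega) _ ?_
        have := exists_nodeRow k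
        simpa only [relationFunctional, if_neg (by omega : ¬ 172 + k < 172),
          if_pos (by omega : 172 + k < 178), Nat.add_sub_cancel_left] using this
      · simp only [List.mem_cons, List.not_mem_nil, or_false] at hN
        have hess : ∀ (n a b : ℕ), n < 182 → a < 2 → b < 2 →
            relationFunctional (sampleProj.map (Int.cast : ℤ → ZMod 4099)) ![0, 0, 1] ![1, 1, 1] n =
            hessianFunctional (sampleProj.map (Int.cast : ℤ → ZMod 4099)) a b ![0, 0, 1]
              ![1, 1, 1] →
            N = hessianRow (natDelta a 0) (natDelta a 1) (natDelta b 0) (natDelta b 1) →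
            ∃ (k : Fin vectorExps.length) (f : CoordExp → ℕ), N = packRow f vectorExps ∧
              ∀ j : Fin vectorExps.length, (f vectorExps[j] : ZMod 4099) = relationMatrix
                (sampleProj.map (Int.cast : ℤ → ZMod 4099)) ![0, 0, 1] ![1, 1, 1] k j := by
          intro n a b hn ha hb h h'
          refine key n hn _ ?_
          rw [h, h']
          exact exists_hessianRow a b ha hb
        rcases hN with h | h | h | h
        · exact hess 178 0 0 (by norm_num) (by norm_num) (by norm_num)
            (by simp [relationFunctional]) h
        · exact hess 179 0 1 (by norm_num) (by norm_num) (by norm_num)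
            (by simp [relationFunctional]) h
        · exact hess 180 1 0 (by norm_num) (by norm_num) (by norm_num)
            (by simp [relationFunctional]) h
        · exact hess 181 1 1 (by norm_num) (by norm_num) (by norm_num)
            (by simp [relationFunctional]) h
  · have := elimCheck_twoJetRow
    rw [strictMap_eq, strictMap_eq] at this
    exact this

section linear_algebra

variable {K V : Type*} [Field K] [AddCommGroup V] [Module K V] [FiniteDimensional K V]

/-- A nonvanishing minor of a family of functionals bounds their common kernel. -/
theorem finrank_add_card_le_of_det_ne_zero {ι : Type*} [Fintype ι] [DecidableEq ι]
    (W : Submodule K V) (φ : ι → V →ₗ[K] K) (hW : ∀ i, ∀ w ∈ W, φ i w = 0) (v : ι → V)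
    (h : (Matrix.of fun i j => φ i (v j)).det ≠ 0) :
    Module.finrank K W + Fintype.card ι ≤ Module.finrank K V := by
  have hsurj : Function.Surjective (LinearMap.pi φ) := by
    intro y
    have hu : IsUnit (Matrix.of fun i j => φ i (v j)) :=
      (Matrix.isUnit_iff_isUnit_det _).2 (isUnit_iff_ne_zero.2 h)
    obtain ⟨c, hc⟩ := Matrix.mulVec_surjective_iff_isUnit.2 hu y
    refine ⟨∑ j, c j • v j, funext fun i => ?_⟩
    rw [← hc]
    simp [Matrix.mulVec, dotProduct, mul_comm]
  have h1 := LinearMap.finrank_range_add_finrank_ker (LinearMap.pi φ)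
  rw [LinearMap.range_eq_top.2 hsurj, finrank_top, Module.finrank_fintype_fun_eq_card] at h1
  have h2 : W ≤ LinearMap.ker (LinearMap.pi φ) := fun w hw =>
    LinearMap.mem_ker.2 (funext fun i => hW i w hw)
  have := Submodule.finrank_mono h2
  omega

/-- A family of functionals with small common kernel has a large nonvanishing minor. -/
theorem exists_det_ne_zero_of_finrank_add_le {ι : Type*} (W : Submodule K V)
    (φ : ι → V →ₗ[K] K) (hW : ∀ w, (∀ i, φ i w = 0) → w ∈ W) (r : ℕ)
    (hr : Module.finrank K W + r ≤ Module.finrank K V) :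
    ∃ (i : Fin r → ι) (v : Fin r → V), (Matrix.of fun k l => φ (i k) (v l)).det ≠ 0 := by
  induction r with
  | zero => exact ⟨Fin.elim0, Fin.elim0, by simp⟩
  | succ r ih =>
    obtain ⟨i, v, h⟩ := ih (by omega)
    let Ψ : V →ₗ[K] (Fin r → K) := LinearMap.pi fun k => φ (i k)
    have h1 := LinearMap.finrank_range_add_finrank_ker Ψ
    have h2 : Module.finrank K (LinearMap.range Ψ) ≤ r := by
      simpa using Submodule.finrank_le (LinearMap.range Ψ)
    have h3 : ¬ LinearMap.ker Ψ ≤ W := fun hle => by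
      have := Submodule.finrank_mono hle
      omega
    obtain ⟨x, hx, hxW⟩ := Set.not_subset.1 h3
    obtain ⟨i₀, hi₀⟩ : ∃ i₀, φ i₀ x ≠ 0 := by
      by_contra! hcon
      exact hxW (hW x hcon)
    refine ⟨Fin.cons i₀ i, Fin.cons x v, ?_⟩
    rw [Matrix.det_succ_column_zero, Fin.sum_univ_succ, Finset.sum_eq_zero]
    · have : (Matrix.of fun k l => φ ((Fin.cons i₀ i : Fin (r + 1) → ι) k)
          ((Fin.cons x v : Fin (r + 1) → V) l)).submatrix (Fin.succAbove 0) Fin.succ =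
          Matrix.of fun k l => φ (i k) (v l) := by
        ext k l
        simp
      rw [this]
      simpa using ⟨hi₀, h⟩
    · intro k _
      have : φ (i k) x = 0 := congrFun (LinearMap.mem_ker.1 hx) k
      simp [this]

end linear_algebra

/-- The space of forms of degree `d` in `n` variables is finite-dimensional. -/
instance finiteDimensional_homogeneousSubmodule (n d : ℕ) :
    FiniteDimensional ℂ (homogeneousSubmodule (Fin n) ℂ d) :=
  Module.Finite.iff_fg.2 (homogeneousSubmodule_fg (Fin n) ℂ d)

theorem finrank_homogeneousSubmodule (n d : ℕ) :
    Module.finrank ℂ (homogeneousSubmodule (Fin n) ℂ d) = (n + d - 1).choose d := by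
  have h : homogeneousSubmodule (Fin n) ℂ d = restrictSupport ℂ
      (Finset.finsuppAntidiag (Finset.univ : Finset (Fin n)) d : Set (Fin n →₀ ℕ)) := by
    rw [homogeneousSubmodule_eq_finsupp_supported]
    congr 1
    ext μ
    simp [Finsupp.degree_eq_sum]
  rw [h, Module.finrank_eq_card_basis (basisRestrictSupport ℂ _)]
  simp [Finset.card_finsuppAntidiag_nat_eq_choose]

theorem eval_monomial_eq_jet {n : ℕ} (μ : Fin n →₀ ℕ) (s : Fin n → ℂ) :
    eval s (monomial μ 1) = jet 0 μ s := by
  simp [eval_monomial, jet, Finsupp.prod_fintype]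

theorem eval_pderiv_monomial_eq_jet {n : ℕ} (j : Fin n) (μ : Fin n →₀ ℕ) (s : Fin n → ℂ) :
    eval s (pderiv j (monomial μ 1)) = jet (unitExp n j) μ s := by
  rw [pderiv_monomial, eval_monomial, Finsupp.prod_fintype _ _ (by simp), jet, one_mul,
    ← Finset.mul_prod_erase _ _ (Finset.mem_univ j),
    ← Finset.mul_prod_erase Finset.univ _ (Finset.mem_univ j), ← mul_assoc]
  congr 1
  · simp [unitExp]
  · refine Finset.prod_congr rfl fun l hl => ?_
    have hl' := Finset.ne_of_mem_erase hl
    have : ¬ l.val = j.val := fun h => hl' (Fin.ext h)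
    simp [unitExp, this, hl'.symm]

/-- Quintic forms in six variables whose partial derivatives vanish on the surface parametrized
by the cubics `L` in the eight standard monomials. -/
def doubleQuintics (L : Matrix (Fin 6) (Fin 8) ℂ) :
    Submodule ℂ (homogeneousSubmodule (Fin 6) ℂ 5) :=
  ⨅ (s : Fin 3 → ℂ) (i : Fin 6), LinearMap.ker
    ((aeval (R := ℂ) (L.mulVec (cubicJet 0 s))).toLinearMap ∘ₗ (pderiv i).toLinearMap ∘ₗ
      (homogeneousSubmodule (Fin 6) ℂ 5).subtype)

theorem mem_doubleQuintics {L : Matrix (Fin 6) (Fin 8) ℂ} {f : homogeneousSubmodule (Fin 6) ℂ 5} :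
    f ∈ doubleQuintics L ↔ ∀ s i, eval (L.mulVec (cubicJet 0 s)) (pderiv i (f : Pl 6)) = 0 := by
  simp [doubleQuintics, aeval_eq_eval]

/-- The value of a partial derivative at a point as a functional on quintic forms. -/
def quinticPartial (i : Fin 6) (x : Fin 6 → ℂ) : homogeneousSubmodule (Fin 6) ℂ 5 →ₗ[ℂ] ℂ :=
  (aeval (R := ℂ) x).toLinearMap ∘ₗ (pderiv i).toLinearMap ∘ₗ
      (homogeneousSubmodule (Fin 6) ℂ 5).subtype

theorem quinticPartial_apply (i : Fin 6) (x : Fin 6 → ℂ) (f : homogeneousSubmodule (Fin 6) ℂ 5) :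
    quinticPartial i x f = eval x (pderiv i (f : Pl 6)) := by
  simp [quinticPartial, aeval_eq_eval]

theorem quinticExps_sum : ∀ t ∈ quinticExps, t.a + t.b + t.c + t.d + t.e + t.f = 5 := by
  have : quinticExps.all (fun t => Nat.beq (t.a + t.b + t.c + t.d + t.e + t.f) 5) = true := by
    decide +kernel
  intro t ht
  simpa [Nat.beq_eq] using List.all_eq_true.1 this t ht

theorem finrank_doubleQuintics_add_le (L : Matrix (Fin 6) (Fin 8) ℂ) (items : List SixExp)
    (hitems : ∀ t ∈ items, t.a + t.b + t.c + t.d + t.e + t.f = 5)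
    (M : Matrix (Fin items.length) (Fin items.length) ℂ)
    (hM : ∀ k c, M k c = jet (unitExp 6 (k % 6)) items[c].toFun
      (L.mulVec (cubicJet 0 (samplePoint ℂ k)))) (h : M.det ≠ 0) :
    Module.finrank ℂ (doubleQuintics L) + items.length ≤ 252 := by
  have key := finrank_add_card_le_of_det_ne_zero (ι := Fin items.length) (doubleQuintics L)
    (fun k => quinticPartial (Fin.ofNat 6 k) (L.mulVec (cubicJet 0 (samplePoint ℂ k))))
    (fun k f hf => by
      rw [quinticPartial_apply]
      exact mem_doubleQuintics.1 hf _ _)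
    (fun c => ⟨monomial (Finsupp.equivFunOnFinite.symm items[c].toFun) 1,
      isHomogeneous_monomial 1 (by
        have := hitems items[c] (List.getElem_mem _)
        rw [Finsupp.degree_eq_sum]
        simpa [Fin.sum_univ_succ, SixExp.toFun, add_assoc] using this)⟩)
    (by
      refine fun h' => h (Eq.trans (congrArg Matrix.det (Matrix.ext fun k c => ?_)) h')
      rw [Matrix.of_apply, quinticPartial_apply, hM]
      rw [eval_pderiv_monomial_eq_jet]
      rfl)
  rw [finrank_homogeneousSubmodule, Fintype.card_fin] at key
  exact key

theorem finrank_doubleQuintics_le (L : Matrix (Fin 6) (Fin 8) ℂ) (h : (partialMatrix L).det ≠ 0) :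
    Module.finrank ℂ (doubleQuintics L) ≤ 8 := by
  have hlen : quinticExps.length = 244 := rfl
  have := finrank_doubleQuintics_add_le L quinticExps quinticExps_sum (partialMatrix L)
    (fun k c => rfl) h
  omega

theorem eval_aeval {ι κ : Type*} (φ : κ → MvPolynomial ι ℂ) (s : ι → ℂ) (h : MvPolynomial κ ℂ) :
    eval s (aeval φ h) = eval (fun k => eval s (φ k)) h := by
  induction h using MvPolynomial.induction_on with
  | C a => simp
  | add p q hp hq => simp_all
  | mul_X p i hp => simp_all

/-- The cubic forms with coefficient matrix `L` in the eight standard monomials. -/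
def cubicForms (L : Matrix (Fin 6) (Fin 8) ℂ) (i : Fin 6) : Pl 3 :=
  ∑ k, C (L i k) * monomial (Finsupp.equivFunOnFinite.symm (cubicExp k)) 1

theorem eval_cubicForms (L : Matrix (Fin 6) (Fin 8) ℂ) (i : Fin 6) (s : Fin 3 → ℂ) :
    eval s (cubicForms L i) = L.mulVec (cubicJet 0 s) i := by
  simp only [cubicForms, map_sum, map_mul, eval_C, eval_monomial_eq_jet]
  rfl

theorem eval_pderiv_cubicForms (L : Matrix (Fin 6) (Fin 8) ℂ) (i : Fin 6) (j : Fin 3)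
    (s : Fin 3 → ℂ) :
    eval s (pderiv j (cubicForms L i)) = L.mulVec (cubicJet (unitExp 3 j) s) i := by
  simp only [cubicForms, map_sum, pderiv_C_mul, map_mul, eval_C, eval_pderiv_monomial_eq_jet]
  rfl

theorem eval_aeval_cubicForms (L : Matrix (Fin 6) (Fin 8) ℂ) (s : Fin 3 → ℂ) (h : Pl 6) :
    eval s (aeval (cubicForms L) h) = eval (L.mulVec (cubicJet 0 s)) h := by
  have : L.mulVec (cubicJet 0 s) = fun i => eval s (cubicForms L i) :=
    funext fun i => (eval_cubicForms L i s).symm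
  rw [this, eval_aeval]

theorem pderiv_aeval {m n : ℕ} (φ : Fin m → Pl n) (j : Fin n) (h : Pl m) :
    pderiv j (aeval φ h) = ∑ i, pderiv j (φ i) * aeval φ (pderiv i h) := by
  induction h using MvPolynomial.induction_on with
  | C a => simp
  | add p q hp hq => simp only [map_add, hp, hq, mul_add, Finset.sum_add_distrib]
  | mul_X p i hp =>
    have h1 : ∀ k, aeval φ (pderiv k (p * X i)) =
        aeval φ (pderiv k p) * φ i + if k = i then aeval φ p else 0 := by
      intro k
      rw [pderiv_mul, pderiv_X, map_add, map_mul, map_mul, aeval_X]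
      by_cases hk : k = i
      · subst hk
        rw [Pi.single_eq_same, if_pos rfl, map_one, mul_one]
      · rw [Pi.single_eq_of_ne (Ne.symm hk), if_neg hk, map_zero, mul_zero]
    simp only [h1, mul_add]
    rw [map_mul, aeval_X, pderiv_mul, hp, Finset.sum_add_distrib, Finset.sum_mul]
    have h2 : ∑ k, pderiv j (φ k) * (if k = i then aeval φ p else 0) =
        aeval φ p * pderiv j (φ i) := by
      rw [Finset.sum_eq_single i (fun k _ hk => by rw [if_neg hk, mul_zero]) (by simp),
        if_pos rfl, mul_comm]
    rw [h2]
    simp only [mul_assoc]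

theorem pderiv_pderiv_comm {n : ℕ} (i j : Fin n) (p : Pl n) :
    pderiv i (pderiv j p) = pderiv j (pderiv i p) := by
  have h : ⁅(pderiv i : Derivation ℂ (Pl n) (Pl n)), pderiv j⁆ = 0 := derivation_ext fun l => by
    have key : ∀ i j : Fin n, pderiv i (pderiv j (X l : Pl n)) = 0 := fun i j => by
      rw [pderiv_X]
      by_cases hl : l = j
      · subst hl
        simp
      · simp [hl]
    rw [Derivation.commutator_apply, key, key, sub_zero]
    rfl
  have := congrArg (fun D : Derivation ℂ (Pl n) (Pl n) => D p) h
  simpa [Derivation.commutator_apply, sub_eq_zero] using this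

/-- The partial derivatives of a form in six variables along the surface parametrized by `L`. -/
def gradPullback (L : Matrix (Fin 6) (Fin 8) ℂ) : Pl 6 →ₗ[ℂ] (Fin 6 → Pl 3) :=
  LinearMap.pi fun i => (aeval (cubicForms L)).toLinearMap ∘ₗ (pderiv i).toLinearMap

theorem gradPullback_apply (L : Matrix (Fin 6) (Fin 8) ℂ) (f : Pl 6) (i : Fin 6) :
    gradPullback L f i = aeval (cubicForms L) (pderiv i f) := rfl

/-- The linear functional on `Pl n` with the values `F` on monomials. -/
def monomialFunctional {n : ℕ} (F : (Fin n → ℕ) → ℂ) : Pl n →ₗ[ℂ] ℂ :=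
  (basisMonomials (Fin n) ℂ).constr ℂ fun μ => F μ

theorem monomialFunctional_monomial {n : ℕ} (F : (Fin n → ℕ) → ℂ) (μ : Fin n →₀ ℕ) :
    monomialFunctional F (monomial μ 1) = F μ := by
  have : monomial μ (1 : ℂ) = basisMonomials (Fin n) ℂ μ := by rw [coe_basisMonomials]
  rw [monomialFunctional, this, Module.Basis.constr_basis]

theorem monomialFunctional_jet_zero {n : ℕ} (s : Fin n → ℂ) (p : Pl n) :
    monomialFunctional (fun μ => jet 0 μ s) p = eval s p := by
  have : monomialFunctional (fun μ => jet 0 μ s) = (aeval (R := ℂ) s).toLinearMap :=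
    (basisMonomials (Fin n) ℂ).ext fun μ => by
      simp only [coe_basisMonomials, monomialFunctional_monomial, AlgHom.toLinearMap_apply,
        aeval_eq_eval]
      exact (eval_monomial_eq_jet μ s).symm
  rw [this]
  simp [aeval_eq_eval]

theorem monomialFunctional_jet_unitExp {n : ℕ} (j : Fin n) (s : Fin n → ℂ) (p : Pl n) :
    monomialFunctional (fun μ => jet (unitExp n j) μ s) p = eval s (pderiv j p) := by
  have : monomialFunctional (fun μ => jet (unitExp n j) μ s) =
      (aeval (R := ℂ) s).toLinearMap ∘ₗ (pderiv j).toLinearMap :=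
    (basisMonomials (Fin n) ℂ).ext fun μ => by
      rw [coe_basisMonomials, monomialFunctional_monomial, ← eval_pderiv_monomial_eq_jet]
      simp [aeval_eq_eval]
  rw [this]
  simp [aeval_eq_eval]

/-- The linear functional on vectors of polynomials with the values `F` on monomial vectors. -/
def vectorFunctional (F : Fin 6 → (Fin 3 → ℕ) → ℂ) : (Fin 6 → Pl 3) →ₗ[ℂ] ℂ :=
  ∑ i, monomialFunctional (F i) ∘ₗ LinearMap.proj i

theorem vectorFunctional_apply (F : Fin 6 → (Fin 3 → ℕ) → ℂ) (g : Fin 6 → Pl 3) :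
    vectorFunctional F g = ∑ i, monomialFunctional (F i) (g i) := by
  simp [vectorFunctional]

theorem vectorFunctional_single (F : Fin 6 → (Fin 3 → ℕ) → ℂ) (i : Fin 6) (μ : Fin 3 →₀ ℕ) :
    vectorFunctional F (Pi.single i (monomial μ 1)) = F i μ := by
  rw [vectorFunctional_apply, Finset.sum_eq_single i]
  · rw [Pi.single_eq_same, monomialFunctional_monomial]
  · intro b _ hb
    rw [Pi.single_eq_of_ne hb, map_zero]
  · simp

theorem vectorFunctional_twoJet (w : Fin 6 → ℂ) (d : Fin 3 → ℕ) (s : Fin 3 → ℂ) (w' : Fin 6 → ℂ)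
    (d' : Fin 3 → ℕ) (s' : Fin 3 → ℂ) (g : Fin 6 → Pl 3) :
    vectorFunctional (twoJet w d s w' d' s') g =
      ∑ i, (w i * monomialFunctional (fun μ => jet d μ s) (g i) -
        w' i * monomialFunctional (fun μ => jet d' μ s') (g i)) := by
  rw [vectorFunctional_apply]
  refine Finset.sum_congr rfl fun i _ => ?_
  have : monomialFunctional (twoJet w d s w' d' s' i) =
      w i • monomialFunctional (fun μ => jet d μ s) -
        w' i • monomialFunctional (fun μ => jet d' μ s') :=
    (basisMonomials (Fin 3) ℂ).ext fun μ => by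
      simp [monomialFunctional_monomial, twoJet]
  rw [this]
  simp

theorem eulerFunctional_gradPullback (L : Matrix (Fin 6) (Fin 8) ℂ) {f : Pl 6}
    (hf : f.IsHomogeneous 5) (j : Fin 3) (s : Fin 3 → ℂ) :
    vectorFunctional (eulerFunctional L j s) (gradPullback L f) = 0 := by
  rw [eulerFunctional, vectorFunctional_twoJet]
  simp only [monomialFunctional_jet_zero, monomialFunctional_jet_unitExp, gradPullback_apply,
    Pi.smul_apply, nsmul_eq_mul, ← eval_cubicForms, ← eval_pderiv_cubicForms]
  have h1 := congrArg (fun p => eval s (pderiv j (aeval (cubicForms L) p))) hf.sum_X_mul_pderiv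
  have h2 := congrArg (eval s) (pderiv_aeval (cubicForms L) j f)
  simp only [map_sum, map_mul, aeval_X, pderiv_mul, map_add, nsmul_eq_mul, map_natCast,
    Derivation.map_natCast, zero_mul, zero_add] at h1 h2
  rw [h2, Finset.sum_add_distrib] at h1
  rw [Finset.sum_sub_distrib]
  have h3 : ∑ i, ((4 : ℕ) : ℂ) * eval s (pderiv j (cubicForms L i)) *
      eval s (aeval (cubicForms L) (pderiv i f)) =
      4 * ∑ i, eval s (pderiv j (cubicForms L i)) *
      eval s (aeval (cubicForms L) (pderiv i f)) := by
    rw [Finset.mul_sum]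
    exact Finset.sum_congr rfl fun _ _ => by push_cast; ring
  rw [h3]
  push_cast at h1
  linear_combination h1

theorem nodeFunctional_gradPullback (L : Matrix (Fin 6) (Fin 8) ℂ) (f : Pl 6) (l : ℕ)
    {u v : Fin 3 → ℂ} (huv : L.mulVec (cubicJet 0 u) = L.mulVec (cubicJet 0 v)) :
    vectorFunctional (nodeFunctional l u v) (gradPullback L f) = 0 := by
  rw [nodeFunctional, vectorFunctional_twoJet]
  simp only [monomialFunctional_jet_zero, gradPullback_apply, eval_aeval_cubicForms, huv, sub_self,
    Finset.sum_const_zero]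

theorem hessianFunctional_gradPullback (L : Matrix (Fin 6) (Fin 8) ℂ) (f : Pl 6) (a b : Fin 3)
    {u v : Fin 3 → ℂ} (huv : L.mulVec (cubicJet 0 u) = L.mulVec (cubicJet 0 v)) :
    vectorFunctional (hessianFunctional L a b u v) (gradPullback L f) = 0 := by
  rw [hessianFunctional, vectorFunctional_twoJet]
  simp only [monomialFunctional_jet_unitExp, gradPullback_apply, pderiv_aeval, map_sum, map_mul,
    eval_aeval_cubicForms, huv, ← eval_pderiv_cubicForms]
  rw [Finset.sum_sub_distrib, sub_eq_zero]
  simp only [Finset.mul_sum]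
  rw [Finset.sum_comm]
  refine Finset.sum_congr rfl fun i _ => Finset.sum_congr rfl fun k _ => ?_
  rw [pderiv_pderiv_comm]
  ring

theorem relationFunctional_gradPullback (L : Matrix (Fin 6) (Fin 8) ℂ) {f : Pl 6}
    (hf : f.IsHomogeneous 5) {u v : Fin 3 → ℂ}
    (huv : L.mulVec (cubicJet 0 u) = L.mulVec (cubicJet 0 v)) (n : ℕ) (hn : n < 182) :
    vectorFunctional (relationFunctional L u v n) (gradPullback L f) = 0 := by
  unfold relationFunctional
  split_ifs
  · exact eulerFunctional_gradPullback L hf ⟨n % 2, by omega⟩ _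
  · exact nodeFunctional_gradPullback L f _ huv
  · exact hessianFunctional_gradPullback L f ⟨(n - 178) / 2, by omega⟩ ⟨n % 2, by omega⟩ huv

/-- Exponents in three variables of degree `3 k`, with the first two entries at most `2 k`. -/
def boundedExps (k : ℕ) : Set (Fin 3 →₀ ℕ) :=
  {μ | μ 0 + μ 1 + μ 2 = 3 * k ∧ μ 0 ≤ 2 * k ∧ μ 1 ≤ 2 * k}

theorem mul_mem_boundedExps {j k : ℕ} {p q : Pl 3} (hp : p ∈ restrictSupport ℂ (boundedExps j))
    (hq : q ∈ restrictSupport ℂ (boundedExps k)) :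
    p * q ∈ restrictSupport ℂ (boundedExps (j + k)) := by
  rw [mem_restrictSupport_iff] at *
  intro μ hμ
  obtain ⟨a, ha, b, hb, rfl⟩ := Finset.mem_add.1 (support_mul p q hμ)
  obtain ⟨h1, h2, h3⟩ := hp ha
  obtain ⟨h4, h5, h6⟩ := hq hb
  refine ⟨?_, ?_, ?_⟩ <;> simp only [Finsupp.add_apply] <;> omega

theorem one_mem_boundedExps : (1 : Pl 3) ∈ restrictSupport ℂ (boundedExps 0) := by
  rw [← C_1, C_apply, monomial_mem_restrictSupport]
  exact Or.inl ⟨rfl, le_rfl, le_rfl⟩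

theorem pow_mem_boundedExps {p : Pl 3} (hp : p ∈ restrictSupport ℂ (boundedExps 1)) (n : ℕ) :
    p ^ n ∈ restrictSupport ℂ (boundedExps n) := by
  induction n with
  | zero => simpa using one_mem_boundedExps
  | succ n ih =>
    rw [pow_succ]
    exact mul_mem_boundedExps ih hp

theorem prod_mem_boundedExps {ι : Type*} (t : Finset ι) (p : ι → Pl 3) (d : ι → ℕ)
    (hp : ∀ i, p i ∈ restrictSupport ℂ (boundedExps (d i))) :
    ∏ i ∈ t, p i ∈ restrictSupport ℂ (boundedExps (∑ i ∈ t, d i)) := by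
  induction t using Finset.induction_on with
  | empty => simpa using one_mem_boundedExps
  | insert i t hi ih =>
    rw [Finset.prod_insert hi, Finset.sum_insert hi]
    exact mul_mem_boundedExps (hp i) ih

theorem cubicForms_mem_boundedExps (L : Matrix (Fin 6) (Fin 8) ℂ) (i : Fin 6) :
    cubicForms L i ∈ restrictSupport ℂ (boundedExps 1) := by
  refine Submodule.sum_mem _ fun k _ => ?_
  rw [C_mul_monomial, monomial_mem_restrictSupport]
  refine Or.inl ?_
  have : cubicExp k 0 + cubicExp k 1 + cubicExp k 2 = 3 * 1 ∧ cubicExp k 0 ≤ 2 * 1 ∧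
    cubicExp k 1 ≤ 2 * 1 := by
    revert k
    decide
  exact this

theorem aeval_cubicForms_mem_boundedExps (L : Matrix (Fin 6) (Fin 8) ℂ) {h : Pl 6} {d : ℕ}
    (hh : h.IsHomogeneous d) :
    aeval (cubicForms L) h ∈ restrictSupport ℂ (boundedExps d) := by
  rw [aeval_def, eval₂_eq']
  refine Submodule.sum_mem _ fun μ hμ => ?_
  have hd : ∑ i, μ i = d := by
    rw [← Finsupp.degree_eq_sum]
    by_contra hne
    exact (mem_support_iff.1 hμ) (hh.coeff_eq_zero hne)
  rw [algebraMap_eq, C_mul']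
  refine Submodule.smul_mem _ _ ?_
  rw [← hd]
  exact prod_mem_boundedExps _ _ _ fun i => pow_mem_boundedExps (cubicForms_mem_boundedExps L i) _

/-- Six-tuples of polynomials supported on `boundedExps 4`. -/
def boundedVectors : Submodule ℂ (Fin 6 → Pl 3) :=
  Submodule.pi Set.univ fun _ => restrictSupport ℂ (boundedExps 4)

theorem mem_boundedVectors {g : Fin 6 → Pl 3} :
    g ∈ boundedVectors ↔ ∀ i, g i ∈ restrictSupport ℂ (boundedExps 4) := by
  simp [boundedVectors]

/-- The coefficients of the elements of `boundedVectors`. -/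
def boundedCoeff : boundedVectors →ₗ[ℂ]
    (Fin 6 × {e : Fin 9 × Fin 9 // e.1.val + e.2.val ≤ 12} → ℂ) :=
  LinearMap.pi (fun t => lcoeff ℂ (Finsupp.equivFunOnFinite.symm
    ![t.2.1.1.val, t.2.1.2.val, 12 - t.2.1.1.val - t.2.1.2.val]) ∘ₗ LinearMap.proj t.1) ∘ₗ
    boundedVectors.subtype

theorem boundedCoeff_injective : Function.Injective boundedCoeff := by
  rw [injective_iff_map_eq_zero]
  intro g hg
  refine Subtype.ext (funext fun i => MvPolynomial.ext _ _ fun μ => ?_)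
  by_cases hμ : μ ∈ boundedExps 4
  · obtain ⟨h1, h2, h3⟩ := hμ
    have := congrFun hg (i, ⟨(⟨μ 0, by omega⟩, ⟨μ 1, by omega⟩), by simp only; omega⟩)
    have hμ' : μ = Finsupp.equivFunOnFinite.symm ![μ 0, μ 1, 12 - μ 0 - μ 1] := by
      ext l
      fin_cases l
      · rfl
      · rfl
      · simp
        omega
    rw [hμ']
    exact this
  · by_contra hne
    exact hμ (mem_boundedVectors.1 g.2 i (mem_support_iff.2 hne))

instance finiteDimensional_boundedVectors : FiniteDimensional ℂ boundedVectors :=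
  Module.Finite.of_injective boundedCoeff boundedCoeff_injective

theorem finrank_boundedVectors_le : Module.finrank ℂ boundedVectors ≤ 426 := by
  have h := LinearMap.finrank_le_finrank_of_injective boundedCoeff_injective
  have hc : Fintype.card {e : Fin 9 × Fin 9 // e.1.val + e.2.val ≤ 12} = 71 := by
    rw [Fintype.card_subtype]
    decide +kernel
  rw [Module.finrank_fintype_fun_eq_card, Fintype.card_prod, hc] at h
  simpa using h

theorem gradPullback_mem_boundedVectors (L : Matrix (Fin 6) (Fin 8) ℂ) {f : Pl 6}
    (hf : f.IsHomogeneous 5) : gradPullback L f ∈ boundedVectors :=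
  mem_boundedVectors.2 fun _ => aeval_cubicForms_mem_boundedExps L hf.pderiv

theorem vectorExps_bounded : ∀ t ∈ vectorExps, t.a + t.b + t.c = 12 ∧ t.a ≤ 8 ∧ t.b ≤ 8 := by
  have : vectorExps.all (fun t => Nat.beq (t.a + t.b + t.c) 12 && (Nat.ble t.a 8 && Nat.ble t.b 8))
      = true := by
    decide +kernel
  intro t ht
  have := List.all_eq_true.1 this t ht
  simpa [Nat.beq_eq, Nat.ble_eq] using this

theorem single_mem_boundedVectors {t : CoordExp}
    (ht : t.a + t.b + t.c = 12 ∧ t.a ≤ 8 ∧ t.b ≤ 8) :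
    (Pi.single t.idx (monomial (Finsupp.equivFunOnFinite.symm t.toFun) 1) : Fin 6 → Pl 3) ∈
      boundedVectors := by
  refine mem_boundedVectors.2 fun i => ?_
  by_cases h : i = t.idx
  · subst h
    rw [Pi.single_eq_same, monomial_mem_restrictSupport]
    exact Or.inl ht
  · rw [Pi.single_eq_of_ne h]
    exact Submodule.zero_mem _

theorem card_le_finrank_of_det_ne_zero {K V ι : Type*} [Field K] [AddCommGroup V] [Module K V]
    [FiniteDimensional K V] [Fintype ι] [DecidableEq ι] (W : Submodule K V) (φ : ι → V →ₗ[K] K)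
    (g : ι → V)
    (hg : ∀ l, g l ∈ W) (h : (Matrix.of fun k l => φ k (g l)).det ≠ 0) :
    Fintype.card ι ≤ Module.finrank K W := by
  have := finrank_add_card_le_of_det_ne_zero (⊥ : Submodule K W) (fun k => φ k ∘ₗ W.subtype)
    (fun k w hw => by rw [(Submodule.mem_bot K).1 hw, map_zero]) (fun l => ⟨g l, hg l⟩) h
  omega

theorem det_quinticPartial_eq_zero_aux (L : Matrix (Fin 6) (Fin 8) ℂ) {u v : Fin 3 → ℂ}
    (huv : L.mulVec (cubicJet 0 u) = L.mulVec (cubicJet 0 v)) (items : List CoordExp)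
    (hitems : ∀ t ∈ items, t.a + t.b + t.c = 12 ∧ t.a ≤ 8 ∧ t.b ≤ 8) (hlen : items.length = 182)
    (M : Matrix (Fin items.length) (Fin items.length) ℂ)
    (hM : ∀ n c, M n c = relationFunctional L u v n items[c].idx items[c].toFun) (h : M.det ≠ 0)
    (f : Fin 245 → homogeneousSubmodule (Fin 6) ℂ 5) (i : Fin 245 → Fin 6)
    (s : Fin 245 → Fin 3 → ℂ) :
    (Matrix.of fun k l => quinticPartial (i k) (L.mulVec (cubicJet 0 (s k))) (f l)).det = 0 := by
  by_contra hne
  let W : Submodule ℂ boundedVectors := ⨅ n : Fin items.length,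
    LinearMap.ker (vectorFunctional (relationFunctional L u v n) ∘ₗ boundedVectors.subtype)
  have hW : ∀ g, g ∈ W ↔ ∀ n : Fin items.length,
      vectorFunctional (relationFunctional L u v n) (g : Fin 6 → Pl 3) = 0 := fun g => by
    simp [W]
  have h1 := finrank_add_card_le_of_det_ne_zero W
    (fun n : Fin items.length => vectorFunctional (relationFunctional L u v n) ∘ₗ
      boundedVectors.subtype) (fun n g hg => (hW g).1 hg n)
    (fun c => ⟨_, single_mem_boundedVectors (hitems items[c] (List.getElem_mem _))⟩)
    (by
      refine fun h' => h (Eq.trans (congrArg Matrix.det (Matrix.ext fun n c => ?_)) h')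
      rw [Matrix.of_apply, hM, LinearMap.comp_apply, Submodule.subtype_apply,
        vectorFunctional_single]
      rfl)
  let g : Fin 245 → boundedVectors := fun l =>
    ⟨gradPullback L (f l), gradPullback_mem_boundedVectors L (f l).2⟩
  let ψ : Fin 245 → boundedVectors →ₗ[ℂ] ℂ := fun k => (aeval (R := ℂ) (s k)).toLinearMap ∘ₗ
    (LinearMap.proj (i k) : (Fin 6 → Pl 3) →ₗ[ℂ] Pl 3) ∘ₗ boundedVectors.subtype
  have hg : ∀ l, g l ∈ W := fun l =>
    (hW _).2 fun n => relationFunctional_gradPullback L (f l).2 huv n (by omega)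
  have hψ : ∀ k l, ψ k (g l) = quinticPartial (i k) (L.mulVec (cubicJet 0 (s k))) (f l) := by
    intro k l
    have h4 : ψ k (g l) = aeval (s k) (gradPullback L (f l) (i k)) := rfl
    rw [h4, quinticPartial_apply, ← eval_aeval_cubicForms, gradPullback_apply, aeval_eq_eval]
  have h2 := card_le_finrank_of_det_ne_zero W ψ g hg (by
    refine fun h' => hne (Eq.trans (congrArg Matrix.det (Matrix.ext fun k l => ?_)) h')
    rw [Matrix.of_apply, Matrix.of_apply, hψ])
  have h3 := finrank_boundedVectors_le
  rw [Fintype.card_fin] at h1 h2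
  omega

/-- If the relations of `relationMatrix` are independent, then the partial derivatives of
quintics on the surface satisfy as many relations. -/
theorem det_quinticPartial_eq_zero (L : Matrix (Fin 6) (Fin 8) ℂ) {u v : Fin 3 → ℂ}
    (huv : L.mulVec (cubicJet 0 u) = L.mulVec (cubicJet 0 v)) (h : (relationMatrix L u v).det ≠ 0)
    (f : Fin 245 → homogeneousSubmodule (Fin 6) ℂ 5) (i : Fin 245 → Fin 6)
    (s : Fin 245 → Fin 3 → ℂ) :
    (Matrix.of fun k l => quinticPartial (i k) (L.mulVec (cubicJet 0 (s k))) (f l)).det = 0 :=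
  det_quinticPartial_eq_zero_aux L huv vectorExps vectorExps_bounded rfl (relationMatrix L u v)
    (fun _ _ => rfl) h f i s

/-- Functions given by a polynomial. -/
def IsPolyFn {ι : Type*} (f : (ι → ℂ) → ℂ) : Prop := ∃ P : MvPolynomial ι ℂ, ∀ v, f v = eval v P

namespace IsPolyFn

variable {ι κ : Type*} {f g : (ι → ℂ) → ℂ}

theorem const (c : ℂ) : IsPolyFn fun _ : ι → ℂ => c := ⟨C c, fun v => by simp⟩

theorem coord (i : ι) : IsPolyFn fun v : ι → ℂ => v i := ⟨X i, fun v => by simp⟩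

theorem add (hf : IsPolyFn f) (hg : IsPolyFn g) : IsPolyFn fun v => f v + g v := by
  obtain ⟨P, hP⟩ := hf
  obtain ⟨Q, hQ⟩ := hg
  exact ⟨P + Q, fun v => by simp [hP, hQ]⟩

theorem mul (hf : IsPolyFn f) (hg : IsPolyFn g) : IsPolyFn fun v => f v * g v := by
  obtain ⟨P, hP⟩ := hf
  obtain ⟨Q, hQ⟩ := hg
  exact ⟨P * Q, fun v => by simp [hP, hQ]⟩

theorem sub (hf : IsPolyFn f) (hg : IsPolyFn g) : IsPolyFn fun v => f v - g v := by
  obtain ⟨P, hP⟩ := hf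
  obtain ⟨Q, hQ⟩ := hg
  exact ⟨P - Q, fun v => by simp [hP, hQ]⟩

theorem sum {t : Finset κ} {f : κ → (ι → ℂ) → ℂ} (hf : ∀ k, IsPolyFn (f k)) :
    IsPolyFn fun v => ∑ k ∈ t, f k v := by
  choose P hP using hf
  exact ⟨∑ k ∈ t, P k, fun v => by simp [hP]⟩

theorem prod {t : Finset κ} {f : κ → (ι → ℂ) → ℂ} (hf : ∀ k, IsPolyFn (f k)) :
    IsPolyFn fun v => ∏ k ∈ t, f k v := by
  choose P hP using hf
  exact ⟨∏ k ∈ t, P k, fun v => by simp [hP]⟩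

theorem pow (hf : IsPolyFn f) (n : ℕ) : IsPolyFn fun v => f v ^ n := by
  obtain ⟨P, hP⟩ := hf
  exact ⟨P ^ n, fun v => by simp [hP]⟩

theorem comp {f : (κ → ℂ) → ℂ} (hf : IsPolyFn f) {w : (ι → ℂ) → κ → ℂ}
    (hw : ∀ k, IsPolyFn fun v => w v k) : IsPolyFn fun v => f (w v) := by
  obtain ⟨P, hP⟩ := hf
  choose Q hQ using hw
  refine ⟨aeval Q P, fun v => ?_⟩
  have : w v = fun k => eval v (Q k) := funext fun k => hQ k v
  beta_reduce
  rw [hP, this, eval_aeval]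

theorem det {n : Type*} [Fintype n] [DecidableEq n] {M : (ι → ℂ) → Matrix n n ℂ}
    (hM : ∀ i j, IsPolyFn fun v => M v i j) : IsPolyFn fun v => (M v).det := by
  simp only [Matrix.det_apply']
  exact sum fun σ => (const _).mul (prod fun i => hM _ _)

theorem mulVec {m n : Type*} [Fintype n] {M : (ι → ℂ) → Matrix m n ℂ} {w : (ι → ℂ) → n → ℂ}
    (hM : ∀ i j, IsPolyFn fun v => M v i j) (hw : ∀ j, IsPolyFn fun v => w v j) (i : m) :
    IsPolyFn fun v => (M v).mulVec (w v) i := by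
  simp only [Matrix.mulVec, dotProduct]
  exact sum fun j => (hM i j).mul (hw j)

theorem matrixMul {l m n : Type*} [Fintype m] {M : (ι → ℂ) → Matrix l m ℂ}
    {N : (ι → ℂ) → Matrix m n ℂ} (hM : ∀ i j, IsPolyFn fun v => M v i j)
    (hN : ∀ i j, IsPolyFn fun v => N v i j) (i : l) (j : n) :
    IsPolyFn fun v => (M v * N v) i j := by
  simp only [Matrix.mul_apply]
  exact sum fun k => (hM i k).mul (hN k j)

theorem eval_const (p : MvPolynomial κ ℂ) {w : (ι → ℂ) → κ → ℂ}
    (hw : ∀ k, IsPolyFn fun v => w v k) : IsPolyFn fun v => eval (w v) p :=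
  comp (f := fun x => eval x p) ⟨p, fun _ => rfl⟩ hw

/-- If a product of polynomial functions vanishes identically, then so does one factor. -/
theorem eq_zero_of_mul (hf : IsPolyFn f) (hg : IsPolyFn g) (h : ∀ v, f v * g v = 0) {a : ι → ℂ}
    (ha : g a ≠ 0) (v : ι → ℂ) : f v = 0 := by
  obtain ⟨P, hP⟩ := hf
  obtain ⟨Q, hQ⟩ := hg
  have h0 : P * Q = 0 := MvPolynomial.funext fun v => by
    rw [map_mul, map_zero, ← hP, ← hQ, h]
  rcases mul_eq_zero.1 h0 with h1 | h1
  · rw [hP, h1, map_zero]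
  · exact absurd (by rw [hQ, h1, map_zero]) ha

theorem jet {n : ℕ} (d μ : Fin n → ℕ) {s : (ι → ℂ) → Fin n → ℂ}
    (hs : ∀ l, IsPolyFn fun v => s v l) : IsPolyFn fun v => jet d μ (s v) :=
  prod fun l => (const _).mul ((hs l).pow _)

theorem cubicJet (d : Fin 3 → ℕ) {s : (ι → ℂ) → Fin 3 → ℂ} (hs : ∀ l, IsPolyFn fun v => s v l)
    (k : Fin 8) : IsPolyFn fun v => cubicJet d (s v) k :=
  IsPolyFn.jet _ _ hs

theorem twoJet {w w' : (ι → ℂ) → Fin 6 → ℂ} {s s' : (ι → ℂ) → Fin 3 → ℂ}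
    (hw : ∀ i, IsPolyFn fun v => w v i) (hs : ∀ l, IsPolyFn fun v => s v l)
    (hw' : ∀ i, IsPolyFn fun v => w' v i) (hs' : ∀ l, IsPolyFn fun v => s' v l)
    (d d' : Fin 3 → ℕ) (i : Fin 6) (μ : Fin 3 → ℕ) :
    IsPolyFn fun v => twoJet (w v) d (s v) (w' v) d' (s' v) i μ :=
  ((hw i).mul (IsPolyFn.jet d μ hs)).sub ((hw' i).mul (IsPolyFn.jet d' μ hs'))

theorem mulVec_cubicJet {L : (ι → ℂ) → Matrix (Fin 6) (Fin 8) ℂ} {x : (ι → ℂ) → Fin 3 → ℂ}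
    (hL : ∀ i j, IsPolyFn fun v => L v i j) (hx : ∀ l, IsPolyFn fun v => x v l) (d : Fin 3 → ℕ)
    (i : Fin 6) : IsPolyFn fun v => (L v).mulVec (CF.cubicJet d (x v)) i :=
  mulVec hL (cubicJet d hx) i

theorem eulerFunctional {L : (ι → ℂ) → Matrix (Fin 6) (Fin 8) ℂ} {x : (ι → ℂ) → Fin 3 → ℂ}
    (hL : ∀ i j, IsPolyFn fun v => L v i j) (hx : ∀ l, IsPolyFn fun v => x v l) (j : ℕ)
    (i : Fin 6) (μ : Fin 3 → ℕ) : IsPolyFn fun v => eulerFunctional (L v) j (x v) i μ := by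
  refine twoJet (w := fun v => (L v).mulVec (CF.cubicJet 0 (x v)))
    (w' := fun v => 4 • (L v).mulVec (CF.cubicJet (unitExp 3 j) (x v)))
    (mulVec_cubicJet hL hx _) hx (fun i => ?_) hx _ _ i μ
  simp only [Pi.smul_apply, nsmul_eq_mul]
  exact (const _).mul (mulVec_cubicJet hL hx _ i)

theorem hessianFunctional {L : (ι → ℂ) → Matrix (Fin 6) (Fin 8) ℂ} {x y : (ι → ℂ) → Fin 3 → ℂ}
    (hL : ∀ i j, IsPolyFn fun v => L v i j) (hx : ∀ l, IsPolyFn fun v => x v l)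
    (hy : ∀ l, IsPolyFn fun v => y v l) (a b : ℕ) (i : Fin 6) (μ : Fin 3 → ℕ) :
    IsPolyFn fun v => hessianFunctional (L v) a b (x v) (y v) i μ :=
  twoJet (w := fun v => (L v).mulVec (CF.cubicJet (unitExp 3 b) (y v)))
    (w' := fun v => (L v).mulVec (CF.cubicJet (unitExp 3 a) (x v)))
    (mulVec_cubicJet hL hy _) hx (mulVec_cubicJet hL hx _) hy _ _ i μ

theorem nodeFunctional {x y : (ι → ℂ) → Fin 3 → ℂ} (hx : ∀ l, IsPolyFn fun v => x v l)
    (hy : ∀ l, IsPolyFn fun v => y v l) (l : ℕ) (i : Fin 6) (μ : Fin 3 → ℕ) :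
    IsPolyFn fun v => nodeFunctional l (x v) (y v) i μ :=
  twoJet (w := fun _ i => (unitExp 6 l i : ℂ)) (w' := fun _ i => (unitExp 6 l i : ℂ))
    (fun _ => const _) hx (fun _ => const _) hy _ _ i μ

theorem relationFunctional {L : (ι → ℂ) → Matrix (Fin 6) (Fin 8) ℂ} {x y : (ι → ℂ) → Fin 3 → ℂ}
    (hL : ∀ i j, IsPolyFn fun v => L v i j) (hx : ∀ l, IsPolyFn fun v => x v l)
    (hy : ∀ l, IsPolyFn fun v => y v l) (n : ℕ) (i : Fin 6) (μ : Fin 3 → ℕ) :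
    IsPolyFn fun v => relationFunctional (L v) (x v) (y v) n i μ := by
  simp only [CF.relationFunctional]
  by_cases h1 : n < 172
  · simp only [if_pos h1]
    exact eulerFunctional hL (x := fun _ => samplePoint ℂ n) (fun _ => const _) _ _ _
  · by_cases h2 : n < 178
    · simp only [if_neg h1, if_pos h2]
      exact nodeFunctional hx hy _ _ _
    · simp only [if_neg h1, if_neg h2]
      exact hessianFunctional hL hx hy _ _ _ _

theorem det_relationMatrix {L : (ι → ℂ) → Matrix (Fin 6) (Fin 8) ℂ} {x y : (ι → ℂ) → Fin 3 → ℂ}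
    (hL : ∀ i j, IsPolyFn fun v => L v i j) (hx : ∀ l, IsPolyFn fun v => x v l)
    (hy : ∀ l, IsPolyFn fun v => y v l) :
    IsPolyFn fun v => (relationMatrix (L v) (x v) (y v)).det :=
  det fun n _ => IsPolyFn.relationFunctional hL hx hy n _ _

theorem det_partialMatrix {L : (ι → ℂ) → Matrix (Fin 6) (Fin 8) ℂ}
    (hL : ∀ i j, IsPolyFn fun v => L v i j) : IsPolyFn fun v => (partialMatrix (L v)).det :=
  det fun _ _ => IsPolyFn.jet _ _ (mulVec hL fun _ => const _)

end IsPolyFn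

/-- The sample projection over the complex numbers. -/
def complexSampleProj : Matrix (Fin 6) (Fin 8) ℂ := sampleProj.map (Int.cast : ℤ → ℂ)

theorem det_intCast_ne_zero {n : Type*} [Fintype n] [DecidableEq n] (p : ℕ) (M : Matrix n n ℤ)
    (h : (M.map (Int.cast : ℤ → ZMod p)).det ≠ 0) : (M.map (Int.cast : ℤ → ℂ)).det ≠ 0 := by
  intro h0
  have h1 : ((M.det : ℤ) : ℂ) = 0 := by
    rw [← h0]
    exact RingHom.map_det (Int.castRingHom ℂ) M
  refine h ?_
  rw [Int.cast_eq_zero] at h1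
  have h2 : (M.map (Int.cast : ℤ → ZMod p)).det = ((M.det : ℤ) : ZMod p) :=
    (RingHom.map_det (Int.castRingHom (ZMod p)) M).symm
  rw [h2, h1, Int.cast_zero]

theorem det_partialMatrix_complexSampleProj : (partialMatrix complexSampleProj).det ≠ 0 := by
  have h1 := map_partialMatrix (Int.castRingHom ℂ) sampleProj
  have h2 := map_partialMatrix (Int.castRingHom (ZMod 4099)) sampleProj
  have h3 := det_intCast_ne_zero 4099 (partialMatrix sampleProj)
    (fun h => det_partialMatrix_sampleProj ((congrArg Matrix.det h2.symm).trans h))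
  exact fun h => h3 ((congrArg Matrix.det h1).trans h)

theorem det_relationMatrix_complexSampleProj :
    (relationMatrix complexSampleProj ![0, 0, 1] ![1, 1, 1]).det ≠ 0 := by
  have h1 := map_relationMatrix (Int.castRingHom ℂ) sampleProj ![0, 0, 1] ![1, 1, 1]
  have h2 := map_relationMatrix (Int.castRingHom (ZMod 4099)) sampleProj ![0, 0, 1] ![1, 1, 1]
  have ha : ∀ {R : Type} [CommRing R] (f : ℤ →+* R), f ∘ ![0, 0, 1] = ![0, 0, 1] := fun f => by
    funext i
    fin_cases i <;> simp
  have hb : ∀ {R : Type} [CommRing R] (f : ℤ →+* R), f ∘ ![1, 1, 1] = ![1, 1, 1] := fun f => by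
    funext i
    fin_cases i <;> simp
  rw [ha, hb] at h1 h2
  have h3 := det_intCast_ne_zero 4099 (relationMatrix sampleProj ![0, 0, 1] ![1, 1, 1])
    (fun h => det_relationMatrix_sampleProj ((congrArg Matrix.det h2.symm).trans h))
  exact fun h => h3 ((congrArg Matrix.det h1).trans h)

/-- The sum of the first seven basis vectors, a difference of two points on the surface. -/
def sampleCenter : Fin 8 → ℂ := ![1, 1, 1, 1, 1, 1, 1, 0]

theorem cubicJet_sub_eq_sampleCenter :
    cubicJet 0 ![1, 1, 1] - cubicJet 0 ![0, 0, 1] = sampleCenter := by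
  funext k
  fin_cases k <;>
    simp [cubicJet, CF.jet, cubicExp, sampleCenter, Fin.prod_univ_succ]

theorem complexSampleProj_mulVec_sampleCenter : complexSampleProj.mulVec sampleCenter = 0 := by
  have h : sampleProj.mulVec ![1, 1, 1, 1, 1, 1, 1, 0] = 0 := by decide
  have hc : sampleCenter = (Int.cast : ℤ → ℂ) ∘ ![1, 1, 1, 1, 1, 1, 1, 0] := by
    funext i
    fin_cases i <;> simp [sampleCenter]
  have h2 := map_mulVec (Int.castRingHom ℂ) sampleProj ![1, 1, 1, 1, 1, 1, 1, 0]
  rw [h] at h2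
  rw [hc]
  refine Eq.trans h2.symm ?_
  funext i
  simp

/-- A multiple of `L` corrected by a multiple of `ξ` so as to kill `z`. -/
def killAlong {m n : ℕ} (ξ : Fin n → ℂ) (L : Matrix (Fin m) (Fin n) ℂ) (z : Fin n → ℂ) :
    Matrix (Fin m) (Fin n) ℂ :=
  Matrix.of fun i k => (∑ j, ξ j * z j) * L i k - L.mulVec z i * ξ k

theorem killAlong_mulVec_self {m n : ℕ} (ξ : Fin n → ℂ) (L : Matrix (Fin m) (Fin n) ℂ)
    (z : Fin n → ℂ) : (killAlong ξ L z).mulVec z = 0 := by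
  funext i
  have : (killAlong ξ L z).mulVec z i =
      (∑ j, ξ j * z j) * L.mulVec z i - L.mulVec z i * ∑ j, ξ j * z j := by
    simp only [killAlong, Matrix.mulVec, dotProduct, Matrix.of_apply, sub_mul,
      Finset.sum_sub_distrib, Finset.mul_sum, mul_assoc]
  rw [this, mul_comm, sub_self, Pi.zero_apply]

theorem killAlong_eq_self {m n : ℕ} {ξ : Fin n → ℂ} {L : Matrix (Fin m) (Fin n) ℂ}
    {z : Fin n → ℂ} (hξ : ∑ j, ξ j * z j = 1) (hL : L.mulVec z = 0) : killAlong ξ L z = L := by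
  ext i k
  simp [killAlong, hξ, hL]

theorem IsPolyFn.killAlong {ι : Type*} {m n : ℕ} {ξ z : (ι → ℂ) → Fin n → ℂ}
    {L : (ι → ℂ) → Matrix (Fin m) (Fin n) ℂ} (hξ : ∀ j, IsPolyFn fun v => ξ v j)
    (hL : ∀ i j, IsPolyFn fun v => L v i j) (hz : ∀ j, IsPolyFn fun v => z v j) (i : Fin m)
    (k : Fin n) : IsPolyFn fun v => killAlong (ξ v) (L v) (z v) i k :=
  ((IsPolyFn.sum fun j => (hξ j).mul (hz j)).mul (hL i k)).sub
    ((IsPolyFn.mulVec hL hz i).mul (hξ k))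

theorem exists_dual_eq_one {n : ℕ} {z : Fin n → ℂ} (hz : z ≠ 0) :
    ∃ ξ : Fin n → ℂ, ∑ j, ξ j * z j = 1 := by
  obtain ⟨i, hi⟩ := Function.ne_iff.1 hz
  refine ⟨Pi.single i (z i)⁻¹, ?_⟩
  rw [Finset.sum_eq_single i (fun j _ hj => by rw [Pi.single_eq_of_ne hj, zero_mul]) (by simp),
    Pi.single_eq_same]
  exact inv_mul_cancel₀ hi

/-- The affine line through two points. -/
def segmentAt {κ : Type*} (a b : κ → ℂ) (t : Unit → ℂ) : κ → ℂ :=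
  fun k => (1 - t ()) * a k + t () * b k

theorem IsPolyFn.segmentAt {κ : Type*} (a b : κ → ℂ) (k : κ) :
    IsPolyFn fun t => segmentAt a b t k :=
  (((const 1).sub (coord ())).mul (const _)).add ((coord ()).mul (const _))

theorem segmentAt_zero {κ : Type*} (a b : κ → ℂ) : segmentAt a b 0 = a := by
  funext k
  simp [segmentAt]

theorem segmentAt_one {κ : Type*} (a b : κ → ℂ) : segmentAt a b 1 = b := by
  funext k
  simp [segmentAt]

/-- The affine line through two matrices. -/
def matrixSegmentAt {m n : Type*} (A B : Matrix m n ℂ) (t : Unit → ℂ) : Matrix m n ℂ :=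
  Matrix.of fun i => segmentAt (A i) (B i) t

theorem matrixSegmentAt_zero {m n : Type*} (A B : Matrix m n ℂ) : matrixSegmentAt A B 0 = A := by
  ext i k
  simp [matrixSegmentAt, segmentAt]

theorem matrixSegmentAt_one {m n : Type*} (A B : Matrix m n ℂ) : matrixSegmentAt A B 1 = B := by
  ext i k
  simp [matrixSegmentAt, segmentAt]

theorem isPolyFn_det_quinticPartial {ι : Type*} {r : ℕ}
    (f : Fin r → homogeneousSubmodule (Fin 6) ℂ 5)
    (i : Fin r → Fin 6) {x : (ι → ℂ) → Fin r → Fin 6 → ℂ}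
    (hx : ∀ k l, IsPolyFn fun v => x v k l) :
    IsPolyFn fun v => (Matrix.of fun k l => quinticPartial (i k) (x v k) (f l)).det := by
  refine IsPolyFn.det fun k l => ?_
  simp only [Matrix.of_apply, quinticPartial_apply]
  exact IsPolyFn.eval_const _ (hx k)

/-- A polynomial condition on projections which holds whenever the relations of
`relationMatrix` are independent holds for every projection killing a secant vector. -/
theorem eq_zero_killAlong_sub (D : Matrix (Fin 6) (Fin 8) ℂ → ℂ)
    (hD : ∀ K : (Unit → ℂ) → Matrix (Fin 6) (Fin 8) ℂ, (∀ k l, IsPolyFn fun t => K t k l) →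
      IsPolyFn fun t => D (K t))
    (h : ∀ K u v, K.mulVec (cubicJet 0 u) = K.mulVec (cubicJet 0 v) →
      (relationMatrix K u v).det ≠ 0 → D K = 0)
    (ξ : Fin 8 → ℂ) (L : Matrix (Fin 6) (Fin 8) ℂ) (u v : Fin 3 → ℂ) :
    D (killAlong ξ L (cubicJet 0 v - cubicJet 0 u)) = 0 := by
  let a : (Unit → ℂ) → Fin 3 → ℂ := segmentAt ![0, 0, 1] u
  let b : (Unit → ℂ) → Fin 3 → ℂ := segmentAt ![1, 1, 1] v
  let z : (Unit → ℂ) → Fin 8 → ℂ := fun t => cubicJet 0 (b t) - cubicJet 0 (a t)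
  let K : (Unit → ℂ) → Matrix (Fin 6) (Fin 8) ℂ := fun t =>
    killAlong (segmentAt (Pi.single 0 1) ξ t) (matrixSegmentAt complexSampleProj L t) (z t)
  have ha : ∀ l, IsPolyFn fun t => a t l := IsPolyFn.segmentAt _ _
  have hb : ∀ l, IsPolyFn fun t => b t l := IsPolyFn.segmentAt _ _
  have hz : ∀ l, IsPolyFn fun t => z t l := fun l =>
    (IsPolyFn.cubicJet 0 hb l).sub (IsPolyFn.cubicJet 0 ha l)
  have hK : ∀ k l, IsPolyFn fun t => K t k l :=
    IsPolyFn.killAlong (IsPolyFn.segmentAt _ _) (fun k => IsPolyFn.segmentAt _ _) hz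
  have hE := IsPolyFn.det_relationMatrix hK ha hb
  have h0 : (relationMatrix (K 0) (a 0) (b 0)).det ≠ 0 := by
    have h1 : z 0 = sampleCenter := by
      simp only [z, a, b, segmentAt_zero, cubicJet_sub_eq_sampleCenter]
    have h2 : K 0 = complexSampleProj := by
      simp only [K, segmentAt_zero, matrixSegmentAt_zero, h1]
      refine killAlong_eq_self ?_ complexSampleProj_mulVec_sampleCenter
      simp [Fin.sum_univ_succ, sampleCenter]
    simp only [h2, a, b, segmentAt_zero]
    exact det_relationMatrix_complexSampleProj
  have h1 : D (K 1) = 0 := by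
    refine (hD K hK).eq_zero_of_mul hE (fun t => ?_) h0 1
    by_cases ht : (relationMatrix (K t) (a t) (b t)).det = 0
    · rw [ht, mul_zero]
    · refine mul_eq_zero_of_left (h (K t) (a t) (b t) ?_ ht) _
      have h3 : (K t).mulVec (z t) = 0 := killAlong_mulVec_self _ _ _
      rw [Matrix.mulVec_sub, sub_eq_zero] at h3
      exact h3.symm
  simpa only [K, z, a, b, segmentAt_one, matrixSegmentAt_one] using h1

theorem cubicJet_zero_smul (c : ℂ) (s : Fin 3 → ℂ) :
    cubicJet 0 (c • s) = c ^ 3 • cubicJet 0 s := by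
  funext k
  fin_cases k <;> simp [cubicJet, jet, cubicExp, Fin.prod_univ_succ] <;> ring

theorem exists_cubicJet_eq_smul (c : ℂ) (s : Fin 3 → ℂ) :
    ∃ t : Fin 3 → ℂ, cubicJet 0 t = c • cubicJet 0 s := by
  obtain ⟨d, hd⟩ := IsAlgClosed.exists_pow_nat_eq c (n := 3) (by norm_num)
  exact ⟨d • s, by rw [cubicJet_zero_smul, hd]⟩

/-- A polynomial condition on projections which holds whenever the relations of
`relationMatrix` are independent holds for every projection killing a vector in the cone over the
secant variety. -/
theorem eq_zero_of_mulVec_eq_zero (D : Matrix (Fin 6) (Fin 8) ℂ → ℂ)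
    (hD : ∀ {ι : Type} (K : (ι → ℂ) → Matrix (Fin 6) (Fin 8) ℂ),
      (∀ k l, IsPolyFn fun t => K t k l) → IsPolyFn fun t => D (K t))
    (h : ∀ K u v, K.mulVec (cubicJet 0 u) = K.mulVec (cubicJet 0 v) →
      (relationMatrix K u v).det ≠ 0 → D K = 0)
    (L : Matrix (Fin 6) (Fin 8) ℂ) {z : Fin 8 → ℂ} (hz : z ≠ 0) (hL : L.mulVec z = 0)
    (hsec : ∀ p : (Fin 8 → ℂ) → ℂ, IsPolyFn p →
      (∀ (α β : ℂ) (u v : Fin 3 → ℂ), p (α • cubicJet 0 u + β • cubicJet 0 v) = 0) → p z = 0) :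
    D L = 0 := by
  obtain ⟨ξ, hξ⟩ := exists_dual_eq_one hz
  have hK : ∀ k l, IsPolyFn fun w : Fin 8 → ℂ => killAlong ξ L w k l :=
    IsPolyFn.killAlong (fun _ => IsPolyFn.const _) (fun _ _ => IsPolyFn.const _)
      fun l => IsPolyFn.coord l
  rw [← killAlong_eq_self hξ hL]
  refine hsec _ (hD _ hK) fun α β u v => ?_
  obtain ⟨u', hu⟩ := exists_cubicJet_eq_smul (-α) u
  obtain ⟨v', hv⟩ := exists_cubicJet_eq_smul β v
  have : α • cubicJet 0 u + β • cubicJet 0 v = cubicJet 0 v' - cubicJet 0 u' := by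
    rw [hu, hv, neg_smul, sub_neg_eq_add, add_comm]
  rw [this]
  exact eq_zero_killAlong_sub D hD h ξ L u' v'

theorem exists_det_quinticPartial_ne_zero (L : Matrix (Fin 6) (Fin 8) ℂ) (r : ℕ)
    (h : Module.finrank ℂ (doubleQuintics L) + r ≤ 252) :
    ∃ (f : Fin r → homogeneousSubmodule (Fin 6) ℂ 5) (i : Fin r → Fin 6)
      (s : Fin r → Fin 3 → ℂ), (Matrix.of fun k l =>
        quinticPartial (i k) (L.mulVec (cubicJet 0 (s k))) (f l)).det ≠ 0 := by
  have hc : Module.finrank ℂ (homogeneousSubmodule (Fin 6) ℂ 5) = 252 := by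
    rw [finrank_homogeneousSubmodule]
    decide
  obtain ⟨i, f, h⟩ := exists_det_ne_zero_of_finrank_add_le (doubleQuintics L)
    (fun t : Fin 6 × (Fin 3 → ℂ) => quinticPartial t.1 (L.mulVec (cubicJet 0 t.2)))
    (fun f hf => mem_doubleQuintics.2 fun s i => by
      rw [← quinticPartial_apply]
      exact hf (i, s)) r (by rwa [hc])
  exact ⟨f, fun k => (i k).1, fun k => (i k).2, h⟩

theorem lt_finrank_doubleQuintics_add (r : ℕ)
    (h : ∀ (K : Matrix (Fin 6) (Fin 8) ℂ) (u v : Fin 3 → ℂ),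
      K.mulVec (cubicJet 0 u) = K.mulVec (cubicJet 0 v) → (relationMatrix K u v).det ≠ 0 →
      ∀ (f : Fin r → homogeneousSubmodule (Fin 6) ℂ 5) (i : Fin r → Fin 6)
        (s : Fin r → Fin 3 → ℂ), (Matrix.of fun k l =>
          quinticPartial (i k) (K.mulVec (cubicJet 0 (s k))) (f l)).det = 0)
    (L : Matrix (Fin 6) (Fin 8) ℂ) {z : Fin 8 → ℂ} (hz : z ≠ 0) (hL : L.mulVec z = 0)
    (hsec : ∀ p : (Fin 8 → ℂ) → ℂ, IsPolyFn p →
      (∀ (α β : ℂ) (u v : Fin 3 → ℂ), p (α • cubicJet 0 u + β • cubicJet 0 v) = 0) → p z = 0) :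
    252 < Module.finrank ℂ (doubleQuintics L) + r := by
  by_contra hlt
  obtain ⟨f, i, s, hdet⟩ := exists_det_quinticPartial_ne_zero L r (not_lt.1 hlt)
  let D : Matrix (Fin 6) (Fin 8) ℂ → ℂ := fun K => (Matrix.of fun k l =>
    quinticPartial (i k) (K.mulVec (cubicJet 0 (s k))) (f l)).det
  have hD : ∀ {ι : Type} (K : (ι → ℂ) → Matrix (Fin 6) (Fin 8) ℂ),
      (∀ k l, IsPolyFn fun t => K t k l) → IsPolyFn fun t => D (K t) := by
    intro ι K hK
    have hx : ∀ k l, IsPolyFn fun t => (K t).mulVec (cubicJet 0 (s k)) l := fun k l =>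
      IsPolyFn.mulVec_cubicJet (x := fun _ => s k) hK (fun _ => IsPolyFn.const _) 0 l
    exact isPolyFn_det_quinticPartial f i (x := fun v k => (K v).mulVec (cubicJet 0 (s k))) hx
  exact hdet (eq_zero_of_mulVec_eq_zero D hD
    (fun K u v huv hK => h K u v huv hK f i s) L hz hL hsec)

/-- A projection killing a vector in the cone over the secant variety leaves at least eight
quintics. -/
theorem le_finrank_doubleQuintics (L : Matrix (Fin 6) (Fin 8) ℂ) {z : Fin 8 → ℂ} (hz : z ≠ 0)
    (hL : L.mulVec z = 0)
    (hsec : ∀ p : (Fin 8 → ℂ) → ℂ, IsPolyFn p →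
      (∀ (α β : ℂ) (u v : Fin 3 → ℂ), p (α • cubicJet 0 u + β • cubicJet 0 v) = 0) → p z = 0) :
    8 ≤ Module.finrank ℂ (doubleQuintics L) := by
  have := lt_finrank_doubleQuintics_add 245
    (fun K u v huv hK f i s => det_quinticPartial_eq_zero K huv hK f i s) L hz hL hsec
  omega

/-- A polynomial in the entries of `L`, nonvanishing when `L` has maximal rank and leaves at most
eight quintics. -/
def genericity (L : Matrix (Fin 6) (Fin 8) ℂ) : ℂ :=
  (partialMatrix L).det * (L.submatrix id ![0, 1, 2, 4, 5, 7]).det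

theorem IsPolyFn.genericity {ι : Type*} {L : (ι → ℂ) → Matrix (Fin 6) (Fin 8) ℂ}
    (hL : ∀ i j, IsPolyFn fun v => L v i j) : IsPolyFn fun v => genericity (L v) :=
  (det_partialMatrix hL).mul (det fun _ _ => hL _ _)

theorem genericity_complexSampleProj_ne_zero : genericity complexSampleProj ≠ 0 := by
  refine mul_ne_zero det_partialMatrix_complexSampleProj ?_
  have h1 : (sampleProj.submatrix id ![0, 1, 2, 4, 5, 7]).det = 1 := by
    have h : ∀ i j : Fin 6, j < i → sampleProj.submatrix id ![0, 1, 2, 4, 5, 7] i j = 0 := by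
      intro i j hij
      fin_cases i <;> fin_cases j <;> first | rfl | exact absurd hij (by decide)
    rw [Matrix.det_of_isUpperTriangular fun i j hij => h i j hij]
    decide
  have h2 : (complexSampleProj.submatrix id ![0, 1, 2, 4, 5, 7]).det =
      (((sampleProj.submatrix id ![0, 1, 2, 4, 5, 7]).det : ℤ) : ℂ) :=
    (RingHom.map_det (Int.castRingHom ℂ) (sampleProj.submatrix id ![0, 1, 2, 4, 5, 7])).symm
  rw [h2, h1]
  simp

/-- The linear change of coordinates with matrix `T`. -/
def linearSubst (T : Matrix (Fin 6) (Fin 6) ℂ) (i : Fin 6) : Pl 6 := ∑ j, C (T i j) * X j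

theorem isHomogeneous_linearSubst (T : Matrix (Fin 6) (Fin 6) ℂ) (i : Fin 6) :
    (linearSubst T i).IsHomogeneous 1 :=
  IsHomogeneous.sum _ _ _ fun j _ => by simpa using (isHomogeneous_C_mul_X (T i j) j)

theorem eval_linearSubst (T : Matrix (Fin 6) (Fin 6) ℂ) (x : Fin 6 → ℂ) :
    (fun i => eval x (linearSubst T i)) = T.mulVec x := by
  funext i
  simp [linearSubst, Matrix.mulVec, dotProduct]

/-- The change of coordinates with matrix `T` on quintic forms. -/
def quinticSubst (T : Matrix (Fin 6) (Fin 6) ℂ) :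
    homogeneousSubmodule (Fin 6) ℂ 5 →ₗ[ℂ] homogeneousSubmodule (Fin 6) ℂ 5 :=
  (aeval (linearSubst T)).toLinearMap.restrict fun f hf => by
    have := IsHomogeneous.aeval (φ := f) (m := 5) hf (linearSubst T)
      (isHomogeneous_linearSubst T)
    simpa using this

theorem finrank_doubleQuintics_le_of_genericity (M : Matrix (Fin 6) (Fin 6) ℂ)
    (A : Matrix (Fin 6) (Fin 8) ℂ) (h : genericity (M * A) ≠ 0) :
    Module.finrank ℂ (doubleQuintics A) ≤ 8 := by
  have hM : IsUnit M.det := by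
    refine isUnit_iff_ne_zero.2 fun h0 => (mul_ne_zero_iff.1 h).2 ?_
    have : (M * A).submatrix id ![0, 1, 2, 4, 5, 7] = M * A.submatrix id ![0, 1, 2, 4, 5, 7] := rfl
    rw [this, Matrix.det_mul, h0, zero_mul]
  refine le_trans ?_ (finrank_doubleQuintics_le (M * A) (mul_ne_zero_iff.1 h).1)
  have hinv : ∀ x : Fin 6 → ℂ, M⁻¹.mulVec (M.mulVec x) = x := fun x => by
    rw [Matrix.mulVec_mulVec, Matrix.nonsing_inv_mul _ hM, Matrix.one_mulVec]
  have hval : ∀ (f : homogeneousSubmodule (Fin 6) ℂ 5),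
      ((quinticSubst M⁻¹ f : homogeneousSubmodule (Fin 6) ℂ 5) : Pl 6) =
        aeval (linearSubst M⁻¹) (f : Pl 6) := fun f => rfl
  have hmem : ∀ f ∈ doubleQuintics A, quinticSubst M⁻¹ f ∈ doubleQuintics (M * A) := by
    intro f hf
    refine mem_doubleQuintics.2 fun s i => ?_
    rw [hval, pderiv_aeval, map_sum]
    refine Finset.sum_eq_zero fun k _ => ?_
    rw [map_mul, eval_aeval, eval_linearSubst, ← Matrix.mulVec_mulVec, hinv,
      mem_doubleQuintics.1 hf, mul_zero]
  have hinj : Function.Injective (quinticSubst M⁻¹) := by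
    refine (injective_iff_map_eq_zero _).2 fun f hf => Subtype.ext (MvPolynomial.funext fun x => ?_)
    have h1 : eval (M.mulVec x) (aeval (linearSubst M⁻¹) (f : Pl 6)) = 0 := by
      rw [← hval, hf]
      simp
    rw [eval_aeval, eval_linearSubst, hinv] at h1
    simpa using h1
  exact LinearMap.finrank_le_finrank_of_injective (f := (quinticSubst M⁻¹).restrict hmem)
    fun f g hfg => Subtype.ext (hinj (congrArg Subtype.val hfg))

theorem exists_comp_eq {m n k : ℕ} (L : (Fin n → ℂ) →ₗ[ℂ] (Fin m → ℂ))
    (hL : Function.Surjective L) {z : Fin n → ℂ} (hz : LinearMap.ker L = Submodule.span ℂ {z})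
    (K : Matrix (Fin k) (Fin n) ℂ) (hK : K.mulVec z = 0) :
    ∃ N : Matrix (Fin k) (Fin m) ℂ, K = N * LinearMap.toMatrix' L := by
  obtain ⟨R, hR⟩ := L.exists_rightInverse_of_surjective (LinearMap.range_eq_top.2 hL)
  refine ⟨LinearMap.toMatrix' (Matrix.toLin' K ∘ₗ R), ?_⟩
  rw [← LinearMap.toMatrix'_comp, ← LinearMap.toMatrix'_toLin' K]
  refine congrArg _ (LinearMap.ext fun x => ?_)
  have h1 : x - R (L x) ∈ Submodule.span ℂ {z} := by
    rw [← hz, LinearMap.mem_ker, map_sub, sub_eq_zero]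
    exact (LinearMap.congr_fun hR (L x)).symm
  obtain ⟨c, hc⟩ := Submodule.mem_span_singleton.1 h1
  have h2 : K.mulVec (x - R (L x)) = 0 := by
    rw [← hc, Matrix.mulVec_smul, hK, smul_zero]
  rw [Matrix.mulVec_sub, sub_eq_zero] at h2
  simpa using h2

/-- A polynomial condition on the first projection center. -/
def firstCondition (B : Matrix (Fin 8) (Fin 8) ℂ) (z : Fin 8 → ℂ) : ℂ :=
  genericity (killAlong (Pi.single 0 1) complexSampleProj (B⁻¹.mulVec z))

theorem isPolyFn_firstCondition (B : Matrix (Fin 8) (Fin 8) ℂ) : IsPolyFn (firstCondition B) :=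
  IsPolyFn.genericity (IsPolyFn.killAlong (fun _ => IsPolyFn.const _) (fun _ _ => IsPolyFn.const _)
    (IsPolyFn.mulVec (fun _ _ => IsPolyFn.const _) fun j => IsPolyFn.coord j))

theorem firstCondition_ne_zero {B : Matrix (Fin 8) (Fin 8) ℂ} (hB : IsUnit B.det) :
    firstCondition B (B.mulVec sampleCenter) ≠ 0 := by
  rw [firstCondition, Matrix.mulVec_mulVec, Matrix.nonsing_inv_mul _ hB, Matrix.one_mulVec,
    killAlong_eq_self _ complexSampleProj_mulVec_sampleCenter]
  · exact genericity_complexSampleProj_ne_zero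
  · simp [Fin.sum_univ_succ, sampleCenter]

/-- For a general first projection there is a polynomial condition on the second projection
center that bounds the number of quintics. -/
theorem exists_secondCondition {B : Matrix (Fin 8) (Fin 8) ℂ} (hB : IsUnit B.det)
    {z : Fin 8 → ℂ} (hz : firstCondition B z ≠ 0) (L₁ : (Fin 8 → ℂ) →ₗ[ℂ] (Fin 7 → ℂ))
    (hL₁ : Function.Surjective L₁) (hker : LinearMap.ker L₁ = Submodule.span ℂ {z}) :
    ∃ p : (Fin 7 → ℂ) → ℂ, IsPolyFn p ∧ (∃ y, y ≠ 0 ∧ p y ≠ 0) ∧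
      ∀ y, p y ≠ 0 → ∀ L₂ : (Fin 7 → ℂ) →ₗ[ℂ] (Fin 6 → ℂ), Function.Surjective L₂ →
        LinearMap.ker L₂ = Submodule.span ℂ {y} →
        Module.finrank ℂ (doubleQuintics
          (LinearMap.toMatrix' L₂ * (LinearMap.toMatrix' L₁ * B))) ≤ 8 := by
  set K : Matrix (Fin 6) (Fin 8) ℂ :=
    killAlong (Pi.single 0 1) complexSampleProj (B⁻¹.mulVec z) with hK
  obtain ⟨N, hN⟩ := exists_comp_eq L₁ hL₁ hker (K * B⁻¹) (by
    rw [← Matrix.mulVec_mulVec]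
    exact killAlong_mulVec_self _ _ _)
  have hKN : K = N * (LinearMap.toMatrix' L₁ * B) := by
    rw [← Matrix.mul_assoc, ← hN, Matrix.mul_assoc, Matrix.nonsing_inv_mul _ hB, Matrix.mul_one]
  obtain ⟨y₀, hy₀, hNy⟩ : ∃ y₀ : Fin 7 → ℂ, y₀ ≠ 0 ∧ N.mulVec y₀ = 0 := by
    have h1 : LinearMap.ker N.mulVecLin ≠ ⊥ := fun h => by
      have := LinearMap.finrank_le_finrank_of_injective (LinearMap.ker_eq_bot.1 h)
      simp at this
    obtain ⟨y, hy, hy0⟩ := Submodule.exists_mem_ne_zero_of_ne_bot h1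
    exact ⟨y, hy0, by simpa using hy⟩
  obtain ⟨ξ, hξ⟩ := exists_dual_eq_one hy₀
  refine ⟨fun y => genericity (killAlong ξ N y * (LinearMap.toMatrix' L₁ * B)),
    IsPolyFn.genericity (IsPolyFn.matrixMul (IsPolyFn.killAlong (fun _ => IsPolyFn.const _)
      (fun _ _ => IsPolyFn.const _) fun j => IsPolyFn.coord j) fun _ _ => IsPolyFn.const _),
    ⟨y₀, hy₀, ?_⟩, fun y hy L₂ hL₂ hker₂ => ?_⟩
  · beta_reduce
    rw [killAlong_eq_self hξ hNy, ← hKN]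
    exact hz
  · obtain ⟨M, hM⟩ := exists_comp_eq L₂ hL₂ hker₂ (killAlong ξ N y) (killAlong_mulVec_self _ _ _)
    refine finrank_doubleQuintics_le_of_genericity M _ ?_
    rwa [← Matrix.mul_assoc, ← hM]

theorem mem_cone_singleton {n : ℕ} {x : Pr n} {v : Fin (n + 1) → ℂ} :
    v ∈ cone ({x} : Set (Pr n)) ↔ ∃ h : v ≠ 0, Projectivization.mk ℂ v h = x :=
  Iff.rfl

theorem cone_mono {n : ℕ} {A B : Set (Pr n)} (h : A ⊆ B) : cone A ⊆ cone B :=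
  fun _ hv => ⟨hv.1, h hv.2⟩

theorem smul_mem_cone {n : ℕ} {Z : Set (Pr n)} {v : Fin (n + 1) → ℂ} (hv : v ∈ cone Z) {c : ℂ}
    (hc : c ≠ 0) : c • v ∈ cone Z := by
  refine ⟨smul_ne_zero hc hv.1, ?_⟩
  have : Projectivization.mk ℂ (c • v) (smul_ne_zero hc hv.1) = Projectivization.mk ℂ v hv.1 :=
    (Projectivization.mk_eq_mk_iff' ℂ _ _ _ _).2 ⟨c, rfl⟩
  rw [this]
  exact hv.2

theorem span_rep_eq {n : ℕ} {x : Pr n} {v : Fin (n + 1) → ℂ} (hv : v ∈ cone ({x} : Set (Pr n))) :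
    Submodule.span ℂ {x.rep} = Submodule.span ℂ {v} := by
  obtain ⟨h, rfl⟩ := mem_cone_singleton.1 hv
  obtain ⟨a, ha⟩ := Projectivization.exists_smul_eq_mk_rep ℂ v h
  rw [← ha]
  exact Submodule.span_singleton_group_smul_eq ℂ a v

theorem eval_smul_of_isHomogeneous {ι : Type*} {p : MvPolynomial ι ℂ} {d : ℕ}
    (hp : p.IsHomogeneous d) (c : ℂ) (v : ι → ℂ) : eval (c • v) p = c ^ d * eval v p := by
  rw [eval_eq, eval_eq, Finset.mul_sum]
  refine Finset.sum_congr rfl fun m hm => ?_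
  have hd := hp (mem_support_iff.1 hm)
  simp only [Pi.smul_apply, smul_eq_mul, mul_pow, Finset.prod_mul_distrib,
    Finset.prod_pow_eq_pow_sum]
  have : ∑ i ∈ m.support, m i = d := by
    rw [← hd]
    simp [Finsupp.weight_apply, Finsupp.sum]
  rw [this]
  ring

theorem eval_homogeneousComponent_eq_zero {ι : Type*} {p : MvPolynomial ι ℂ} {v : ι → ℂ}
    (h : ∀ c : ℂ, c ≠ 0 → eval (c • v) p = 0) (d : ℕ) : eval v (homogeneousComponent d p) = 0 := by
  set Q : Polynomial ℂ := ∑ i ∈ Finset.range (p.totalDegree + 1),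
    Polynomial.C (eval v (homogeneousComponent i p)) * Polynomial.X ^ i with hQ
  have hev : ∀ c, Q.eval c = eval (c • v) p := by
    intro c
    conv_rhs => rw [← sum_homogeneousComponent p]
    rw [hQ, Polynomial.eval_finsetSum, map_sum]
    refine Finset.sum_congr rfl fun i _ => ?_
    rw [eval_smul_of_isHomogeneous (homogeneousComponent_isHomogeneous i p)]
    rw [Polynomial.eval_mul, Polynomial.eval_C, Polynomial.eval_pow, Polynomial.eval_X, mul_comm]
  have h0 : Q = 0 := by
    refine Polynomial.eq_zero_of_infinite_isRoot Q ?_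
    refine Set.Infinite.mono (s := {0}ᶜ) (fun c hc => ?_) (Set.finite_singleton 0).infinite_compl
    exact (hev c).trans (h c hc)
  by_cases hd : p.totalDegree < d
  · rw [homogeneousComponent_eq_zero _ _ hd, map_zero]
  · have h1 : Q.coeff d = eval v (homogeneousComponent d p) := by
      rw [hQ, Polynomial.finsetSum_coeff]
      simp only [Polynomial.coeff_C_mul_X_pow]
      rw [Finset.sum_eq_single d]
      · simp
      · intro i _ hi
        rw [if_neg hi.symm]
      · intro h2
        exact absurd (Finset.mem_range.2 (by omega)) h2
    rw [← h1, h0, Polynomial.coeff_zero]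

/-- The points all of whose representatives are zeros of the given polynomial. -/
def vanishingSet {n : ℕ} (p : Pl (n + 1)) : Set (Pr n) :=
  zeroSet (Set.range fun d => homogeneousComponent d p)

theorem isAlg_vanishingSet {n : ℕ} (p : Pl (n + 1)) : IsAlg (vanishingSet p) := by
  refine ⟨_, ?_, rfl⟩
  rintro _ ⟨d, rfl⟩
  exact ⟨d, homogeneousComponent_isHomogeneous d p⟩

theorem mem_vanishingSet {n : ℕ} {p : Pl (n + 1)} {x : Pr n} :
    x ∈ vanishingSet p ↔ ∀ v ∈ cone ({x} : Set (Pr n)), eval v p = 0 := by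
  constructor
  · intro hx v hv
    rw [← sum_homogeneousComponent p, map_sum]
    exact Finset.sum_eq_zero fun d _ => hx _ ⟨d, rfl⟩ v hv
  · rintro hx _ ⟨d, rfl⟩ v hv
    exact eval_homogeneousComponent_eq_zero (fun c hc => hx _ (smul_mem_cone hv hc)) d

theorem subset_algClosure {n : ℕ} (A : Set (Pr n)) : A ⊆ algClosure A :=
  fun _ hx _ hZ => hZ.2 hx

theorem eval_eq_zero_of_mem_cone_algClosure {n : ℕ} {A : Set (Pr n)} {p : Pl (n + 1)}
    (h : ∀ v ∈ cone A, eval v p = 0) {v : Fin (n + 1) → ℂ} (hv : v ∈ cone (algClosure A)) :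
    eval v p = 0 := by
  refine mem_vanishingSet.1 (hv.2 (vanishingSet p) ⟨isAlg_vanishingSet p, ?_⟩) v ⟨hv.1, rfl⟩
  intro x hx
  exact mem_vanishingSet.2 fun w hw => h w (cone_mono (Set.singleton_subset_iff.2 hx) hw)

/-- A polynomial condition that holds at some point of a cone defines a generic property. -/
theorem generically_of_isPolyFn {n : ℕ} {X : Set (Pr n)} {Q : Pr n → Prop}
    {p : (Fin (n + 1) → ℂ) → ℂ} (hp : IsPolyFn p) {w : Fin (n + 1) → ℂ} (hw : w ∈ cone X)
    (hpw : p w ≠ 0)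
    (h : ∀ x ∈ X, ∀ v ∈ cone ({x} : Set (Pr n)), p v ≠ 0 → Q x) : Generically X Q := by
  obtain ⟨P, hP⟩ := hp
  refine ⟨vanishingSet P, isAlg_vanishingSet P, fun hX => ?_, ?_⟩
  · exact hpw ((hP w).trans (mem_vanishingSet.1 (hX hw.2) w ⟨hw.1, rfl⟩))
  · rintro x ⟨hx, hxZ⟩
    rw [mem_vanishingSet] at hxZ
    push Not at hxZ
    obtain ⟨v, hv, hv0⟩ := hxZ
    exact h x hx v hv (by rwa [hP])

theorem eval_eq_zero_of_mem_cone_projIm {N n : ℕ} {L : (Fin (N + 1) → ℂ) →ₗ[ℂ] (Fin (n + 1) → ℂ)}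
    {Z : Set (Pr N)} {q : Pl (n + 1)} (h : ∀ v ∈ cone Z, eval (L v) q = 0)
    {w : Fin (n + 1) → ℂ} (hw : w ∈ cone (projIm L Z)) : eval w q = 0 := by
  refine eval_eq_zero_of_mem_cone_algClosure (fun y hy => ?_) hw
  obtain ⟨hy0, v, hv, hLv, hyv⟩ := hy
  obtain ⟨a, rfl⟩ := (Projectivization.mk_eq_mk_iff' ℂ _ _ _ _).1 hyv
  have ha : a ≠ 0 := fun h0 => hy0 (by rw [h0, zero_smul])
  rw [← map_smul]
  exact h _ (smul_mem_cone hv ha)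

theorem apply_mem_cone_projIm {N n : ℕ} {L : (Fin (N + 1) → ℂ) →ₗ[ℂ] (Fin (n + 1) → ℂ)}
    {Z : Set (Pr N)} {v : Fin (N + 1) → ℂ} (hv : v ∈ cone Z) (hLv : L v ≠ 0) :
    L v ∈ cone (projIm L Z) :=
  ⟨hLv, subset_algClosure _ ⟨v, hv, hLv, rfl⟩⟩

theorem mem_cone_imClos {m n : ℕ} {b : Fin (n + 1) → Pl m} {s : Fin m → ℂ}
    (h : (fun i => eval s (b i)) ≠ 0) : (fun i => eval s (b i)) ∈ cone (imClos b) :=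
  ⟨h, subset_algClosure _ ⟨s, h, rfl⟩⟩

theorem eval_eq_zero_of_mem_cone_imClos {m n d : ℕ} (hd : d ≠ 0) {b : Fin (n + 1) → Pl m}
    (hb : ∀ i, (b i).IsHomogeneous d) {q : Pl (n + 1)}
    (h : ∀ s, eval (fun i => eval s (b i)) q = 0) {w : Fin (n + 1) → ℂ}
    (hw : w ∈ cone (imClos b)) : eval w q = 0 := by
  refine eval_eq_zero_of_mem_cone_algClosure (fun y hy => ?_) hw
  obtain ⟨hy0, s, hs, hys⟩ := hy
  obtain ⟨a, rfl⟩ := (Projectivization.mk_eq_mk_iff' ℂ _ _ _ _).1 hys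
  obtain ⟨c, rfl⟩ := IsAlgClosed.exists_pow_nat_eq a (Nat.pos_of_ne_zero hd)
  rw [← h (c • s)]
  congr 2
  funext i
  rw [eval_smul_of_isHomogeneous (hb i)]
  rfl

theorem eq_zero_of_mem_cone_secantVariety {n : ℕ} {Z : Set (Pr n)} {p : (Fin (n + 1) → ℂ) → ℂ}
    (hp : IsPolyFn p) (h : ∀ (α β : ℂ), ∀ u ∈ cone Z, ∀ v ∈ cone Z, p (α • u + β • v) = 0)
    {w : Fin (n + 1) → ℂ} (hw : w ∈ cone (secantVariety Z)) : p w = 0 := by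
  obtain ⟨P, hP⟩ := hp
  rw [hP]
  refine eval_eq_zero_of_mem_cone_algClosure (fun y hy => ?_) hw
  obtain ⟨hy0, u, v, hu, hv, hyr⟩ := hy
  have hy1 : y ∈ Submodule.span ℂ {u, v} := by
    refine Submodule.span_le.2 (Set.singleton_subset_iff.2 hyr) ?_
    rw [span_rep_eq ⟨hy0, rfl⟩]
    exact Submodule.mem_span_singleton_self y
  obtain ⟨α, β, rfl⟩ := Submodule.mem_span_pair.1 hy1
  rw [← hP]
  exact h α β u hu v hv

/-- A polynomial function vanishing on all lines spanned by two points of a parametrized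
variety vanishes on its secant variety. -/
theorem eq_zero_of_mem_cone_secantVariety_imClos {m n d : ℕ} (hd : d ≠ 0)
    {b : Fin (n + 1) → Pl m} (hb : ∀ i, (b i).IsHomogeneous d) {p : (Fin (n + 1) → ℂ) → ℂ}
    (hp : IsPolyFn p)
    (h : ∀ (α β : ℂ) (s t : Fin m → ℂ),
      p (α • (fun i => eval s (b i)) + β • fun i => eval t (b i)) = 0)
    {w : Fin (n + 1) → ℂ} (hw : w ∈ cone (secantVariety (imClos b))) : p w = 0 := by
  refine eq_zero_of_mem_cone_secantVariety hp (fun α β u hu v hv => ?_) hw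
  have key : ∀ a : Fin (n + 1) → ℂ, ∀ γ : ℂ, ∃ Q : Pl (n + 1), ∀ x, p (γ • x + a) = eval x Q :=
    fun a γ => IsPolyFn.comp hp (w := fun x => γ • x + a) fun k => by
      simp only [Pi.add_apply, Pi.smul_apply, smul_eq_mul]
      exact ((IsPolyFn.const γ).mul (IsPolyFn.coord k)).add (IsPolyFn.const (a k))
  have h1 : ∀ s, ∀ v ∈ cone (imClos b), p (α • (fun i => eval s (b i)) + β • v) = 0 := by
    intro s v hv
    obtain ⟨Q, hQ⟩ := key (α • fun i => eval s (b i)) β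
    rw [add_comm, hQ]
    refine eval_eq_zero_of_mem_cone_imClos hd hb (fun t => ?_) hv
    rw [← hQ, add_comm]
    exact h α β s t
  obtain ⟨Q, hQ⟩ := key (β • v) α
  rw [hQ]
  refine eval_eq_zero_of_mem_cone_imClos hd hb (fun s => ?_) hu
  rw [← hQ]
  exact h1 s v hv

theorem sub_mem_cone_secantVariety {n : ℕ} {Z : Set (Pr n)} {u v : Fin (n + 1) → ℂ}
    (hu : u ∈ cone Z) (hv : v ∈ cone Z) (huv : u - v ≠ 0) : u - v ∈ cone (secantVariety Z) := by
  refine ⟨huv, subset_algClosure _ ⟨u, v, hu, hv, ?_⟩⟩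
  have h1 : u - v ∈ Submodule.span ℂ {u, v} :=
    Submodule.mem_span_pair.2 ⟨1, -1, by simp [sub_eq_add_neg]⟩
  refine Submodule.span_le.2 (Set.singleton_subset_iff.2 h1) ?_
  rw [← span_rep_eq ⟨huv, rfl⟩]
  exact Submodule.mem_span_singleton_self _

/-- The exponents of the ten cubic monomials in three variables. -/
def ternaryCubicExp : Fin 10 → Fin 3 → ℕ :=
  ![![3, 0, 0], ![0, 3, 0], ![2, 1, 0], ![2, 0, 1], ![1, 2, 0], ![1, 1, 1], ![1, 0, 2], ![0, 2, 1],
    ![0, 1, 2], ![0, 0, 3]]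

theorem ternaryCubicExp_injective : Function.Injective ternaryCubicExp := by
  intro i j h
  have h0 := congrFun h 0
  have h1 := congrFun h 1
  fin_cases i <;> fin_cases j <;> first | rfl | (exfalso; simp [ternaryCubicExp] at h0 h1)

theorem exists_ternaryCubicExp_eq (m : Fin 3 →₀ ℕ) (hm : m 0 + m 1 + m 2 = 3) :
    ∃ k, Finsupp.equivFunOnFinite.symm (ternaryCubicExp k) = m := by
  have key : ∀ k, ternaryCubicExp k 0 = m 0 → ternaryCubicExp k 1 = m 1 →
      ternaryCubicExp k 2 = m 2 → Finsupp.equivFunOnFinite.symm (ternaryCubicExp k) = m := by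
    intro k h0 h1 h2
    ext i
    rw [Finsupp.equivFunOnFinite_symm_apply_apply]
    fin_cases i
    exacts [h0, h1, h2]
  have : ∃ k, ternaryCubicExp k 0 = m 0 ∧ ternaryCubicExp k 1 = m 1 ∧
      ternaryCubicExp k 2 = m 2 := by
    generalize m 0 = a at *
    generalize m 1 = b at *
    generalize m 2 = c at *
    obtain rfl : c = 3 - a - b := by omega
    have ha : a ≤ 3 := by omega
    have hb : b ≤ 3 := by omega
    clear key
    interval_cases a <;> interval_cases b <;> first
      | (exfalso; omega)
      | exact ⟨0, rfl, rfl, rfl⟩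
      | exact ⟨1, rfl, rfl, rfl⟩
      | exact ⟨2, rfl, rfl, rfl⟩
      | exact ⟨3, rfl, rfl, rfl⟩
      | exact ⟨4, rfl, rfl, rfl⟩
      | exact ⟨5, rfl, rfl, rfl⟩
      | exact ⟨6, rfl, rfl, rfl⟩
      | exact ⟨7, rfl, rfl, rfl⟩
      | exact ⟨8, rfl, rfl, rfl⟩
      | exact ⟨9, rfl, rfl, rfl⟩
  obtain ⟨k, h0, h1, h2⟩ := this
  exact ⟨k, key k h0 h1 h2⟩

theorem eval_ternary_cubic {h : Pl 3} (hh : h.IsHomogeneous 3) (s : Fin 3 → ℂ) :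
    eval s h = ∑ k, coeff (Finsupp.equivFunOnFinite.symm (ternaryCubicExp k)) h *
      ∏ i, s i ^ ternaryCubicExp k i := by
  have hinj : Function.Injective fun k => Finsupp.equivFunOnFinite.symm (ternaryCubicExp k) :=
    Finsupp.equivFunOnFinite.symm.injective.comp ternaryCubicExp_injective
  have hsub : h.support ⊆ Finset.univ.map ⟨_, hinj⟩ := by
    intro m hm
    have hd := hh (mem_support_iff.1 hm)
    rw [Finsupp.weight_apply, Finsupp.sum_fintype _ _ (by simp), Fin.sum_univ_three] at hd
    have h3 : m 0 + m 1 + m 2 = 3 := by simpa using hd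
    obtain ⟨k, hk⟩ := exists_ternaryCubicExp_eq m h3
    exact Finset.mem_map.2 ⟨k, Finset.mem_univ _, hk⟩
  rw [eval_eq', Finset.sum_subset hsub fun m _ hm => by rw [notMem_support_iff.1 hm, zero_mul],
    Finset.sum_map]
  rfl

theorem eval_eq_sum_cubicJet {h : Pl 3} (hh : h.IsHomogeneous 3) (h0 : eval ![1, 0, 0] h = 0)
    (h1 : eval ![0, 1, 0] h = 0) (s : Fin 3 → ℂ) :
    eval s h = ∑ l, coeff (Finsupp.equivFunOnFinite.symm (cubicExp l)) h * cubicJet 0 s l := by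
  rw [eval_ternary_cubic hh, Fin.sum_univ_succ, Fin.sum_univ_succ] at h0 h1 ⊢
  have e0 : coeff (Finsupp.equivFunOnFinite.symm (ternaryCubicExp 0)) h = 0 := by
    rw [← h0]
    simp [Fin.sum_univ_succ, Fin.prod_univ_succ, ternaryCubicExp]
  have e1 : coeff (Finsupp.equivFunOnFinite.symm (ternaryCubicExp (Fin.succ 0))) h = 0 := by
    rw [← h1]
    simp [Fin.sum_univ_succ, Fin.prod_univ_succ, ternaryCubicExp]
  rw [e0, e1, zero_mul, zero_mul, zero_add, zero_add]
  refine Finset.sum_congr rfl fun l _ => ?_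
  have hl : ternaryCubicExp l.succ.succ = cubicExp l := by fin_cases l <;> rfl
  rw [hl]
  simp [cubicJet, jet]

/-- The coordinate change of the plane with columns `p`, `q` and the last basis vector. -/
def planeCoord (p q s : Fin 3 → ℂ) : Fin 3 → ℂ := fun j =>
  p j * s 0 + q j * s 1 + (![0, 0, 1] : Fin 3 → ℂ) j * s 2

theorem planeCoord_surjective {p q : Fin 3 → ℂ} (h : p 0 * q 1 - p 1 * q 0 ≠ 0) :
    Function.Surjective (planeCoord p q) := by
  intro t
  set D := p 0 * q 1 - p 1 * q 0 with hD
  refine ⟨![(t 0 * q 1 - t 1 * q 0) / D, (p 0 * t 1 - p 1 * t 0) / D,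
    t 2 - p 2 * ((t 0 * q 1 - t 1 * q 0) / D) - q 2 * ((p 0 * t 1 - p 1 * t 0) / D)], ?_⟩
  funext j
  fin_cases j
  · simp [planeCoord]
    field_simp
    rw [hD]
    ring
  · simp [planeCoord]
    field_simp
    rw [hD]
    ring
  · simp [planeCoord]

/-- The substitution of forms defined by `planeCoord`. -/
def planeSubst (p q : Fin 3 → ℂ) (j : Fin 3) : Pl 3 :=
  C (p j) * X 0 + C (q j) * X 1 + C ((![0, 0, 1] : Fin 3 → ℂ) j) * X 2

theorem isHomogeneous_planeSubst (p q : Fin 3 → ℂ) (j : Fin 3) :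
    (planeSubst p q j).IsHomogeneous 1 :=
  ((isHomogeneous_C_mul_X _ _).add (isHomogeneous_C_mul_X _ _)).add (isHomogeneous_C_mul_X _ _)

theorem eval_aeval_planeSubst (p q s : Fin 3 → ℂ) (h : Pl 3) :
    eval s (aeval (planeSubst p q) h) = eval (planeCoord p q s) h := by
  rw [eval_aeval]
  congr 2
  funext j
  simp [planeSubst, planeCoord]

/-- The cubics `b` parametrize, up to a change of coordinates of the plane, the surface with
coefficient matrix `B` in the eight standard monomials. -/
structure IsCubicParam (b : Fin 8 → Pl 3) (B : Matrix (Fin 8) (Fin 8) ℂ) : Prop where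
  isHomogeneous : ∀ k, (b k).IsHomogeneous 3
  isUnit_det : IsUnit B.det
  exists_eval_eq : ∀ s, ∃ t, (fun k => eval t (b k)) = B.mulVec (cubicJet 0 s)
  exists_eq_eval : ∀ t, ∃ s, (fun k => eval t (b k)) = B.mulVec (cubicJet 0 s)

theorem exists_isCubicParam {P : Fin 2 × Fin 3 → ℂ}
    (hP : P (0, 0) * P (1, 1) - P (0, 1) * P (1, 0) ≠ 0) {b : Fin 8 → Pl 3}
    (hb : IsBasisOf b (linSysV 3 3 1 (Set.range fun i : Fin 2 => fun j => P (i, j)))) :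
    ∃ B, IsCubicParam b B := by
  have hom : ∀ k, (b k).IsHomogeneous 3 := fun k => (Submodule.mem_inf.1 (hb.1 k)).1
  have hvan : ∀ k i, eval (fun j => P (i, j)) (b k) = 0 := by
    intro k i
    have h1 := (Submodule.mem_inf.1 (hb.1 k)).2
    simp only [Submodule.mem_iInf] at h1
    exact h1 [] (by simp) _ ⟨i, rfl⟩
  set p : Fin 3 → ℂ := fun j => P (0, j) with hp
  set q : Fin 3 → ℂ := fun j => P (1, j) with hq
  have hsurj : Function.Surjective (planeCoord p q) := planeCoord_surjective hP
  let h : Fin 8 → Pl 3 := fun k => aeval (planeSubst p q) (b k)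
  let B : Matrix (Fin 8) (Fin 8) ℂ := Matrix.of fun k l =>
    coeff (Finsupp.equivFunOnFinite.symm (cubicExp l)) (h k)
  have hh : ∀ k, (h k).IsHomogeneous 3 := fun k =>
    (hom k).aeval _ (isHomogeneous_planeSubst p q)
  have hB : ∀ s, (fun k => eval (planeCoord p q s) (b k)) = B.mulVec (cubicJet 0 s) := by
    intro s
    funext k
    rw [← eval_aeval_planeSubst]
    refine eval_eq_sum_cubicJet (hh k) ?_ ?_ s
    · rw [eval_aeval_planeSubst]
      convert hvan k 0 using 3
      funext j
      simp [planeCoord, p]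
    · rw [eval_aeval_planeSubst]
      convert hvan k 1 using 3
      funext j
      simp [planeCoord, q]
  have hex : ∀ t, ∃ s, (fun k => eval t (b k)) = B.mulVec (cubicJet 0 s) := fun t => by
    obtain ⟨s, rfl⟩ := hsurj t
    exact ⟨s, hB s⟩
  refine ⟨B, hom, ?_, fun s => ⟨_, hB s⟩, hex⟩
  rw [isUnit_iff_ne_zero]
  intro hdet
  obtain ⟨c, hc, hcB⟩ := Matrix.exists_vecMul_eq_zero_iff.2 hdet
  have hsum : ∑ k, c k • b k = 0 := MvPolynomial.funext fun t => by
    obtain ⟨s, hs⟩ := hex t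
    rw [map_sum, map_zero]
    have h2 : ∑ k, eval t (c k • b k) = c ⬝ᵥ fun k => eval t (b k) := by
      simp [dotProduct, smul_eval]
    rw [h2, hs, Matrix.dotProduct_mulVec, hcB, zero_dotProduct]
  exact hc (funext fun k => Fintype.linearIndependent_iff.1 hb.2.1 c hsum k)

theorem isPolyFn_linearMap {m n : ℕ} (L : (Fin m → ℂ) →ₗ[ℂ] (Fin n → ℂ)) (k : Fin n) :
    IsPolyFn fun v => L v k := by
  have h : ∀ v, L v = (LinearMap.toMatrix' L).mulVec v := fun v => by
    rw [← Matrix.toLin'_apply, Matrix.toLin'_toMatrix']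
  simp only [h]
  exact IsPolyFn.mulVec (M := fun _ => LinearMap.toMatrix' L) (w := fun v => v)
    (fun _ _ => IsPolyFn.const _) IsPolyFn.coord k

theorem eval_zero_of_isHomogeneous {ι : Type*} {p : MvPolynomial ι ℂ} {d : ℕ}
    (hp : p.IsHomogeneous d) (hd : d ≠ 0) : eval (0 : ι → ℂ) p = 0 := by
  have h := eval_smul_of_isHomogeneous hp 0 (0 : ι → ℂ)
  rwa [smul_zero, zero_pow hd, zero_mul] at h

theorem mem_linSys_two {n d : ℕ} (hd : d ≠ 0) {Z : Set (Pr n)} {f : Pl (n + 1)} :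
    f ∈ linSys d 2 Z ↔ f.IsHomogeneous d ∧ ∀ v ∈ cone Z, ∀ i, eval v (pderiv i f) = 0 := by
  simp only [linSys, linSysV, Submodule.mem_inf, mem_homogeneousSubmodule, Submodule.mem_iInf]
  refine and_congr_right fun hf => ⟨fun h v hv i => h [i] (by simp) v hv, fun h l hl v hv => ?_⟩
  match l, hl with
  | [], _ =>
    have h1 := congrArg (eval v) hf.sum_X_mul_pderiv
    rw [map_sum, Finset.sum_eq_zero fun i _ => by rw [map_mul, h v hv, mul_zero], map_nsmul] at h1
    exact (smul_eq_zero.1 h1.symm).resolve_left hd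
  | [i], _ => exact h v hv i

theorem forall_mem_cone_projIm_projIm_imClos_iff {k m n r d e : ℕ} (hd : d ≠ 0)
    {b : Fin (m + 1) → Pl k} (hb : ∀ i, (b i).IsHomogeneous d)
    {L₁ : (Fin (m + 1) → ℂ) →ₗ[ℂ] (Fin (n + 1) → ℂ)}
    {L₂ : (Fin (n + 1) → ℂ) →ₗ[ℂ] (Fin (r + 1) → ℂ)}
    {q : Pl (r + 1)} (he : e ≠ 0) (hq : q.IsHomogeneous e) :
    (∀ v ∈ cone (projIm L₂ (projIm L₁ (imClos b))), eval v q = 0) ↔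
      ∀ s, eval (L₂ (L₁ fun i => eval s (b i))) q = 0 := by
  constructor
  · intro h s
    by_cases h2 : L₂ (L₁ fun i => eval s (b i)) = 0
    · rw [h2, eval_zero_of_isHomogeneous hq he]
    · have h1 : L₁ (fun i => eval s (b i)) ≠ 0 := fun h0 => h2 (by rw [h0, map_zero])
      have h0 : (fun i => eval s (b i)) ≠ 0 := fun h0 => h1 (by rw [h0, map_zero])
      exact h _ (apply_mem_cone_projIm (apply_mem_cone_projIm (mem_cone_imClos h0) h1) h2)
  · intro h v hv
    refine eval_eq_zero_of_mem_cone_projIm (fun v hv => ?_) hv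
    obtain ⟨Q₂, hQ₂⟩ : ∃ Q, ∀ v, eval (L₂ v) q = eval v Q :=
      IsPolyFn.eval_const q (isPolyFn_linearMap L₂)
    rw [hQ₂]
    refine eval_eq_zero_of_mem_cone_projIm (fun v hv => ?_) hv
    obtain ⟨Q₁, hQ₁⟩ : ∃ Q, ∀ v, eval (L₁ v) Q₂ = eval v Q :=
      IsPolyFn.eval_const Q₂ (isPolyFn_linearMap L₁)
    rw [hQ₁]
    refine eval_eq_zero_of_mem_cone_imClos hd hb (fun s => ?_) hv
    rw [← hQ₁, ← hQ₂]
    exact h s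

theorem toMatrix_mul_mulVec (L₁ : (Fin 8 → ℂ) →ₗ[ℂ] (Fin 7 → ℂ))
    (L₂ : (Fin 7 → ℂ) →ₗ[ℂ] (Fin 6 → ℂ)) (B : Matrix (Fin 8) (Fin 8) ℂ) (v : Fin 8 → ℂ) :
    (LinearMap.toMatrix' L₂ * (LinearMap.toMatrix' L₁ * B)).mulVec v = L₂ (L₁ (B.mulVec v)) := by
  rw [← Matrix.mulVec_mulVec, ← Matrix.mulVec_mulVec, ← Matrix.toLin'_apply, ← Matrix.toLin'_apply,
    Matrix.toLin'_toMatrix', Matrix.toLin'_toMatrix']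

namespace IsCubicParam

variable {b : Fin 8 → Pl 3} {B : Matrix (Fin 8) (Fin 8) ℂ}

theorem h0_eq_finrank (h : IsCubicParam b B) (L₁ : (Fin 8 → ℂ) →ₗ[ℂ] (Fin 7 → ℂ))
    (L₂ : (Fin 7 → ℂ) →ₗ[ℂ] (Fin 6 → ℂ)) :
    h0 5 2 (projIm (N := 6) (n := 5) L₂ (projIm (N := 7) L₁ (imClos (n := 7) b))) =
      Module.finrank ℂ
        (doubleQuintics (LinearMap.toMatrix' L₂ * (LinearMap.toMatrix' L₁ * B))) := by
  have key : linSys 5 2 (projIm (N := 6) (n := 5) L₂ (projIm (N := 7) L₁ (imClos (n := 7) b))) =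
      (doubleQuintics (LinearMap.toMatrix' L₂ * (LinearMap.toMatrix' L₁ * B))).map
        (homogeneousSubmodule (Fin 6) ℂ 5).subtype := by
    ext f
    rw [mem_linSys_two (by norm_num)]
    have hiff : ∀ hf : f.IsHomogeneous 5,
        (∀ v ∈ cone (projIm (N := 6) (n := 5) L₂ (projIm (N := 7) L₁ (imClos (n := 7) b))),
          ∀ i, eval v (pderiv i f) = 0) ↔
        ∀ s i, eval (L₂ (L₁ (B.mulVec (cubicJet 0 s)))) (pderiv i f) = 0 := by
      intro hf
      have h1 := fun i => forall_mem_cone_projIm_projIm_imClos_iff (L₁ := L₁) (L₂ := L₂)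
        (by norm_num) h.isHomogeneous (by norm_num) (hf.pderiv (i := i))
      constructor
      · intro hv s i
        obtain ⟨t, ht⟩ := h.exists_eval_eq s
        rw [← ht]
        exact (h1 i).1 (fun v hvc => hv v hvc i) t
      · intro hv v hvc i
        refine (h1 i).2 (fun t => ?_) v hvc
        obtain ⟨s, hs⟩ := h.exists_eq_eval t
        rw [hs]
        exact hv s i
    constructor
    · rintro ⟨hf, hv⟩
      refine ⟨⟨f, hf⟩, mem_doubleQuintics.2 fun s i => ?_, rfl⟩
      rw [toMatrix_mul_mulVec]
      exact (hiff hf).1 hv s i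
    · rintro ⟨⟨g, hg⟩, hmem, rfl⟩
      refine ⟨hg, (hiff hg).2 fun s i => ?_⟩
      rw [← toMatrix_mul_mulVec]
      exact mem_doubleQuintics.1 hmem s i
  rw [h0, key]
  exact Submodule.finrank_map_subtype_eq _ _

theorem mulVec_injective (h : IsCubicParam b B) : Function.Injective B.mulVec :=
  Matrix.mulVec_injective_iff_isUnit.2 ((Matrix.isUnit_iff_isUnit_det B).2 h.isUnit_det)

theorem mulVec_sampleCenter_mem_cone (h : IsCubicParam b B) :
    B.mulVec sampleCenter ∈ cone (secantVariety (imClos (n := 7) b)) := by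
  have hne : ∀ v, v ≠ 0 → B.mulVec v ≠ 0 := fun v hv h0 =>
    hv (h.mulVec_injective (h0.trans (Matrix.mulVec_zero B).symm))
  have hcone : ∀ s, cubicJet 0 s ≠ 0 → B.mulVec (cubicJet 0 s) ∈ cone (imClos (n := 7) b) := by
    intro s hs
    obtain ⟨t, ht⟩ := h.exists_eval_eq s
    have h1 := hne _ hs
    rw [← ht] at h1 ⊢
    exact mem_cone_imClos h1
  have h7 : ∀ s : Fin 3 → ℂ, s 2 = 1 → cubicJet 0 s ≠ 0 := by
    intro s hs h0
    have := congrFun h0 7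
    simp [cubicJet, jet, cubicExp, Fin.prod_univ_succ, hs] at this
  have hz : sampleCenter ≠ 0 := fun h0 => by
    have := congrFun h0 0
    simp [sampleCenter] at this
  have hsub := cubicJet_sub_eq_sampleCenter
  rw [← hsub, Matrix.mulVec_sub]
  refine sub_mem_cone_secantVariety (hcone _ (h7 _ rfl)) (hcone _ (h7 _ rfl)) ?_
  rw [← Matrix.mulVec_sub, hsub]
  exact hne _ hz

theorem eq_zero_of_mem_cone_secantVariety (h : IsCubicParam b B) {p : (Fin 8 → ℂ) → ℂ}
    (hp : IsPolyFn p)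
    (hsec : ∀ (α β : ℂ) (u v : Fin 3 → ℂ), p (α • cubicJet 0 u + β • cubicJet 0 v) = 0)
    {w : Fin 8 → ℂ} (hw : w ∈ cone (secantVariety (imClos (n := 7) b))) :
    p (B⁻¹.mulVec w) = 0 := by
  have hp2 : IsPolyFn fun w => p (B⁻¹.mulVec w) :=
    IsPolyFn.comp hp (w := fun w => B⁻¹.mulVec w)
      (IsPolyFn.mulVec (fun _ _ => IsPolyFn.const _) IsPolyFn.coord)
  refine eq_zero_of_mem_cone_secantVariety_imClos (by norm_num) h.isHomogeneous hp2
    (fun α β s t => ?_) hw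
  obtain ⟨u, hu⟩ := h.exists_eq_eval s
  obtain ⟨v, hv⟩ := h.exists_eq_eval t
  rw [hu, hv, ← Matrix.mulVec_smul, ← Matrix.mulVec_smul, ← Matrix.mulVec_add,
    Matrix.mulVec_mulVec, Matrix.nonsing_inv_mul _ h.isUnit_det, Matrix.one_mulVec]
  exact hsec α β u v

theorem le_finrank (h : IsCubicParam b B) {z : Fin 8 → ℂ}
    (hz : z ∈ cone (secantVariety (imClos (n := 7) b))) {L₁ : (Fin 8 → ℂ) →ₗ[ℂ] (Fin 7 → ℂ)}
    (hL₁ : L₁ z = 0) (L₂ : (Fin 7 → ℂ) →ₗ[ℂ] (Fin 6 → ℂ)) :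
    8 ≤ Module.finrank ℂ
      (doubleQuintics (LinearMap.toMatrix' L₂ * (LinearMap.toMatrix' L₁ * B))) := by
  have hB : B.mulVec (B⁻¹.mulVec z) = z := by
    rw [Matrix.mulVec_mulVec, Matrix.mul_nonsing_inv _ h.isUnit_det, Matrix.one_mulVec]
  refine le_finrank_doubleQuintics _ (z := B⁻¹.mulVec z) (fun h0 => ?_) ?_
    fun p hp hsec => h.eq_zero_of_mem_cone_secantVariety hp hsec hz
  · rw [h0, Matrix.mulVec_zero] at hB
    exact hz.1 hB.symm
  · rw [toMatrix_mul_mulVec, hB, hL₁, map_zero]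

end IsCubicParam

/-! ## STATEMENT 10
For a general surface `S'₂₆ ⊆ ℙ⁵` (the projection from a general point outside
the secant variety of the septic surface with one node in `ℙ⁶`, itself the
projection of a smooth del Pezzo surface of degree 7 in `ℙ⁷` from a general
point of its secant variety), the space `H⁰(𝐼²_{S'₂₆}(5))` of quintic forms
vanishing to order `≥ 2` along `S'₂₆` has dimension 8, so
`|H⁰(𝐼²_{S'₂₆}(5))| = ℙ⁷`. -/
theorem h0_quintics_double_along_S26' :
    GenericAff (ι := Fin 2 × Fin 3) fun P =>
      ∀ b : Fin 8 → Pl 3,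
        IsBasisOf b (linSysV 3 3 1 (Set.range fun i : Fin 2 => fun j => P (i, j))) →
        Generically (secantVariety (imClos (n := 7) b)) fun z1 =>
          ∀ L1 : (Fin 8 → ℂ) →ₗ[ℂ] (Fin 7 → ℂ), Function.Surjective L1 →
            LinearMap.ker L1 = Submodule.span ℂ {z1.rep} →
            Generically (Set.univ : Set (Pr 6)) fun z2 =>
              z2 ∉ secantVariety (projIm L1 (imClos (n := 7) b)) →
              ∀ L2 : (Fin 7 → ℂ) →ₗ[ℂ] (Fin 6 → ℂ), Function.Surjective L2 →
                LinearMap.ker L2 = Submodule.span ℂ {z2.rep} →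
                h0 5 2 (projIm L2 (projIm L1 (imClos (n := 7) b))) = 8 := by
  refine ⟨X (0, 0) * X (1, 1) - X (0, 1) * X (1, 0), fun h => ?_, fun P hP b hb => ?_⟩
  · have h1 := congrArg
      (eval fun ij : Fin 2 × Fin 3 => if ij.1.val = ij.2.val then (1 : ℂ) else 0) h
    simp at h1
  simp only [map_sub, map_mul, eval_X] at hP
  obtain ⟨B, hB⟩ := exists_isCubicParam hP hb
  refine generically_of_isPolyFn (isPolyFn_firstCondition B) hB.mulVec_sampleCenter_mem_cone
    (firstCondition_ne_zero hB.isUnit_det) fun z₁ hz₁ z hz hzp L₁ hL₁ hker₁ => ?_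
  rw [span_rep_eq hz] at hker₁
  obtain ⟨p, hp, ⟨y₀, hy₀, hpy₀⟩, hle⟩ := exists_secondCondition hB.isUnit_det hzp L₁ hL₁ hker₁
  refine generically_of_isPolyFn hp (w := y₀) ⟨hy₀, Set.mem_univ _⟩ hpy₀
    fun z₂ _ y hy hpy _ L₂ hL₂ hker₂ => ?_
  rw [span_rep_eq hy] at hker₂
  rw [hB.h0_eq_finrank]
  refine le_antisymm (hle y hpy L₂ hL₂ hker₂) ?_
  refine hB.le_finrank (cone_mono (Set.singleton_subset_iff.2 hz₁) hz) ?_ L₂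
  rw [← LinearMap.mem_ker, hker₁]
  exact Submodule.mem_span_singleton_self z

end CF
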